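/- (Theorem 3) Suppose p = (p_1,…,p_k) ∈ [1,∞]^k satisfies ∑_{j=1}^k p_j^{-1} > 1 and the point b(p) lies in the interior of the Newton polytope P. Then, provided the support of a is contained in a sufficiently small neighborhood of 0, there is a finite constant C such that |S(f_1,…,f_k)| ≤ C ∏_{j=1}^k ‖f_j‖_{L^{p_j}(ℝ^{n-1})} for all measurable f_j; i.e., S is of strong type (p_1,…,p_k). -/

import Mathlib

open MeasureTheory Set Metric
open scoped ENNReal NNReal

noncomputable section

/-- `E n` is Euclidean space `ℝ^n`. -/
abbrev E (n : ℕ) : Type := EuclideanSpace ℝ (Fin n)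

/-- The Lie bracket `[X,Y]` of two vector fields on `ℝ^n`. -/
def lieB {n : ℕ} (X Y : E n → E n) : E n → E n :=
  fun x => fderiv ℝ Y x (X x) - fderiv ℝ X x (Y x)

/-- The iterated Lie bracket `X_w` associated to a (nonempty) word `w`.
Words are represented as lists with the *last* letter at the head, so that
`X_{(w,j)} = [X_w, X_j]` corresponds to `XW X (j :: w) = [XW X w, X j]`. -/
def XW {n k : ℕ} (X : Fin k → E n → E n) : List (Fin k) → E n → E n
  | [] => fun _ => 0
  | [j] => X j
  | j :: w => lieB (XW X w) (X j)

/-- The degree of an `n`-tuple of words `I`: `degI I j` counts the total number of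
occurrences of the letter `j`. -/
def degI {n k : ℕ} (I : Fin n → List (Fin k)) (j : Fin k) : ℕ := ∑ i, (I i).count j

/-- `λ_I(x) = det (X_{w_1}(x), …, X_{w_n}(x))`. -/
def lam {n k : ℕ} (X : Fin k → E n → E n) (I : Fin n → List (Fin k)) (x : E n) : ℝ :=
  Matrix.det (Matrix.of fun i i' => XW X (I i) x i')

/-- `δ^β = ∏_j δ_j^{β_j}`. -/
def dpow {k : ℕ} (δ : Fin k → ℝ) (β : Fin k → ℕ) : ℝ := ∏ j, δ j ^ β j

/-- Membership in the finite collection `𝐈` of `n`-tuples of (nonempty) words whose degrees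
are bounded by `D` in each component. -/
def inIset {n k : ℕ} (D : ℝ) (I : Fin n → List (Fin k)) : Prop :=
  (∀ i, I i ≠ []) ∧ ∀ j, (degI I j : ℝ) ≤ D

/-- the total degree `d` of an `n`-tuple of words -/
def degTot {n k : ℕ} (I : Fin n → List (Fin k)) : ℝ := ∑ j, (degI I j : ℝ)

/-- `|Λ_δ(x)|`: the (sup-norm) size of the vector `(δ^{deg I} λ_I(x))_{I ∈ 𝐈}`,
where `𝐈` is the set of `n`-tuples of words of degree at most `D` in each letter. -/
def LamSup {n k : ℕ} (X : Fin k → E n → E n) (D : ℝ) (δ : Fin k → ℝ) (x : E n) : ℝ :=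
  sSup {r | ∃ I : Fin n → List (Fin k), inIset D I ∧ r = dpow δ (degI I) * |lam X I x|}

/-- The Newton polytope `P` of the vector fields `X_1,…,X_k`: the closed convex hull of
`{b : b ≥ deg I for some I with λ_I(0) ≠ 0}`. -/
def newtonP (n k : ℕ) (X : Fin k → E n → E n) : Set (Fin k → ℝ) :=
  closure (convexHull ℝ {b : Fin k → ℝ | ∃ I : Fin n → List (Fin k),
    (∀ i, I i ≠ []) ∧ lam X I 0 ≠ 0 ∧ ∀ j, (degI I j : ℝ) ≤ b j})

/-- `b(p)_i = p_i⁻¹ / (∑_j p_j⁻¹ − 1)`. -/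
def bOf {k : ℕ} (p : Fin k → ℝ≥0∞) : Fin k → ℝ :=
  fun i => ((p i)⁻¹).toReal / ((∑ j, ((p j)⁻¹).toReal) - 1)

/-- `φ j` is the flow of the vector field `X j`: `φ j t x = e^{tX_j}(x)`. -/
def IsFlowOf {n k : ℕ} (X : Fin k → E n → E n) (φ : Fin k → ℝ → E n → E n) : Prop :=
  (∀ j x, φ j 0 x = x) ∧ ∀ j x t, HasDerivAt (fun s => φ j s x) (X j (φ j t x)) t

/-- The multi-parameter Carnot–Carathéodory ball `B(x; δ_1,…,δ_k)`: the closure of the set of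
points reachable from `x` by flowing along the vector fields `δ_{j_i} X_{j_i}` for total time
at most 1. -/
def ccBall {n k : ℕ} (φ : Fin k → ℝ → E n → E n) (δ : Fin k → ℝ) (x : E n) : Set (E n) :=
  closure {y | ∃ L : List (Fin k × ℝ), (L.map fun q => |q.2|).sum ≤ 1 ∧
    y = L.foldl (fun z q => φ q.1 (q.2 * δ q.1) z) x}

/-- The restricted ball `B_𝐣(x;δ)` for a sequence `𝐣 ∈ {1,…,k}^n`. -/
def ccBallJ {n k : ℕ} (φ : Fin k → ℝ → E n → E n) (δ : Fin k → ℝ) (js : Fin n → Fin k)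
    (x : E n) : Set (E n) :=
  closure {y | ∃ t : Fin n → ℝ, (∀ i, |t i| ≤ 1) ∧
    y = (List.finRange n).foldl (fun z i => φ (js i) (t i * δ (js i)) z) x}

/-- A central set of width `w` (with centrality constant `A`): a subset of `[-w,w]` of positive
measure meeting every interval `I` in measure `≤ A (|I|/w)^ε |S|`. -/
def IsCentral (ε A w : ℝ) (S : Set ℝ) : Prop :=
  S ⊆ Set.Icc (-w) w ∧ MeasurableSet S ∧ 0 < volume S ∧
  ∀ a b : ℝ, a ≤ b →
    (volume (Set.Icc a b ∩ S)).toReal ≤ A * ((b - a) / w) ^ ε * (volume S).toReal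


open MeasureTheory Set Metric
open scoped ENNReal NNReal
noncomputable section

lemma pd_coeff_prod (w : ℝ) (hw : 0 ≤ w) {ι : Type*} (S : Finset ι) (u : ι → ℝ)
    (hu : ∀ i ∈ S, |u i| ≤ w) (d : ℕ) :
    |(∏ i ∈ S, (Polynomial.X - Polynomial.C (u i))).coeff d| * w ^ d ≤ 2 ^ S.card * w ^ S.card := by
  classical
  induction S using Finset.induction_on generalizing d with
  | empty =>
    rcases Nat.eq_zero_or_pos d with rfl | hd
    · simp
    · simp [Polynomial.coeff_one, hd.ne']
  | insert a S ha ih =>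
    have hu' : ∀ i ∈ S, |u i| ≤ w := fun i hi => hu i (Finset.mem_insert_of_mem hi)
    have hua := hu a (Finset.mem_insert_self _ _)
    rw [Finset.prod_insert ha, Finset.card_insert_of_notMem ha]
    set p := ∏ i ∈ S, (Polynomial.X - Polynomial.C (u i)) with hp
    have h0 := ih hu' d
    have h2 : |u a * p.coeff d| * w ^ d ≤ w * (2 ^ S.card * w ^ S.card) := by
      rw [abs_mul, mul_assoc]
      exact mul_le_mul hua h0 (by positivity) hw
    rcases d with _ | d
    · have : ((Polynomial.X - Polynomial.C (u a)) * p).coeff 0 = -(u a * p.coeff 0) := by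
        rw [sub_mul]; simp
      rw [this, abs_neg]
      calc _ ≤ w * (2 ^ S.card * w ^ S.card) := h2
        _ ≤ 2 * (w * (2 ^ S.card * w ^ S.card)) := by
          have : 0 ≤ w * (2 ^ S.card * w ^ S.card) := by positivity
          linarith
        _ = _ := by ring
    · have : ((Polynomial.X - Polynomial.C (u a)) * p).coeff (d+1)
          = p.coeff d - (u a * p.coeff (d+1)) := by
        rw [sub_mul]; simp
      rw [this]
      have h1 := ih hu' d
      have h3 : |p.coeff d| * w ^ (d+1) ≤ w * (2 ^ S.card * w ^ S.card) := by
        rw [pow_succ]; nlinarith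
      have h4 := abs_sub (p.coeff d) (u a * p.coeff (d+1))
      calc _ ≤ (|p.coeff d| + |u a * p.coeff (d+1)|) * w ^ (d+1) := by gcongr
        _ ≤ 2 * (w * (2 ^ S.card * w ^ S.card)) := by rw [add_mul]; linarith
        _ = _ := by ring

/-- Lagrange bound. -/
lemma pd_lagrange (D : ℕ) (w σ h : ℝ) (hw : 0 < w) (hσ : 0 < σ) (hh : 0 ≤ h)
    (s : Fin (D+1) → ℝ) (hs : ∀ i, |s i| ≤ w) (hsep : ∀ i j, i ≠ j → σ * w ≤ |s i - s j|)
    (q : Polynomial ℝ) (hq : q.natDegree ≤ D) (hqs : ∀ i, |q.eval (s i)| ≤ h) (d : ℕ) :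
    |q.coeff d| * w ^ d ≤ (D+1) * (h * (2 ^ D / σ ^ D)) := by
  classical
  have hinj : Set.InjOn s (Finset.univ : Finset (Fin (D+1))) := by
    intro i _ j _ hij
    by_contra hne
    have := hsep i j hne
    rw [hij, sub_self, abs_zero] at this
    have : 0 < σ * w := by positivity
    linarith
  have hdeg : q.degree < (Finset.univ : Finset (Fin (D+1))).card := by
    rw [Finset.card_univ, Fintype.card_fin]
    refine lt_of_le_of_lt Polynomial.degree_le_natDegree ?_
    exact_mod_cast Nat.lt_succ_of_le hq
  have heq := Lagrange.eq_interpolate hinj hdeg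
  rw [Lagrange.interpolate_apply] at heq
  have hc : q.coeff d = ∑ i, q.eval (s i) *
      (Lagrange.basis Finset.univ s i).coeff d := by
    conv_lhs => rw [heq]
    rw [Polynomial.finsetSum_coeff]
    simp [Polynomial.coeff_C_mul]
  have hb : ∀ i, |(Lagrange.basis Finset.univ s i).coeff d| * w ^ d ≤ 2 ^ D / σ ^ D := by
    intro i
    have : Lagrange.basis Finset.univ s i =
        Polynomial.C (∏ j ∈ Finset.univ.erase i, (s i - s j)⁻¹) *
        ∏ j ∈ Finset.univ.erase i, (Polynomial.X - Polynomial.C (s j)) := by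
      rw [Lagrange.basis, map_prod, ← Finset.prod_mul_distrib]
      rfl
    rw [this, Polynomial.coeff_C_mul, abs_mul, mul_assoc]
    have h1 := pd_coeff_prod w hw.le (Finset.univ.erase i) s (fun i _ => hs i) d
    have hcard : (Finset.univ.erase i : Finset (Fin (D+1))).card = D := by
      rw [Finset.card_erase_of_mem (Finset.mem_univ _)]; simp
    rw [hcard] at h1
    have h2 : |∏ j ∈ Finset.univ.erase i, (s i - s j)⁻¹| ≤ ((σ * w)⁻¹) ^ D := by
      rw [Finset.abs_prod]
      have h3 : ((σ * w)⁻¹) ^ D = ∏ _j ∈ Finset.univ.erase i, (σ * w)⁻¹ := by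
        rw [Finset.prod_const, hcard]
      rw [h3]
      refine Finset.prod_le_prod (fun _ _ => abs_nonneg _) ?_
      intro j hj
      rw [abs_inv]
      have := hsep i j (Finset.ne_of_mem_erase hj).symm
      exact inv_anti₀ (by positivity) this
    calc _ ≤ ((σ * w)⁻¹) ^ D * (2 ^ D * w ^ D) := by gcongr
      _ = 2 ^ D / σ ^ D := by
        rw [inv_pow, mul_pow]; field_simp
  rw [hc]
  calc |∑ i, q.eval (s i) * (Lagrange.basis Finset.univ s i).coeff d| * w ^ d
      ≤ (∑ i, |q.eval (s i) * (Lagrange.basis Finset.univ s i).coeff d|) * w ^ d := by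
        gcongr; exact Finset.abs_sum_le_sum_abs _ _
    _ = ∑ i, |q.eval (s i)| * (|(Lagrange.basis Finset.univ s i).coeff d| * w ^ d) := by
        rw [Finset.sum_mul]; refine Finset.sum_congr rfl fun i _ => ?_
        rw [abs_mul, mul_assoc]
    _ ≤ ∑ i : Fin (D+1), h * (2 ^ D / σ ^ D) := by
        refine Finset.sum_le_sum fun i _ => ?_
        exact mul_le_mul (hqs i) (hb i) (by positivity) hh
    _ = _ := by simp

/-- greedy choice of separated points -/
lemma pd_greedy (D : ℕ) (ρ : ℝ) (A : Set ℝ) (v : ℝ≥0∞)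
    (hv : ∀ a : ℝ, volume (A ∩ Icc (a - ρ) (a + ρ)) ≤ v)
    (hA : (D+1) * v < volume A) (r : ℕ) (hr : r ≤ D + 1) :
    ∃ s : Fin r → ℝ, (∀ i, s i ∈ A) ∧ ∀ i j, i ≠ j → ρ ≤ |s i - s j| := by
  induction r with
  | zero => exact ⟨Fin.elim0, fun i => i.elim0, fun i => i.elim0⟩
  | succ r ih =>
    obtain ⟨s, hs, hsep⟩ := ih (by omega)
    have : ∃ x ∈ A, ∀ i, x ∉ Icc (s i - ρ) (s i + ρ) := by
      by_contra hcon
      push Not at hcon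
      have hsub : A ⊆ ⋃ i, A ∩ Icc (s i - ρ) (s i + ρ) := by
        intro x hx
        obtain ⟨i, hi⟩ := hcon x hx
        exact mem_iUnion.2 ⟨i, hx, hi⟩
      have h1 : volume A ≤ (r : ℝ≥0∞) * v := by
        calc volume A ≤ volume (⋃ i, A ∩ Icc (s i - ρ) (s i + ρ)) := measure_mono hsub
          _ ≤ ∑ i, volume (A ∩ Icc (s i - ρ) (s i + ρ)) := measure_iUnion_fintype_le _ _
          _ ≤ ∑ _i : Fin r, v := Finset.sum_le_sum fun i _ => hv _
          _ = _ := by simp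
      have h2 : (r : ℝ≥0∞) * v ≤ (D+1) * v := by
        gcongr
        exact_mod_cast (by omega : r ≤ D + 1)
      exact absurd (h1.trans h2) (not_le.2 hA)
    obtain ⟨x, hxA, hx⟩ := this
    have hx' : ∀ i, ρ ≤ |x - s i| := by
      intro i
      by_contra hlt
      push Not at hlt
      rw [abs_lt] at hlt
      exact hx i ⟨by linarith, by linarith⟩
    refine ⟨Fin.cons x s, ?_, ?_⟩
    · intro i; refine Fin.cases ?_ (fun i => ?_) i
      · simpa using hxA
      · simpa using hs i
    · intro i j
      refine Fin.cases ?_ (fun i => ?_) i <;> refine Fin.cases ?_ (fun j => ?_) j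
      · simp
      · intro _; simpa using hx' j
      · intro _; simp only [Fin.cons_zero, Fin.cons_succ]; rw [abs_sub_comm]; exact hx' i
      · intro hne; simp only [Fin.cons_succ]; exact hsep i j (fun h => hne (by rw [h]))

/-- constant -/
def cPoly (D : ℕ) : ℝ := 1 / (2 * ((D+1) * 4 ^ D))

lemma cPoly_pos (D : ℕ) : 0 < cPoly D := by unfold cPoly; positivity

/-- `T ⊆ [-w,w]` is spread. -/
structure Spread (D : ℕ) (θ w : ℝ) (T : Set ℝ) : Prop where
  meas : MeasurableSet T
  sub : T ⊆ Icc (-w) w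
  pos : 0 < volume T
  sp : ∀ a : ℝ, (4 * (D+1)) * volume (T ∩ Icc a (a + θ * w)) ≤ volume T

lemma Spread.lt_top {D : ℕ} {θ w : ℝ} {T : Set ℝ} (h : Spread D θ w T) : volume T < ⊤ :=
  lt_of_le_of_lt (measure_mono h.sub) (by simp)

lemma pd_one {D : ℕ} {θ w : ℝ} {T : Set ℝ} (h : Spread D θ w T) (hθ : 0 < θ) (hw : 0 < w)
    (q : Polynomial ℝ) (hq : q.natDegree ≤ D) (d : ℕ) :
    volume T / 2 ≤ volume {s ∈ T | cPoly D * θ ^ D * (|q.coeff d| * w ^ d) ≤ |q.eval s|} := by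
  set H := cPoly D * θ ^ D * (|q.coeff d| * w ^ d) with hH
  set A := {s ∈ T | |q.eval s| < H} with hA
  have hAm : MeasurableSet A := by
    have : A = T ∩ {s | |q.eval s| < H} := rfl
    rw [this]
    refine h.meas.inter (measurableSet_lt ?_ measurable_const)
    exact (q.continuous.abs).measurable
  have hsub : A ⊆ T := fun s hs => hs.1
  by_contra hlt
  push Not at hlt
  have hT := h.lt_top
  have hAlarge : volume T / 2 < volume A := by
    have hu : T = {s ∈ T | H ≤ |q.eval s|} ∪ A := by
      ext s; constructor
      · intro hs; rcases le_or_gt H |q.eval s| with h1 | h1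
        · exact Or.inl ⟨hs, h1⟩
        · exact Or.inr ⟨hs, h1⟩
      · rintro (h1 | h1) <;> exact h1.1
    have h1 : volume T ≤ volume {s ∈ T | H ≤ |q.eval s|} + volume A := by
      conv_lhs => rw [hu]
      exact measure_union_le _ _
    by_contra hle
    push Not at hle
    have h2 : volume T < volume T / 2 + volume T / 2 :=
      lt_of_le_of_lt h1 (ENNReal.add_lt_add_of_lt_of_le
        (ne_top_of_le_ne_top hT.ne ((measure_mono hsub))) hlt hle)
    rw [ENNReal.add_halves] at h2
    exact lt_irrefl _ h2
  set v := volume T / (4 * (D+1)) with hv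
  have h4 : (4 * ((D:ℝ≥0∞)+1)) ≠ 0 := by simp
  have h4' : (4 * ((D:ℝ≥0∞)+1)) ≠ ⊤ := ENNReal.mul_ne_top (by simp) (by simp)
  obtain ⟨s, hs, hsep⟩ := pd_greedy D (θ / 2 * w) A v (by
      intro a
      have h1 := h.sp (a - θ / 2 * w)
      have h2 : a - θ / 2 * w + θ * w = a + θ / 2 * w := by ring
      rw [h2] at h1
      rw [hv, ENNReal.le_div_iff_mul_le (Or.inl h4) (Or.inl h4'), mul_comm]
      refine le_trans ?_ h1
      gcongr) (by
      refine lt_of_le_of_lt ?_ hAlarge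
      rw [hv, ENNReal.le_div_iff_mul_le (by simp) (by simp)]
      rw [ENNReal.div_eq_inv_mul]
      rw [ENNReal.mul_inv (by simp) (by simp)]
      have e1 : ((D:ℝ≥0∞)+1) * ((D:ℝ≥0∞)+1)⁻¹ = 1 := ENNReal.mul_inv_cancel (by simp) (by simp)
      calc ((D:ℝ≥0∞)+1) * (4⁻¹ * ((D:ℝ≥0∞)+1)⁻¹ * volume T) * 2
          = (((D:ℝ≥0∞)+1) * ((D:ℝ≥0∞)+1)⁻¹) * (4⁻¹ * 2) * volume T := by ring
        _ ≤ 1 * 1 * volume T := by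
          rw [e1]; gcongr
          rw [← ENNReal.div_eq_inv_mul]
          refine ENNReal.div_le_of_le_mul ?_
          norm_num
        _ = volume T := by simp) (D+1) le_rfl
  have hHpos : 0 ≤ H := by
    have := cPoly_pos D
    positivity
  have hL := pd_lagrange D w (θ/2) H hw (by positivity) hHpos s
    (fun i => abs_le.2 (h.sub (hsub (hs i)))) hsep q hq (fun i => (hs i).2.le) d
  rcases (by positivity : 0 ≤ |q.coeff d| * w ^ d).eq_or_lt with h0 | h0
  · have := (hs 0).2
    rw [hH, ← h0, mul_zero] at this
    exact absurd this (not_lt.2 (abs_nonneg _))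
  · have e : (D+1 : ℝ) * (H * (2 ^ D / (θ/2) ^ D)) = (1/2) * (|q.coeff d| * w ^ d) := by
      rw [hH, cPoly, div_pow, show (4:ℝ) = 2 * 2 by norm_num, mul_pow]
      field_simp
    rw [e] at hL
    linarith

end

open MeasureTheory Set Metric
open scoped ENNReal NNReal
noncomputable section

/-- tree of admissible times -/
def TTree {Z : Type*} : (m : ℕ) → (Fin m → Set (Z × ℝ)) → (Fin m → ℝ → Z → Z) → Z → Set (Fin m → ℝ)
  | 0, _, _, _ => univ
  | m+1, S, φ, x => {t | (x, t 0) ∈ S 0 ∧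
      Fin.tail t ∈ TTree m (Fin.tail S) (Fin.tail φ) (φ 0 (t 0) x)}

lemma tree_meas {Z : Type*} [MeasurableSpace Z] (m : ℕ) (S : Fin m → Set (Z × ℝ))
    (φ : Fin m → ℝ → Z → Z) (hS : ∀ i, MeasurableSet (S i))
    (hφ : ∀ i, Measurable fun z : ℝ × Z => φ i z.1 z.2) :
    MeasurableSet {z : Z × (Fin m → ℝ) | z.2 ∈ TTree m S φ z.1} := by
  induction m with
  | zero => simp [TTree]
  | succ m ih =>
    have h := ih (Fin.tail S) (Fin.tail φ) (fun i => hS _) (fun i => hφ _)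
    have e : {z : Z × (Fin (m+1) → ℝ) | z.2 ∈ TTree (m+1) S φ z.1} =
      (fun z : Z × (Fin (m+1) → ℝ) => (z.1, z.2 0)) ⁻¹' (S 0) ∩
      (fun z : Z × (Fin (m+1) → ℝ) => (φ 0 (z.2 0) z.1, Fin.tail z.2)) ⁻¹'
        {z : Z × (Fin m → ℝ) | z.2 ∈ TTree m (Fin.tail S) (Fin.tail φ) z.1} := rfl
    rw [e]
    have h0 : Measurable fun z : Z × (Fin (m+1) → ℝ) => z.2 0 :=
      (measurable_pi_apply 0).comp measurable_snd
    refine MeasurableSet.inter ((hS 0).preimage (measurable_fst.prodMk h0)) (h.preimage ?_)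
    refine Measurable.prodMk ((hφ 0).comp (h0.prodMk measurable_fst)) ?_
    exact measurable_pi_lambda _ fun i => (measurable_pi_apply i.succ).comp measurable_snd

lemma tree_main {Z : Type*} [MeasurableSpace Z] {ι : Type*} [Fintype ι] (D : ℕ) (θ : ℝ)
    (hθ : 0 < θ) (m : ℕ) :
    ∀ (S : Fin m → Set (Z × ℝ)) (φ : Fin m → ℝ → Z → Z) (A : Fin (m+1) → Set Z)
    (w : Fin m → ℝ) (a : Fin m → ℝ≥0∞)
    (hS : ∀ i, MeasurableSet (S i))
    (hφ : ∀ i, Measurable fun z : ℝ × Z => φ i z.1 z.2)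
    (hw : ∀ i, 0 < w i)
    (hA : ∀ i, ∀ x ∈ A i.castSucc, ∀ t, (x, t) ∈ S i → φ i t x ∈ A i.succ)
    (hsp : ∀ i, ∀ x ∈ A i.castSucc, Spread D θ (w i) {t | (x, t) ∈ S i})
    (ha : ∀ i, ∀ x ∈ A i.castSucc, a i ≤ volume {t | (x, t) ∈ S i})
    (κ : ι → ℝ) (e : ι → Fin m → ℕ) (he : ∀ i l, e i l ≤ D) (β : Fin m → ℕ)
    (x : Z) (_ : x ∈ A 0),
    ∏ i, (a i / 2) ≤ volume {t | t ∈ TTree m S φ x ∧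
      (cPoly D * θ ^ D) ^ m * (|∑ i, if e i = β then κ i else 0| * ∏ l, w l ^ β l) ≤
        |∑ i, κ i * ∏ l, t l ^ e i l|} := by
  induction m with
  | zero =>
    intro S φ A w a hS hφ hw hA hsp ha κ e he β x hx
    have h1 : ∀ i, e i = β := fun i => Subsingleton.elim _ _
    have : {t : Fin 0 → ℝ | t ∈ TTree 0 S φ x ∧
      (cPoly D * θ ^ D) ^ 0 * (|∑ i, if e i = β then κ i else 0| * ∏ l, w l ^ β l) ≤
        |∑ i, κ i * ∏ l, t l ^ e i l|} = univ := by
      ext t; simp [TTree, h1]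
    rw [this]
    simp [MeasureTheory.volume_pi]
  | succ m ih =>
    intro S φ A w a hS hφ hw hA hsp ha κ e he β x hx
    set η := cPoly D * θ ^ D with hη
    have hηpos : 0 < η := mul_pos (cPoly_pos D) (by positivity)
    set c := ∑ i, if e i = β then κ i else 0 with hc
    set G : Set (Fin (m+1) → ℝ) := {t | t ∈ TTree (m+1) S φ x ∧
      η ^ (m+1) * (|c| * ∏ l, w l ^ β l) ≤ |∑ i, κ i * ∏ l, t l ^ e i l|} with hG
    have hGm : MeasurableSet G := by
      refine MeasurableSet.inter ?_ ?_
      · exact (tree_meas (m+1) S φ hS hφ).preimage (measurable_const.prodMk measurable_id)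
      · have hmm : Measurable fun t : Fin (m+1) → ℝ => |∑ i, κ i * ∏ l, t l ^ e i l| := by
          refine Continuous.measurable ?_
          fun_prop
        exact measurableSet_le measurable_const hmm
    -- polynomial in the first variable
    let q : Polynomial ℝ := ∑ i, if Fin.tail (e i) = Fin.tail β then
      Polynomial.monomial (e i 0) (κ i) else 0
    have hqdeg : q.natDegree ≤ D := by
      refine Polynomial.natDegree_sum_le_of_forall_le _ _ ?_
      intro i _
      split_ifs
      · exact (Polynomial.natDegree_monomial_le _).trans (he i 0)
      · simp
    have hqc : q.coeff (β 0) = c := by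
      simp only [q, hc, Polynomial.finsetSum_coeff]
      refine Finset.sum_congr rfl fun i _ => ?_
      by_cases h1 : Fin.tail (e i) = Fin.tail β
      · by_cases h2 : e i 0 = β 0
        · have : e i = β := by
            rw [← Fin.cons_self_tail (e i), ← Fin.cons_self_tail β, h1, h2]
          rw [if_pos h1, if_pos this]; simp [h2]
        · have : e i ≠ β := fun h => h2 (by rw [h])
          rw [if_pos h1, if_neg this, Polynomial.coeff_monomial, if_neg h2]
      · have : e i ≠ β := fun h => h1 (by rw [h])
        rw [if_neg h1, if_neg this]; simp
    have hqe : ∀ s, q.eval s = ∑ i, if Fin.tail (e i) = Fin.tail β then κ i * s ^ (e i 0) else 0 := by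
      intro s
      simp only [q, Polynomial.eval_finsetSum]
      refine Finset.sum_congr rfl fun i _ => ?_
      split_ifs <;> simp
    have hx0 : x ∈ A (Fin.castSucc 0) := hx
    have hone := pd_one (hsp 0 x hx0) hθ (hw 0) q hqdeg (β 0)
    rw [hqc] at hone
    set G0 := {s ∈ {t | (x, t) ∈ S 0} | η * (|c| * w 0 ^ β 0) ≤ |q.eval s|} with hG0
    have hG0m : MeasurableSet G0 :=
      (hsp 0 x hx0).meas.inter (measurableSet_le measurable_const (q.continuous.abs).measurable)
    have hslice : ∀ s ∈ G0, ∏ i : Fin m, (a i.succ / 2) ≤ volume {t' : Fin m → ℝ | Fin.cons s t' ∈ G} := by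
      intro s hs
      have := ih (Fin.tail S) (Fin.tail φ) (Fin.tail A) (Fin.tail w) (Fin.tail a) (fun i => hS _)
        (fun i => hφ _) (fun i => hw _) (fun i y hy t ht => hA i.succ y hy t ht)
        (fun i y hy => hsp i.succ y hy) (fun i y hy => ha i.succ y hy)
        (fun i => κ i * s ^ (e i 0)) (fun i => Fin.tail (e i)) (fun i l => he i _) (Fin.tail β)
        (φ 0 s x) (hA 0 x hx0 s hs.1)
      refine le_trans this (measure_mono ?_)
      rintro t' ⟨ht1, ht2⟩
      refine ⟨⟨by simpa using hs.1, by simpa using ht1⟩, ?_⟩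
      have e1 : ∀ i, κ i * ∏ l, (Fin.cons s t' : Fin (m+1) → ℝ) l ^ e i l
          = κ i * s ^ e i 0 * ∏ l, t' l ^ (Fin.tail (e i)) l := by
        intro i; rw [Fin.prod_univ_succ]; simp [Fin.tail, mul_assoc]
      simp only [e1]
      refine le_trans ?_ ht2
      have h2 := hs.2
      rw [hqe] at h2
      rw [Fin.prod_univ_succ, pow_succ]
      have hwp : 0 ≤ ∏ l : Fin m, Fin.tail w l ^ Fin.tail β l :=
        Finset.prod_nonneg fun i _ => pow_nonneg (hw i.succ).le _
      have hwp' : ∏ l : Fin m, w l.succ ^ β l.succ = ∏ l : Fin m, Fin.tail w l ^ Fin.tail β l := rfl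
      rw [hwp']
      calc _ = η ^ m * ((η * (|c| * w 0 ^ β 0)) * ∏ l : Fin m, Fin.tail w l ^ Fin.tail β l) := by ring
        _ ≤ _ := by gcongr
    have hvol : volume G = ∫⁻ s, volume {t' : Fin m → ℝ | Fin.cons s t' ∈ G} := by
      have mp := (volume_preserving_piFinSuccAbove (fun _ : Fin (m+1) => ℝ) 0).symm
      rw [← mp.measure_preimage hGm.nullMeasurableSet]
      rw [Measure.volume_eq_prod, Measure.prod_apply (hGm.preimage (MeasurableEquiv.measurable _))]
      refine lintegral_congr fun s => ?_
      congr 1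
      ext t'
      simp [MeasurableEquiv.piFinSuccAbove, Fin.insertNthEquiv]
    rw [hvol, Fin.prod_univ_succ]
    calc a 0 / 2 * ∏ i : Fin m, (a i.succ / 2)
        ≤ volume G0 * ∏ i : Fin m, (a i.succ / 2) := by
          gcongr
          refine le_trans ?_ hone
          gcongr; exact ha 0 x hx0
      _ = ∫⁻ s in G0, ∏ i : Fin m, (a i.succ / 2) := by rw [setLIntegral_const, mul_comm]
      _ ≤ ∫⁻ s in G0, volume {t' : Fin m → ℝ | Fin.cons s t' ∈ G} := by
          exact setLIntegral_mono' hG0m hslice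
      _ ≤ _ := setLIntegral_le_lintegral _ _

end

set_option linter.unusedVariables false
open MeasureTheory Set Metric
open scoped ENNReal NNReal
noncomputable section

lemma bz_delta {m : ℕ} (Z : Finset (Fin m → ℝ)) (z : Fin m → ℝ) (hz : z ∈ Z) :
    ∃ p : MvPolynomial (Fin m) ℝ, MvPolynomial.eval z p = 1 ∧
      ∀ z' ∈ Z, z' ≠ z → MvPolynomial.eval z' p = 0 := by
  classical
  refine ⟨∏ y ∈ Z.erase z, (MvPolynomial.C (∑ i, (z i - y i)^2)⁻¹ *
    ∑ i, (MvPolynomial.X i - MvPolynomial.C (y i))^2), ?_, ?_⟩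
  · rw [map_prod]
    refine Finset.prod_eq_one fun y hy => ?_
    have hne : z ≠ y := (Finset.ne_of_mem_erase hy).symm
    have : ∑ i, (z i - y i)^2 ≠ 0 := by
      intro h0
      rw [Finset.sum_eq_zero_iff_of_nonneg (fun i _ => sq_nonneg _)] at h0
      apply hne; ext i
      have := h0 i (Finset.mem_univ _)
      have := pow_eq_zero_iff (two_ne_zero) |>.1 this
      linarith
    simp only [map_mul, map_sum, map_pow, map_sub, MvPolynomial.eval_C, MvPolynomial.eval_X]
    exact inv_mul_cancel₀ this
  · intro z' hz' hne
    rw [map_prod]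
    refine Finset.prod_eq_zero (Finset.mem_erase.2 ⟨hne, hz'⟩) ?_
    simp

lemma bezout {m N : ℕ} (hN : 1 ≤ N) (g : Fin m → MvPolynomial (Fin m) ℝ)
    (hg : ∀ i, (g i).totalDegree < N) (ε : ℝ) (hε : ε ≠ 0) (Z : Finset (Fin m → ℝ))
    (hZ : ∀ z ∈ Z, ∀ i, MvPolynomial.eval z (g i) + ε * z i ^ N = 0) :
    Z.card ≤ N ^ m := by
  classical
  let R : MvPolynomial (Fin m) ℝ →ₗ[ℝ] (Z → ℝ) :=
    LinearMap.pi fun z => (MvPolynomial.aeval (z : Fin m → ℝ)).toLinearMap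
  have hR : ∀ p z, R p z = MvPolynomial.eval (z : Fin m → ℝ) p := by
    intro p z; simp [R, MvPolynomial.aeval_eq_eval]
  let b : (Fin m → Fin N) → (Z → ℝ) := fun e => R (∏ i, MvPolynomial.X i ^ (e i : ℕ))
  let B : Submodule ℝ (Z → ℝ) := Submodule.span ℝ (Set.range b)
  have key : ∀ d : ℕ, ∀ p : MvPolynomial (Fin m) ℝ, p.totalDegree < d → R p ∈ B := by
    intro d
    induction d with
    | zero => intro p hp; omega
    | succ d ih =>
      intro p hp
      rw [p.as_sum, map_sum]
      refine Submodule.sum_mem _ fun s hs => ?_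
      have hsd : (s.sum fun _ e => e) < d + 1 := lt_of_le_of_lt (MvPolynomial.le_totalDegree hs) hp
      have hsm : MvPolynomial.monomial s (p.coeff s) = p.coeff s • MvPolynomial.monomial s (1:ℝ) := by
        rw [MvPolynomial.smul_monomial]; simp
      rw [hsm, map_smul]
      refine Submodule.smul_mem _ _ ?_
      by_cases hbox : ∀ i, s i < N
      · refine Submodule.subset_span ⟨fun i => ⟨s i, hbox i⟩, ?_⟩
        simp only [b]
        rw [MvPolynomial.monomial_eq]
        congr 1
        simp [Finsupp.prod_fintype]
      · push Not at hbox
        obtain ⟨i, hi⟩ := hbox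
        set s' := s - Finsupp.single i N with hs'
        have hss : s = s' + Finsupp.single i N := by
          rw [hs']; refine (tsub_add_cancel_of_le ?_).symm
          exact Finsupp.single_le_iff.2 hi
        have e1 : R (MvPolynomial.monomial s (1:ℝ)) =
            (-ε⁻¹) • R (g i * MvPolynomial.monomial s' (1:ℝ)) := by
          ext z
          have hz := hZ z z.2 i
          rw [Pi.smul_apply, hR, hR, map_mul]
          have : MvPolynomial.monomial s (1:ℝ) = MvPolynomial.X i ^ N * MvPolynomial.monomial s' 1 := by
            rw [MvPolynomial.X_pow_eq_monomial, MvPolynomial.monomial_mul, hss]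
            simp [add_comm]
          rw [this, map_mul, map_pow, MvPolynomial.eval_X]
          have h3 : (z : Fin m → ℝ) i ^ N = -ε⁻¹ * MvPolynomial.eval (z : Fin m → ℝ) (g i) := by
            field_simp; linarith
          rw [h3, smul_eq_mul, mul_assoc]
        rw [e1]
        refine Submodule.smul_mem _ _ (ih _ ?_)
        have h4 := MvPolynomial.totalDegree_mul (g i) (MvPolynomial.monomial s' (1:ℝ))
        rw [MvPolynomial.totalDegree_monomial _ one_ne_zero] at h4
        have h5 : (s.sum fun _ e => e) = (s'.sum fun _ e => e) + N := by
          conv_lhs => rw [hss]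
          rw [Finsupp.sum_add_index' (by simp) (by simp)]
          simp
        have := hg i
        omega
  have hBtop : B = ⊤ := by
    rw [eq_top_iff]
    intro f _
    choose δ hδ1 hδ2 using fun z : Z => bz_delta Z z z.2
    have : f = R (∑ z : Z, f z • δ z) := by
      ext z
      rw [map_sum, Finset.sum_apply, Finset.sum_eq_single z]
      · rw [map_smul, Pi.smul_apply, hR, hδ1]; simp
      · intro y _ hy
        rw [map_smul, Pi.smul_apply, hR, hδ2 y z z.2 (fun h => hy (Subtype.ext h.symm))]; simp
      · simp
    rw [this]
    exact key _ _ (Nat.lt_succ_self _)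
  have h1 := finrank_range_le_card (R := ℝ) b
  have h2 : Set.finrank ℝ (Set.range b) = Z.card := by
    unfold Set.finrank
    change Module.finrank ℝ B = _
    rw [hBtop, finrank_top]; simp
  rw [h2] at h1
  simpa using h1

end

set_option linter.unusedVariables false
open MeasureTheory Set Metric
open scoped ENNReal NNReal
noncomputable section

lemma bdd_of_cont {A H : Type*} [TopologicalSpace A] [NormedAddCommGroup H] {K : Set A} (hK : IsCompact K)
    (f : A → H) (hf : Continuous f) : ∃ C : ℝ, 0 < C ∧ ∀ x ∈ K, ‖f x‖ ≤ C := by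
  obtain ⟨C, hC⟩ := hK.exists_bound_of_continuousOn hf.continuousOn
  exact ⟨max C 1, by positivity, fun x hx => (hC x hx).trans (le_max_left _ _)⟩

lemma vec_sum {m : ℕ} (P : Type*) [NormedAddCommGroup P] [NormedSpace ℝ P] (t : Fin m → ℝ) :
    ((0 : P), t) = ∑ l, t l • ((0 : P), (Pi.single l 1 : Fin m → ℝ)) := by
  rw [Prod.ext_iff]
  constructor
  · rw [Prod.fst_sum]; simp
  · rw [Prod.snd_sum]
    ext i
    simp [Finset.sum_apply, Pi.single_apply]

lemma taylor_poly {P : Type*} [NormedAddCommGroup P] [NormedSpace ℝ P] [FiniteDimensional ℝ P]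
    {m : ℕ} (Θ : P × (Fin m → ℝ) → (Fin m → ℝ)) (hΘ : ContDiff ℝ (⊤ : ℕ∞) Θ) (N : ℕ) :
    ∃ G : P → Fin m → MvPolynomial (Fin m) ℝ, (∀ x i, (G x i).totalDegree ≤ N) ∧
      ContDiff ℝ (⊤ : ℕ∞) (fun z : P × (Fin m → ℝ) => Θ z - fun i => MvPolynomial.eval z.2 (G z.1 i)) ∧
      ∃ C : ℝ, 0 < C ∧ ∀ x t, ‖x‖ ≤ 1 → ‖t‖ ≤ 1 →
        ‖Θ (x, t) - fun i => MvPolynomial.eval t (G x i)‖ ≤ C * ‖t‖ ^ (N+1) := by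
  classical
  have hΘ0 : ContDiff ℝ (⊤ : ℕ∞) fun x : P => Θ (x, 0) := hΘ.comp (contDiff_id.prodMk contDiff_const)
  let M : (q : ℕ) → P → (Fin q → Fin m) → (Fin m → ℝ) := fun q x r =>
    iteratedFDeriv ℝ q Θ (x, 0) (fun a => ((0 : P), (Pi.single (r a) 1 : Fin m → ℝ)))
  have hM : ∀ q r, ContDiff ℝ (⊤ : ℕ∞) fun x => M q x r := by
    intro q r
    have h1 : ContDiff ℝ (⊤ : ℕ∞) (iteratedFDeriv ℝ q Θ) := by
      refine hΘ.iteratedFDeriv_right ?_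
      exact_mod_cast le_top
    have h2 := h1.comp (contDiff_id.prodMk contDiff_const : ContDiff ℝ (⊤ : ℕ∞) fun x : P => (x, (0 : Fin m → ℝ)))
    exact (ContinuousMultilinearMap.apply ℝ (fun _ : Fin q => P × (Fin m → ℝ)) (Fin m → ℝ)
      (fun a => ((0 : P), (Pi.single (r a) 1 : Fin m → ℝ)))).contDiff.comp h2
  have hMe : ∀ q x t, iteratedFDeriv ℝ q Θ (x, 0) (fun _ => ((0:P), t)) =
      ∑ r : Fin q → Fin m, (∏ a, t (r a)) • M q x r := by
    intro q x t
    rw [vec_sum P t]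
    rw [(iteratedFDeriv ℝ q Θ (x, 0)).map_sum]
    refine Finset.sum_congr rfl fun r _ => ?_
    rw [(iteratedFDeriv ℝ q Θ (x, 0)).map_smul_univ]
  let G : P → Fin m → MvPolynomial (Fin m) ℝ := fun x i => ∑ q ∈ Finset.range (N+1),
    ∑ r : Fin q → Fin m, MvPolynomial.C ((q.factorial : ℝ)⁻¹ * M q x r i) * ∏ a, MvPolynomial.X (r a)
  have hGe : ∀ x t, (fun i => MvPolynomial.eval t (G x i)) = ∑ q ∈ Finset.range (N+1),
      (q.factorial : ℝ)⁻¹ • ∑ r : Fin q → Fin m, (∏ a, t (r a)) • M q x r := by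
    intro x t
    ext i
    simp only [G, map_sum, map_mul, MvPolynomial.eval_C, map_prod, MvPolynomial.eval_X,
      Finset.sum_apply, Pi.smul_apply, smul_eq_mul, Finset.mul_sum]
    refine Finset.sum_congr rfl fun q _ => Finset.sum_congr rfl fun r _ => ?_
    ring
  refine ⟨G, ?_, ?_, ?_⟩
  · intro x i
    refine MvPolynomial.totalDegree_finsetSum_le fun q hq => ?_
    refine MvPolynomial.totalDegree_finsetSum_le fun r _ => ?_
    refine (MvPolynomial.totalDegree_mul _ _).trans ?_
    rw [MvPolynomial.totalDegree_C, zero_add]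
    refine (MvPolynomial.totalDegree_finsetProd _ _).trans ?_
    simp only [MvPolynomial.totalDegree_X, Finset.sum_const, Finset.card_univ, Fintype.card_fin,
      smul_eq_mul, mul_one]
    have := Finset.mem_range.1 hq
    omega
  · refine hΘ.sub ?_
    have : (fun z : P × (Fin m → ℝ) => fun i => MvPolynomial.eval z.2 (G z.1 i)) =
      fun z => ∑ q ∈ Finset.range (N+1),
      (q.factorial : ℝ)⁻¹ • ∑ r : Fin q → Fin m, (∏ a, z.2 (r a)) • M q z.1 r := by
      funext z; exact hGe z.1 z.2
    rw [this]
    refine ContDiff.sum fun q _ => ?_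
    refine ContDiff.const_smul _ ?_
    refine ContDiff.sum fun r _ => ?_
    have hMM : ContDiff ℝ (⊤ : ℕ∞) fun z : P × (Fin m → ℝ) => M q z.1 r := (hM q r).comp contDiff_fst
    have hpp : ContDiff ℝ (⊤ : ℕ∞) fun z : P × (Fin m → ℝ) => ∏ a, z.2 (r a) := by
      refine contDiff_prod fun a _ => ?_
      exact (contDiff_apply ℝ ℝ (r a)).comp contDiff_snd
    exact hpp.smul hMM
  · have hK : IsCompact (closedBall (0 : P × (Fin m → ℝ)) 1) := isCompact_closedBall _ _
    have hcont : Continuous (iteratedFDeriv ℝ (N+1) Θ) := by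
      refine hΘ.continuous_iteratedFDeriv ?_
      exact_mod_cast le_top
    obtain ⟨C, hC0, hC⟩ := bdd_of_cont hK _ hcont
    refine ⟨(N.factorial : ℝ)⁻¹ * C, by positivity, fun x t hx ht => ?_⟩
    have htay := map_add_eq_sum_add_integral_iteratedFDeriv (f := Θ) (x := (x, (0 : Fin m → ℝ)))
      (y := ((0 : P), t)) (n := N) (fun s _ => (hΘ.of_le (by exact_mod_cast le_top)).contDiffAt)
    have hadd : (x, (0 : Fin m → ℝ)) + ((0 : P), t) = (x, t) := by simp
    rw [hadd] at htay
    rw [hGe, htay]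
    simp only [← hMe]
    rw [add_sub_cancel_left, norm_smul, mul_assoc]
    rw [Real.norm_of_nonneg (by positivity)]
    gcongr
    have := intervalIntegral.norm_integral_le_of_norm_le_const (a := 0) (b := 1)
      (f := fun s : ℝ => (1 - s)^N • iteratedFDeriv ℝ (N + 1) Θ ((x, (0 : Fin m → ℝ)) + s • ((0 : P), t)) (fun _ ↦ ((0 : P), t)))
      (C := C * ‖t‖^(N+1)) (by
        intro s hs
        rw [uIoc_of_le zero_le_one] at hs
        rw [norm_smul]
        have h1 : ‖(1 - s)^N‖ ≤ 1 := by
          rw [norm_pow]; refine pow_le_one₀ (norm_nonneg _) ?_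
          rw [Real.norm_eq_abs, abs_le]; constructor <;> linarith [hs.1, hs.2]
        have h2 := (iteratedFDeriv ℝ (N + 1) Θ ((x, (0 : Fin m → ℝ)) + s • ((0 : P), t))).le_opNorm
          (fun _ ↦ ((0 : P), t))
        have h3 : ‖iteratedFDeriv ℝ (N + 1) Θ ((x, (0 : Fin m → ℝ)) + s • ((0 : P), t))‖ ≤ C := by
          apply hC
          rw [mem_closedBall_zero_iff, Prod.norm_def]
          simp only [Prod.smul_mk, smul_zero, Prod.mk_add_mk, add_zero, zero_add]
          refine max_le hx ?_
          rw [norm_smul, Real.norm_of_nonneg hs.1.le]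
          exact mul_le_one₀ hs.2 (norm_nonneg _) ht
        have h4 : ‖((0 : P), t)‖ = ‖t‖ := by simp [Prod.norm_def]
        simp only [Finset.prod_const, Finset.card_univ, Fintype.card_fin, h4] at h2
        calc _ ≤ 1 * (C * ‖t‖^(N+1)) := by
              refine mul_le_mul h1 (h2.trans ?_) (norm_nonneg _) zero_le_one
              gcongr
          _ = _ := one_mul _)
    simpa using this

end

set_option linter.unusedVariables false
open MeasureTheory Set Metric
open scoped ENNReal NNReal
noncomputable section

/-- partial derivative in the second variable -/
def Dt {P F H : Type*} [NormedAddCommGroup P] [NormedSpace ℝ P] [NormedAddCommGroup F] [NormedSpace ℝ F]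
    [NormedAddCommGroup H] [NormedSpace ℝ H] (f : P × F → H) (x : P) (t : F) : F →L[ℝ] H :=
  (fderiv ℝ f (x, t)).comp (ContinuousLinearMap.inr ℝ P F)

section
variable {P F H : Type*} [NormedAddCommGroup P] [NormedSpace ℝ P] [NormedAddCommGroup F] [NormedSpace ℝ F]
    [NormedAddCommGroup H] [NormedSpace ℝ H]

lemma hasFDerivAt_Dt (f : P × F → H) (hf : ContDiff ℝ (⊤ : ℕ∞) f) (x : P) (t : F) :
    HasFDerivAt (fun s => f (x, s)) (Dt f x t) t := by
  have h1 : HasFDerivAt f (fderiv ℝ f (x, t)) (x, t) :=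
    (hf.differentiable (by simp)).differentiableAt.hasFDerivAt
  have h2 : HasFDerivAt (fun s : F => (x, s)) (ContinuousLinearMap.inr ℝ P F) t := by
    exact hasFDerivAt_prodMk_right x t
  exact h1.comp t h2

lemma Dt_cont (f : P × F → H) (hf : ContDiff ℝ (⊤ : ℕ∞) f) :
    Continuous fun z : P × F => Dt f z.1 z.2 := by
  have := hf.continuous_fderiv (by simp)
  unfold Dt
  exact (this.comp (by fun_prop)).clm_comp continuous_const

lemma Dt_lip [FiniteDimensional ℝ P] [FiniteDimensional ℝ F] (f : P × F → H) (hf : ContDiff ℝ (⊤ : ℕ∞) f) :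
    ∃ C : ℝ, 1 ≤ C ∧ ∀ x t t', ‖x‖ ≤ 1 → ‖t‖ ≤ 1 → ‖t'‖ ≤ 1 → ‖Dt f x t - Dt f x t'‖ ≤ C * ‖t - t'‖ := by
  have hf1 : ContDiff ℝ (⊤ : ℕ∞) (fderiv ℝ f) := hf.fderiv_right (by simp)
  have hK : IsCompact (closedBall (0 : P × F) 1) := isCompact_closedBall _ _
  obtain ⟨C, hC0, hC⟩ := bdd_of_cont hK (fderiv ℝ (fderiv ℝ f)) (hf1.continuous_fderiv (by simp))
  refine ⟨max C 1, le_max_right _ _, fun x t t' hx ht ht' => ?_⟩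
  have hmem : ∀ s : F, ‖s‖ ≤ 1 → (x, s) ∈ closedBall (0 : P × F) 1 := by
    intro s hs
    rw [mem_closedBall_zero_iff, Prod.norm_def]; exact max_le hx hs
  have h1 := (convex_closedBall (0 : P × F) 1).norm_image_sub_le_of_norm_fderiv_le
    (f := fderiv ℝ f) (C := C) (fun z _ => (hf1.differentiable (by simp)).differentiableAt)
    hC (hmem t' ht') (hmem t ht)
  have h2 : Dt f x t - Dt f x t' = (fderiv ℝ f (x, t) - fderiv ℝ f (x, t')).comp
      (ContinuousLinearMap.inr ℝ P F) := by
    ext v; simp [Dt]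
  have h3 : ‖(x, t) - (x, t')‖ = ‖t - t'‖ := by simp [Prod.norm_def]
  rw [h3] at h1
  rw [h2]
  calc _ ≤ ‖fderiv ℝ f (x, t) - fderiv ℝ f (x, t')‖ * ‖ContinuousLinearMap.inr ℝ P F‖ :=
        ContinuousLinearMap.opNorm_comp_le _ _
    _ ≤ ‖fderiv ℝ f (x, t) - fderiv ℝ f (x, t')‖ * 1 := by
        gcongr
        refine ContinuousLinearMap.opNorm_le_bound _ zero_le_one fun v => ?_
        simp [Prod.norm_def]
    _ ≤ _ := by
        rw [mul_one]; refine h1.trans ?_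
        gcongr; exact le_max_left _ _

lemma Dt_landau [FiniteDimensional ℝ P] [FiniteDimensional ℝ F] (f : P × F → H)
    (hf : ContDiff ℝ (⊤ : ℕ∞) f) (K : ℕ) (hK : 1 ≤ K)
    (C : ℝ) (hC : 0 < C) (hb : ∀ x t, ‖x‖ ≤ 1 → ‖t‖ ≤ 1 → ‖f (x, t)‖ ≤ C * ‖t‖ ^ (2 * K)) :
    ∃ C' : ℝ, 1 ≤ C' ∧ ∀ x t r, 0 < r → r ≤ 1/2 → ‖x‖ ≤ 1 → ‖t‖ ≤ r → ‖Dt f x t‖ ≤ C' * r ^ K := by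
  obtain ⟨C1, hC1, hlip⟩ := Dt_lip f hf
  refine ⟨max (C1 + 2 * (C * 2 ^ (2*K))) 1, le_max_right _ _, fun x t r hr hr2 hx ht => ?_⟩
  refine ContinuousLinearMap.opNorm_le_of_unit_norm (by positivity) fun v hv => ?_
  set h := r ^ K • v with hh
  have hrK : r ^ K ≤ r := by
    calc r ^ K ≤ r ^ 1 := pow_le_pow_of_le_one hr.le (by linarith) hK
      _ = r := pow_one r
  have hnh : ‖h‖ = r ^ K := by rw [hh, norm_smul, hv, mul_one, Real.norm_of_nonneg (by positivity)]
  have hth : ‖t + h‖ ≤ 2 * r := (norm_add_le _ _).trans (by linarith)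
  have hconv : Convex ℝ (closedBall t ‖h‖) := convex_closedBall _ _
  have hTay := hconv.norm_image_sub_le_of_norm_hasFDerivWithin_le' (f := fun s => f (x, s))
    (f' := fun s => Dt f x s) (φ := Dt f x t) (C := C1 * ‖h‖) (x := t) (y := t + h)
    (fun s _ => (hasFDerivAt_Dt f hf x s).hasFDerivWithinAt)
    (fun s hs => by
      have hs' : ‖s - t‖ ≤ ‖h‖ := by simpa [dist_eq_norm] using hs
      have : ‖s‖ ≤ 1 := by
        calc ‖s‖ = ‖t + (s - t)‖ := by congr 1; abel
          _ ≤ ‖t‖ + ‖s - t‖ := norm_add_le _ _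
          _ ≤ 1 := by linarith
      refine (hlip x s t hx this (by linarith)).trans ?_
      gcongr)
    (mem_closedBall_self (norm_nonneg _)) (by simp)
  rw [add_sub_cancel_left] at hTay
  have b1 : ‖f (x, t + h)‖ ≤ C * 2 ^ (2*K) * r ^ (2*K) := by
    refine (hb x (t+h) hx (by linarith)).trans ?_
    rw [mul_assoc, ← mul_pow]; gcongr
  have b2 : ‖f (x, t)‖ ≤ C * 2 ^ (2*K) * r ^ (2*K) := by
    refine (hb x t hx (by linarith)).trans ?_
    rw [mul_assoc, ← mul_pow]; gcongr; linarith
  have hle : ‖Dt f x t h‖ ≤ (C1 + 2 * (C * 2 ^ (2*K))) * (r ^ K * r ^ K) := by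
    calc ‖Dt f x t h‖ = ‖f (x, t + h) - f (x, t) - (f (x, t + h) - f (x, t) - Dt f x t h)‖ := by
          congr 1; abel
      _ ≤ ‖f (x, t + h)‖ + ‖f (x, t)‖ + ‖f (x, t + h) - f (x, t) - Dt f x t h‖ := by
          refine (norm_sub_le _ _).trans ?_
          gcongr; exact norm_sub_le _ _
      _ ≤ C * 2 ^ (2*K) * r ^ (2*K) + C * 2 ^ (2*K) * r ^ (2*K) + C1 * ‖h‖ * ‖h‖ := by gcongr
      _ = _ := by rw [hnh, two_mul K, pow_add]; ring
  rw [hh, map_smul, norm_smul, Real.norm_of_nonneg (by positivity)] at hle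
  have hrp : 0 < r ^ K := by positivity
  have h5 : ‖Dt f x t v‖ ≤ (C1 + 2 * (C * 2 ^ (2*K))) * r ^ K := by
    refine le_of_mul_le_mul_left ?_ hrp
    linarith
  refine h5.trans ?_
  gcongr; exact le_max_left _ _

end

lemma inv_bound {Q : Type*} [TopologicalSpace Q] {m : ℕ} (K : Set Q) (hK : IsCompact K)
    (A : Q → (Fin m → ℝ) →L[ℝ] (Fin m → ℝ)) (hA : Continuous A) :
    ∃ C : ℝ, 1 ≤ C ∧ ∀ z ∈ K, ∀ h : (A z).det ≠ 0,
      ‖(((A z).toContinuousLinearEquivOfDetNeZero h).symm : (Fin m → ℝ) →L[ℝ] (Fin m → ℝ))‖ ≤ C / |(A z).det| := by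
  classical
  let M : Q → Matrix (Fin m) (Fin m) ℝ := fun z => LinearMap.toMatrix' (A z : (Fin m → ℝ) →ₗ[ℝ] (Fin m → ℝ))
  have hMc : Continuous M := by
    refine continuous_matrix fun i j => ?_
    simp only [M, LinearMap.toMatrix'_apply]
    have : Continuous fun z => A z (Pi.single j 1) i :=
      (continuous_apply i).comp (hA.clm_apply continuous_const)
    convert this using 5
    rfl
  have hadj : Continuous fun z => (M z).adjugate := hMc.matrix_adjugate
  have hS : Continuous fun z => ∑ i, ∑ j, |(M z).adjugate i j| := by
    refine continuous_finsetSum _ fun i _ => continuous_finsetSum _ fun j _ => ?_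
    exact (hadj.matrix_elem i j).abs
  obtain ⟨C, hC0, hC⟩ := bdd_of_cont hK _ hS
  refine ⟨max C 1, le_max_right _ _, fun z hz h => ?_⟩
  refine ContinuousLinearMap.opNorm_le_bound _ (by positivity) fun v => ?_
  have hdet : (A z).det = (M z).det := by
    simp only [M, ContinuousLinearMap.det]
    rw [LinearMap.det_toMatrix']
  set e := (A z).toContinuousLinearEquivOfDetNeZero h with he
  have hv : e.symm v = (A z).det⁻¹ • (M z).adjugate.mulVec v := by
    rw [ContinuousLinearEquiv.symm_apply_eq]
    rw [he, ContinuousLinearMap.toContinuousLinearEquivOfDetNeZero_apply, map_smul]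
    have : A z ((M z).adjugate.mulVec v) = (M z).mulVec ((M z).adjugate.mulVec v) := by
      rw [← Matrix.toLin'_apply (M z)]; simp [M]
    rw [this, Matrix.mulVec_mulVec, Matrix.mul_adjugate, ← hdet, Matrix.smul_mulVec, Matrix.one_mulVec,
      smul_smul, inv_mul_cancel₀ h, one_smul]
  change ‖e.symm v‖ ≤ _
  rw [hv, norm_smul, norm_inv, Real.norm_eq_abs, div_eq_inv_mul, mul_assoc]
  gcongr
  have h6 := hC z hz
  rw [Real.norm_of_nonneg (by positivity)] at h6
  have h7 : ‖(M z).adjugate.mulVec v‖ ≤ (∑ i, ∑ j, |(M z).adjugate i j|) * ‖v‖ := by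
    rw [pi_norm_le_iff_of_nonneg (by positivity)]
    intro i
    rw [Matrix.mulVec, dotProduct]
    refine (norm_sum_le _ _).trans ?_
    rw [Finset.sum_mul]
    calc ∑ j, ‖(M z).adjugate i j * v j‖ ≤ ∑ j, |(M z).adjugate i j| * ‖v‖ := by
          refine Finset.sum_le_sum fun j _ => ?_
          rw [norm_mul]; gcongr
          · exact le_rfl
          · exact norm_le_pi_norm v j
      _ = (∑ j, |(M z).adjugate i j|) * ‖v‖ := by rw [Finset.sum_mul]
      _ ≤ _ := Finset.single_le_sum (f := fun i => (∑ j, |(M z).adjugate i j|) * ‖v‖)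
          (fun i _ => by positivity) (Finset.mem_univ i)
  refine h7.trans ?_
  gcongr
  exact h6.trans (le_max_left _ _)

end

set_option linter.unusedVariables false
open MeasureTheory Set Metric
open scoped ENNReal NNReal
noncomputable section

set_option maxHeartbeats 1600000 in
lemma mult_bound {P : Type*} [NormedAddCommGroup P] [NormedSpace ℝ P] [FiniteDimensional ℝ P]
    {m : ℕ} (hm : 0 < m) (Θ : P × (Fin m → ℝ) → (Fin m → ℝ)) (hΘ : ContDiff ℝ (⊤ : ℕ∞) Θ) (R : ℕ) (hR : 1 ≤ R) :
    ∃ r0 : ℝ, 0 < r0 ∧ ∀ x r, ‖x‖ ≤ 1 → 0 < r → r ≤ r0 → ∀ u : Fin m → ℝ, ∀ Z : Finset (Fin m → ℝ),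
      (∀ z ∈ Z, ‖z‖ ≤ r ∧ Θ (x, z) = u ∧ r ^ R ≤ |(Dt Θ x z).det|) → Z.card ≤ (2 * (R+1)) ^ m := by
  classical
  have : Nonempty (Fin m) := ⟨⟨0, hm⟩⟩
  set K := R + 1 with hKdef
  obtain ⟨G, hGdeg, hfs, C3, hC3, hf3⟩ := taylor_poly Θ hΘ (2 * K - 1)
  have hKK : 2 * K - 1 + 1 = 2 * K := by omega
  rw [hKK] at hf3
  set f : P × (Fin m → ℝ) → (Fin m → ℝ) := fun z => Θ z - fun i => MvPolynomial.eval z.2 (G z.1 i) with hfdef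
  obtain ⟨C4, hC4, hf4⟩ := Dt_landau f hfs K (by omega) C3 hC3 hf3
  obtain ⟨C1, hC1, hlip⟩ := Dt_lip Θ hΘ
  obtain ⟨C2, hC2, hinv⟩ := inv_bound (closedBall (0 : P × (Fin m → ℝ)) 1) (isCompact_closedBall _ _)
    (fun z => Dt Θ z.1 z.2) (Dt_cont Θ hΘ)
  -- r0
  set r0 : ℝ := min (1/4) (min (1 / (8 * C2 * (C4 * 2 ^ K))) (1 / (96 * C1 * C2 ^ 2 * C3))) with hr0
  have hr0pos : 0 < r0 := by positivity
  refine ⟨r0, hr0pos, fun x r hx hr hrr0 u Z hZ => ?_⟩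
  have hr4 : r ≤ 1/4 := hrr0.trans (min_le_left _ _)
  have hra : r ≤ 1 / (8 * C2 * (C4 * 2 ^ K)) := hrr0.trans ((min_le_right _ _).trans (min_le_left _ _))
  have hrb : r ≤ 1 / (96 * C1 * C2 ^ 2 * C3) := hrr0.trans ((min_le_right _ _).trans (min_le_right _ _))
  set μ := r ^ R with hμ
  have hμpos : 0 < μ := by positivity
  have hμr : μ ≤ r := by
    calc r ^ R ≤ r ^ 1 := pow_le_pow_of_le_one hr.le (by linarith) hR
      _ = r := pow_one r
  set ρ := μ / (8 * C1 * C2) with hρ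
  have hρpos : 0 < ρ := by positivity
  have hρr : ρ ≤ r := by
    refine le_trans ?_ hμr
    refine div_le_self hμpos.le ?_
    nlinarith
  -- small eps
  set N := 2 * K with hN
  have hNpos : (0:ℝ) < N := by rw [hN]; positivity
  set ε := min (μ / (8 * C2 * N)) (μ * ρ / (12 * C2)) with hε
  have hεpos : 0 < ε := by positivity
  have hεa : ε * N ≤ μ / (8 * C2) := by
    have : ε ≤ μ / (8 * C2 * N) := min_le_left _ _
    rw [le_div_iff₀ (by positivity)] at this ⊢
    linarith
  have hεb : ε ≤ μ * ρ / (12 * C2) := min_le_right _ _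
  let F : (Fin m → ℝ) → (Fin m → ℝ) := fun s i => MvPolynomial.eval s (G x i) - u i + ε * s i ^ N
  have hF : ∀ s, F s = Θ (x, s) - f (x, s) - u + ε • fun i => s i ^ N := by
    intro s; ext i; simp [F, hfdef]
  -- the f-part derivative bound
  have hfl : ∀ s, ‖s‖ ≤ 2 * r → ‖Dt f x s‖ ≤ μ / (8 * C2) := by
    intro s hs
    refine (hf4 x s (2 * r) (by positivity) (by linarith) hx hs).trans ?_
    rw [mul_pow, hKdef, pow_succ r R, ← hKdef]
    rw [le_div_iff₀ (by positivity)] at hra ⊢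
    calc C4 * (2 ^ K * (r ^ R * r)) * (8 * C2) = μ * (r * (8 * C2 * (C4 * 2 ^ K))) := by rw [hμ]; ring
      _ ≤ μ * 1 := by gcongr
      _ = μ := mul_one _
  have hc0 : (0:ℝ) ≤ μ / (2 * C2) := by positivity
  set c : ℝ≥0 := ⟨μ / (2 * C2), hc0⟩ with hc
  -- for each z ∈ Z
  have hkey : ∀ z ∈ Z, InjOn (fun s => Θ (x, s)) (closedBall z ρ) ∧
      ∃ y ∈ closedBall z (ρ / 3), F y = 0 := by
    intro z hz
    obtain ⟨hzr, hzu, hzd⟩ := hZ z hz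
    have hball : ∀ s ∈ closedBall z ρ, ‖s‖ ≤ 2 * r := by
      intro s hs
      have hs' : ‖s - z‖ ≤ ρ := by simpa [dist_eq_norm] using hs
      calc ‖s‖ = ‖z + (s - z)‖ := by congr 1; abel
        _ ≤ ‖z‖ + ‖s - z‖ := norm_add_le _ _
        _ ≤ 2 * r := by linarith
    set A := Dt Θ x z with hA
    have hdet : A.det ≠ 0 := by
      intro h0; rw [h0, abs_zero] at hzd; linarith
    have hsym := hinv (x, z) (by
      rw [mem_closedBall_zero_iff, Prod.norm_def]; exact max_le hx (by linarith)) hdet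
    set e := A.toContinuousLinearEquivOfDetNeZero hdet with he
    have heA : (e : (Fin m → ℝ) →L[ℝ] (Fin m → ℝ)) = A :=
      ContinuousLinearMap.coe_toContinuousLinearEquivOfDetNeZero _ _
    have hnpos : 0 < ‖(e.symm : (Fin m → ℝ) →L[ℝ] (Fin m → ℝ))‖ := e.norm_symm_pos
    have hninv : μ / C2 ≤ ‖(e.symm : (Fin m → ℝ) →L[ℝ] (Fin m → ℝ))‖⁻¹ := by
      rw [le_inv_comm₀ (by positivity) hnpos, inv_div]
      refine hsym.trans ?_
      gcongr
    have hΘd : ∀ s ∈ closedBall z ρ, ∀ s' ∈ closedBall z ρ,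
        ‖Θ (x, s) - Θ (x, s') - A (s - s')‖ ≤ μ / (8 * C2) * ‖s - s'‖ := by
      intro s hs s' hs'
      refine (convex_closedBall z ρ).norm_image_sub_le_of_norm_hasFDerivWithin_le'
        (f := fun s => Θ (x, s)) (f' := fun s => Dt Θ x s)
        (fun s _ => (hasFDerivAt_Dt Θ hΘ x s).hasFDerivWithinAt) (fun s hs => ?_) hs' hs
      have h1 : ‖s - z‖ ≤ ρ := by simpa [dist_eq_norm] using hs
      refine (hlip x s z hx ((hball s hs).trans (by linarith)) (by linarith)).trans ?_
      calc C1 * ‖s - z‖ ≤ C1 * ρ := by gcongr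
        _ = μ / (8 * C2) := by rw [hρ]; field_simp
    have hfd : ∀ s ∈ closedBall z ρ, ∀ s' ∈ closedBall z ρ,
        ‖f (x, s) - f (x, s')‖ ≤ μ / (8 * C2) * ‖s - s'‖ := by
      intro s hs s' hs'
      exact (convex_closedBall z ρ).norm_image_sub_le_of_norm_hasFDerivWithin_le
        (f := fun s => f (x, s)) (f' := fun s => Dt f x s)
        (fun s _ => (hasFDerivAt_Dt f hfs x s).hasFDerivWithinAt) (fun s hs => hfl s (hball s hs)) hs' hs
    have hpd : ∀ s ∈ closedBall z ρ, ∀ s' ∈ closedBall z ρ,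
        ‖(ε • fun i => s i ^ N) - (ε • fun i => s' i ^ N : Fin m → ℝ)‖ ≤ μ / (8 * C2) * ‖s - s'‖ := by
      intro s hs s' hs'
      rw [← smul_sub, norm_smul, Real.norm_of_nonneg hεpos.le]
      have : ‖(fun i => s i ^ N) - (fun i => s' i ^ N : Fin m → ℝ)‖ ≤ N * ‖s - s'‖ := by
        rw [pi_norm_le_iff_of_nonneg (by positivity)]
        intro i
        have h1 := abs_pow_sub_pow_le (s i) (s' i) N
        have h2 : |s i| ≤ 1 := (norm_le_pi_norm s i).trans ((hball s hs).trans (by linarith))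
        have h3 : |s' i| ≤ 1 := (norm_le_pi_norm s' i).trans ((hball s' hs').trans (by linarith))
        have h4 : max |s i| |s' i| ^ (N-1) ≤ 1 :=
          pow_le_one₀ (le_max_of_le_left (abs_nonneg _)) (max_le h2 h3)
        have h5 : |s i - s' i| ≤ ‖s - s'‖ := norm_le_pi_norm (s - s') i
        calc ‖((fun i => s i ^ N) - (fun i => s' i ^ N : Fin m → ℝ)) i‖ = |s i ^ N - s' i ^ N| := rfl
          _ ≤ |s i - s' i| * N * 1 := h1.trans (by gcongr)
          _ ≤ N * ‖s - s'‖ := by nlinarith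
      calc _ ≤ ε * (N * ‖s - s'‖) := by gcongr
        _ = ε * N * ‖s - s'‖ := by ring
        _ ≤ _ := by gcongr
    have hc' : c < ‖(e.symm : (Fin m → ℝ) →L[ℝ] (Fin m → ℝ))‖₊⁻¹ := by
      rw [← NNReal.coe_lt_coe]
      refine lt_of_lt_of_le ?_ hninv
      change μ / (2 * C2) < _
      rw [div_lt_div_iff₀ (by positivity) (by positivity)]
      nlinarith [mul_pos hμpos (by linarith : 0 < C2)]
    constructor
    · have hap : ApproximatesLinearOn (fun s => Θ (x, s)) (e : (Fin m → ℝ) →L[ℝ] (Fin m → ℝ)) (closedBall z ρ) c := by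
        rw [heA]
        intro s hs s' hs'
        refine (hΘd s hs s' hs').trans ?_
        gcongr
        change _ ≤ μ / (2 * C2)
        gcongr; linarith
      exact hap.injOn (Or.inr hc')
    · have hap : ApproximatesLinearOn F (e : (Fin m → ℝ) →L[ℝ] (Fin m → ℝ)) (closedBall z ρ) c := by
        rw [heA]
        intro s hs s' hs'
        have e1 : F s - F s' - A (s - s') = (Θ (x, s) - Θ (x, s') - A (s - s')) -
            (f (x, s) - f (x, s')) + ((ε • fun i => s i ^ N) - (ε • fun i => s' i ^ N : Fin m → ℝ)) := by
          rw [hF, hF]; abel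
        rw [e1]
        calc _ ≤ ‖Θ (x, s) - Θ (x, s') - A (s - s')‖ + ‖f (x, s) - f (x, s')‖ +
              ‖(ε • fun i => s i ^ N) - (ε • fun i => s' i ^ N : Fin m → ℝ)‖ := by
              refine (norm_add_le _ _).trans ?_
              gcongr; exact norm_sub_le _ _
          _ ≤ μ / (8 * C2) * ‖s - s'‖ + μ / (8 * C2) * ‖s - s'‖ + μ / (8 * C2) * ‖s - s'‖ :=
              add_le_add (add_le_add (hΘd s hs s' hs') (hfd s hs s' hs')) (hpd s hs s' hs')
          _ = 3 * (μ / (8 * C2)) * ‖s - s'‖ := by ring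
          _ ≤ _ := by
              gcongr
              change _ ≤ μ / (2 * C2)
              rw [mul_div_assoc', div_le_div_iff₀ (by positivity) (by positivity)]
              nlinarith [mul_pos hμpos (by linarith : 0 < C2)]
      have hsurj := hap.surjOn_closedBall_of_nonlinearRightInverse e.toNonlinearRightInverse
        (b := z) (ε := ρ/3) (by positivity) (closedBall_subset_closedBall (by linarith))
      have h0 : (0 : Fin m → ℝ) ∈ closedBall (F z)
          (((e.toNonlinearRightInverse.nnnorm : ℝ)⁻¹ - c) * (ρ/3)) := by
        rw [mem_closedBall, dist_eq_norm, zero_sub, norm_neg]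
        have h1 : (μ / (2 * C2)) * (ρ / 3) ≤ ((e.toNonlinearRightInverse.nnnorm : ℝ)⁻¹ - c) * (ρ/3) := by
          gcongr
          have : (e.toNonlinearRightInverse.nnnorm : ℝ) = ‖(e.symm : (Fin m → ℝ) →L[ℝ] (Fin m → ℝ))‖ := rfl
          rw [this]
          have h2 : (c : ℝ) = μ / (2 * C2) := rfl
          rw [h2]
          have h3 : μ / C2 = μ / (2 * C2) + μ / (2 * C2) := by field_simp; ring
          linarith
        refine le_trans ?_ h1
        rw [hF, hzu]
        have e2 : u - f (x, z) - u + (ε • fun i => z i ^ N) = (ε • fun i => z i ^ N) - f (x, z) := by abel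
        rw [e2]
        have b1 : ‖(ε • fun i => z i ^ N : Fin m → ℝ)‖ ≤ ε := by
          rw [norm_smul, Real.norm_of_nonneg hεpos.le]
          refine mul_le_of_le_one_right hεpos.le ?_
          rw [pi_norm_le_iff_of_nonneg zero_le_one]
          intro i
          rw [norm_pow]
          exact pow_le_one₀ (norm_nonneg _) ((norm_le_pi_norm z i).trans (by linarith))
        have b2 : ‖f (x, z)‖ ≤ μ * ρ / (12 * C2) := by
          refine (hf3 x z hx (by linarith)).trans ?_
          calc C3 * ‖z‖ ^ N ≤ C3 * r ^ N := by gcongr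
            _ = C3 * (r * r * (μ * μ)) := by
                rw [hN, hKdef, hμ]; ring
            _ ≤ C3 * (1 / (96 * C1 * C2 ^ 2 * C3) * 1 * (μ * μ)) := by
                gcongr; linarith
            _ = μ * ρ / (12 * C2) := by rw [hρ]; field_simp; norm_num
        calc _ ≤ ε + μ * ρ / (12 * C2) := (norm_sub_le _ _).trans (add_le_add b1 b2)
          _ ≤ μ * ρ / (12 * C2) + μ * ρ / (12 * C2) := by gcongr
          _ = _ := by field_simp; ring
      obtain ⟨y, hy, hy0⟩ := hsurj h0
      exact ⟨y, hy, hy0⟩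
  choose! y hy hy0 using fun z hz => (hkey z hz).2
  have hyinj : Set.InjOn y Z := by
    intro z hz z' hz' hzz
    have h1 : dist (y z) z ≤ ρ / 3 := hy z hz
    have h2 : dist (y z) z' ≤ ρ / 3 := by rw [hzz]; exact hy z' hz'
    have h3 : dist z' z ≤ ρ := by
      calc dist z' z ≤ dist z' (y z) + dist (y z) z := dist_triangle _ _ _
        _ ≤ ρ := by rw [dist_comm z']; linarith
    refine (hkey z hz).1 (mem_closedBall_self hρpos.le) h3 ?_
    simp only
    rw [(hZ z hz).2.1, (hZ z' hz').2.1]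
  have hcard : (Z.image y).card = Z.card := Finset.card_image_of_injOn hyinj
  rw [← hcard]
  refine bezout (by omega) (fun i => G x i - MvPolynomial.C (u i)) (fun i => ?_) ε hεpos.ne' (Z.image y) ?_
  · have h1 := MvPolynomial.totalDegree_sub (G x i) (MvPolynomial.C (u i))
    have h2 := hGdeg x i
    rw [MvPolynomial.totalDegree_C] at h1
    have : (G x i - MvPolynomial.C (u i)).totalDegree ≤ 2 * K - 1 := h1.trans (max_le h2 (by omega))
    omega
  · intro w hw i
    obtain ⟨z, hz, rfl⟩ := Finset.mem_image.1 hw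
    have := congrFun (hy0 z hz) i
    simpa [F] using this

end

set_option linter.unusedVariables false
open MeasureTheory Set Metric
open scoped ENNReal NNReal
noncomputable section

lemma area_mult {m : ℕ} (hm : 0 < m) (f : (Fin m → ℝ) → (Fin m → ℝ))
    (f' : (Fin m → ℝ) → (Fin m → ℝ) →L[ℝ] (Fin m → ℝ)) (hf : ∀ x, HasFDerivAt f (f' x) x)
    (K W : Set (Fin m → ℝ)) (hK : MeasurableSet K) (hW : MapsTo f K W)
    (hdet : ∀ x ∈ K, (f' x).det ≠ 0) (Nm : ℕ)
    (hmult : ∀ u, ∀ Z : Finset (Fin m → ℝ), (∀ z ∈ Z, z ∈ K ∧ f z = u) → Z.card ≤ Nm) :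
    ∫⁻ x in K, ENNReal.ofReal |(f' x).det| ≤ Nm * volume W := by
  classical
  have : Nonempty (Fin m) := ⟨⟨0, hm⟩⟩
  let r : ((Fin m → ℝ) →L[ℝ] (Fin m → ℝ)) → ℝ≥0 := fun A =>
    if h : A.det ≠ 0 then
      ‖((A.toContinuousLinearEquivOfDetNeZero h).symm : (Fin m → ℝ) →L[ℝ] (Fin m → ℝ))‖₊⁻¹ / 2 else 1
  have hpos : ∀ (A : (Fin m → ℝ) →L[ℝ] (Fin m → ℝ)) (h : A.det ≠ 0),
      0 < ‖((A.toContinuousLinearEquivOfDetNeZero h).symm : (Fin m → ℝ) →L[ℝ] (Fin m → ℝ))‖₊⁻¹ := by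
    intro A h
    exact inv_pos.2 (A.toContinuousLinearEquivOfDetNeZero h).nnnorm_symm_pos
  have hr : ∀ A, r A ≠ 0 := by
    intro A
    by_cases h : A.det ≠ 0
    · simp only [r, dif_pos h]
      exact (half_pos (hpos A h)).ne'
    · simp only [r, dif_neg h]; exact one_ne_zero
  rcases K.eq_empty_or_nonempty with rfl | hne
  · simp
  obtain ⟨t, A, htd, htm, hts, happ, hA⟩ := exists_partition_approximatesLinearOn_of_hasFDerivWithinAt
    f K f' (fun x hx => (hf x).hasFDerivWithinAt) r hr
  have hinj : ∀ i, InjOn f (K ∩ t i) := by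
    intro i
    obtain ⟨y, hy, hAy⟩ := hA hne i
    have hd : (A i).det ≠ 0 := by rw [hAy]; exact hdet y hy
    have h1 := happ i
    simp only [r, dif_pos hd] at h1
    have h2 : ((A i).toContinuousLinearEquivOfDetNeZero hd : (Fin m → ℝ) →L[ℝ] (Fin m → ℝ)) = A i :=
      ContinuousLinearMap.coe_toContinuousLinearEquivOfDetNeZero _ _
    have h3 : ∀ c, ApproximatesLinearOn f (A i) (K ∩ t i) c → ApproximatesLinearOn f ((A i).toContinuousLinearEquivOfDetNeZero hd : (Fin m → ℝ) →L[ℝ] (Fin m → ℝ)) (K ∩ t i) c := by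
      intro c hc; rw [h2]; exact hc
    replace h1 := h3 _ h1
    refine h1.injOn (Or.inr ?_)
    exact half_lt_self (hpos _ hd)
  have hKu : K = ⋃ i, K ∩ t i := by
    rw [← inter_iUnion]; exact (inter_eq_left.2 hts).symm
  have hmi : ∀ i, MeasurableSet (f '' (K ∩ t i)) := fun i =>
    measurable_image_of_fderivWithin (hK.inter (htm i)) (fun x hx => (hf x).hasFDerivWithinAt) (hinj i)
  conv_lhs => rw [hKu]
  rw [lintegral_iUnion (fun i => hK.inter (htm i))
    (fun i j hij => (htd hij).mono inter_subset_right inter_subset_right)]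
  have h1 : ∀ i, ∫⁻ x in K ∩ t i, ENNReal.ofReal |(f' x).det| = ∫⁻ u, (f '' (K ∩ t i)).indicator 1 u := by
    intro i
    rw [lintegral_abs_det_fderiv_eq_addHaar_image volume (hK.inter (htm i))
      (fun x hx => (hf x).hasFDerivWithinAt) (hinj i), lintegral_indicator_one (hmi i)]
  simp only [h1]
  rw [← lintegral_tsum (fun i => (measurable_one.indicator (hmi i)).aemeasurable)]
  have h2 : ∀ u, ∑' i, (f '' (K ∩ t i)).indicator (1 : (Fin m → ℝ) → ℝ≥0∞) u ≤
      W.indicator (fun _ => (Nm : ℝ≥0∞)) u := by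
    intro u
    rw [ENNReal.tsum_eq_iSup_sum]
    refine iSup_le fun S => ?_
    by_cases hu : u ∈ W
    · rw [indicator_of_mem hu]
      have hS : ∑ i ∈ S, (f '' (K ∩ t i)).indicator (1 : (Fin m → ℝ) → ℝ≥0∞) u =
          ((S.filter fun i => u ∈ f '' (K ∩ t i)).card : ℝ≥0∞) := by
        rw [Finset.card_filter]
        push_cast
        refine Finset.sum_congr rfl fun i _ => ?_
        by_cases h : u ∈ f '' (K ∩ t i)
        · rw [indicator_of_mem h, if_pos h]; rfl
        · rw [indicator_of_notMem h, if_neg h]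
      rw [hS]
      norm_cast
      have hch : ∀ i ∈ S.filter fun i => u ∈ f '' (K ∩ t i), ∃ z, z ∈ K ∩ t i ∧ f z = u := by
        intro i hi
        exact (Finset.mem_filter.1 hi).2
      choose! z hz hzu using hch
      have hzi : Set.InjOn z (S.filter fun i => u ∈ f '' (K ∩ t i)) := by
        intro i hi j hj hij
        by_contra hne
        have h3 := (hz i hi).2
        have h4 := (hz j hj).2
        rw [hij] at h3
        exact (disjoint_left.1 (htd hne)) h3 h4
      rw [← Finset.card_image_of_injOn hzi]
      refine hmult u _ ?_
      intro w hw
      obtain ⟨i, hi, rfl⟩ := Finset.mem_image.1 hw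
      exact ⟨(hz i hi).1, hzu i hi⟩
    · rw [indicator_of_notMem hu]
      refine le_of_eq (Finset.sum_eq_zero fun i _ => ?_)
      refine indicator_of_notMem ?_ _
      rintro ⟨z, hz, rfl⟩
      exact hu (hW hz.1)
  calc _ ≤ ∫⁻ u, W.indicator (fun _ => (Nm : ℝ≥0∞)) u := lintegral_mono h2
    _ ≤ _ := lintegral_indicator_const_le _ _

end

set_option linter.unusedVariables false
open MeasureTheory Set Metric
open scoped ENNReal NNReal
noncomputable section

/-- the `L`-adic interval of generation `i` containing `s` -/
def JJ (L i : ℕ) (s : ℝ) : Set ℝ := {t | ⌊(L : ℝ) ^ i * t⌋ = ⌊(L : ℝ) ^ i * s⌋}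

lemma JJ_self (L i : ℕ) (s : ℝ) : s ∈ JJ L i s := rfl

lemma JJ_eq {L i : ℕ} {s t : ℝ} (h : t ∈ JJ L i s) : JJ L i t = JJ L i s := by
  ext u; simp only [JJ, mem_ofPred_eq] at *; rw [h]

lemma JJ_ico {L : ℕ} (hL : 2 ≤ L) (i : ℕ) (s : ℝ) :
    JJ L i s = Ico ((⌊(L : ℝ) ^ i * s⌋ : ℝ) / (L : ℝ) ^ i) ((⌊(L : ℝ) ^ i * s⌋ + 1 : ℝ) / (L : ℝ) ^ i) := by
  have h : (0:ℝ) < (L:ℝ) ^ i := by positivity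
  ext t
  simp only [JJ, mem_ofPred_eq, mem_Ico, Int.floor_eq_iff, div_le_iff₀ h, lt_div_iff₀ h]
  constructor <;> rintro ⟨a, b⟩ <;> constructor <;> linarith

lemma JJ_vol {L : ℕ} (hL : 2 ≤ L) (i : ℕ) (s : ℝ) : volume (JJ L i s) = ((L : ℝ≥0∞) ^ i)⁻¹ := by
  have h : (0:ℝ) < (L:ℝ) ^ i := by positivity
  rw [JJ_ico hL, Real.volume_Ico]
  have : (⌊(L : ℝ) ^ i * s⌋ + 1 : ℝ) / (L : ℝ) ^ i - (⌊(L : ℝ) ^ i * s⌋ : ℝ) / (L : ℝ) ^ i = ((L:ℝ)^i)⁻¹ := by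
    field_simp; ring
  rw [this, ENNReal.ofReal_inv_of_pos h, ENNReal.ofReal_pow (by positivity), ENNReal.ofReal_natCast]

lemma JJ_abs {L : ℕ} (hL : 2 ≤ L) {i : ℕ} {s t : ℝ} (h : t ∈ JJ L i s) : |t - s| ≤ 1 / (L:ℝ) ^ i := by
  have h0 : (0:ℝ) < (L:ℝ) ^ i := by positivity
  simp only [JJ, mem_ofPred_eq] at h
  have := Int.abs_sub_lt_one_of_floor_eq_floor h
  rw [← mul_sub, abs_mul, abs_of_pos h0] at this
  rw [le_div_iff₀ h0]; linarith

lemma JJ_mono {L : ℕ} (hL : 2 ≤ L) {i j : ℕ} (hij : i ≤ j) (s : ℝ) : JJ L j s ⊆ JJ L i s := by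
  intro t ht
  obtain ⟨d, rfl⟩ := Nat.exists_eq_add_of_le hij
  simp only [JJ, mem_ofPred_eq] at *
  have key : ∀ u : ℝ, ⌊(L:ℝ)^i * u⌋ = ⌊(L:ℝ)^(i+d) * u⌋ / ((L^d : ℕ) : ℤ) := by
    intro u
    rw [← Int.floor_div_natCast]
    congr 1
    push_cast
    rw [pow_add]; field_simp
  rw [key, key, ht]

lemma JJ_measurable (L i : ℕ) : MeasurableSet {z : ℝ × ℝ | z.2 ∈ JJ L i z.1} := by
  simp only [JJ, mem_ofPred_eq]
  refine measurableSet_eq_fun ?_ ?_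
  · exact Int.measurable_floor.comp (measurable_snd.const_mul _)
  · exact Int.measurable_floor.comp (measurable_fst.const_mul _)

lemma JJ_meas (L i : ℕ) (s : ℝ) : MeasurableSet (JJ L i s) :=
  measurable_prodMk_left (x := s) (JJ_measurable L i)

lemma JJ_sum (L i : ℕ) (A : Set ℝ) (hA : MeasurableSet A) (ν : Measure ℝ)
    (h : ∀ s ∈ A, volume (A ∩ JJ L i s) ≤ ν (JJ L i s)) : volume A ≤ ν univ := by
  let P : ℤ → Set ℝ := fun q => {t | ⌊(L : ℝ) ^ i * t⌋ = q}
  have hPm : ∀ q, MeasurableSet (P q) := fun q =>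
    measurableSet_eq_fun (Int.measurable_floor.comp (measurable_id.const_mul _)) measurable_const
  have hPd : Pairwise (Function.onFun Disjoint P) := by
    intro q r hqr
    refine disjoint_left.2 fun t h1 h2 => hqr ?_
    simp only [P, mem_ofPred_eq] at h1 h2
    rw [← h1, h2]
  have hu : (⋃ q, P q) = univ := by
    ext t; simp [P]
  have h1 : volume A = ∑' q, volume (A ∩ P q) := by
    rw [← measure_iUnion (fun q r hqr => (hPd hqr).mono inter_subset_right inter_subset_right)
      (fun q => hA.inter (hPm q)), ← inter_iUnion, hu, inter_univ]
  have h2 : ν univ = ∑' q, ν (P q) := by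
    rw [← measure_iUnion hPd hPm, hu]
  rw [h1, h2]
  refine ENNReal.tsum_le_tsum fun q => ?_
  rcases (A ∩ P q).eq_empty_or_nonempty with h0 | ⟨s, hs, hq⟩
  · rw [h0]; simp
  · have : P q = JJ L i s := by
      simp only [P, mem_ofPred_eq] at hq
      simp only [P, JJ, hq]
    rw [this]; exact h s hs

lemma refine_line {Y : Type*} [MeasurableSpace Y] (μ : Measure Y) [SFinite μ]
    {L : ℕ} (hL : 2 ≤ L) (D K i0 : ℕ) (hK : 0 < K) (B : Set (Y × ℝ)) (hB : MeasurableSet B)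
    (E : Set Y) (hE : MeasurableSet E) (hBE : B ⊆ E ×ˢ Icc (-1) 1) (hb : (μ.prod volume) B ≠ ⊤)
    (α κ1 c1 κ0 : ℝ≥0∞) (hα : α * μ E ≤ (μ.prod volume) B)
    (hκ1 : κ1 = (4 * (K:ℝ≥0∞))⁻¹) (hc1 : c1 * (8 * (D + 1)) = κ1) (hκ0 : κ0 * (8 * (L:ℝ≥0∞) ^ i0) = α)
    (hsmall : ((L:ℝ≥0∞) ^ (i0 + K))⁻¹ < c1 ^ K * κ0) :
    ∃ i, i0 ≤ i ∧ i < i0 + K ∧ ∃ B1 B2 : Set (Y × ℝ), MeasurableSet B1 ∧ MeasurableSet B2 ∧ B2 ⊆ B1 ∧ B1 ⊆ B ∧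
      κ1 * (μ.prod volume) B ≤ (μ.prod volume) B2 ∧
      ∀ y s, (y, s) ∈ B2 → Spread D (1 / L) (1 / (L:ℝ) ^ i) {τ | s + τ ∈ JJ L i s ∧ (y, s + τ) ∈ B1} ∧
        κ1 * (c1 ^ K * κ0) ≤ volume {τ | s + τ ∈ JJ L i s ∧ (y, s + τ) ∈ B1} := by
  classical
  have hKt : (4 * (K:ℝ≥0∞)) ≠ ⊤ := ENNReal.mul_ne_top (by norm_num) (ENNReal.natCast_ne_top K)
  have hK0 : (4 * (K:ℝ≥0∞)) ≠ 0 := by simp [hK.ne']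
  have hκ1t : κ1 ≠ ⊤ := by rw [hκ1]; exact ENNReal.inv_ne_top.2 hK0
  have hκ10 : κ1 ≠ 0 := by rw [hκ1]; exact ENNReal.inv_ne_zero.2 hKt
  have hc1t : c1 ≠ ⊤ := by
    rintro rfl
    rw [ENNReal.top_mul (by simp)] at hc1
    exact hκ1t hc1.symm
  -- measurability of local masses
  have hmeas : ∀ (A : Set (Y × ℝ)), MeasurableSet A → ∀ i,
      Measurable fun z : Y × ℝ => volume {t | t ∈ JJ L i z.2 ∧ (z.1, t) ∈ A} := by
    intro A hA i
    have hS : MeasurableSet {q : (Y × ℝ) × ℝ | q.2 ∈ JJ L i q.1.2 ∧ (q.1.1, q.2) ∈ A} := by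
      refine MeasurableSet.inter ?_ ?_
      · exact (show Measurable fun q : (Y × ℝ) × ℝ => (q.1.2, q.2) by fun_prop) (JJ_measurable L i)
      · exact (show Measurable fun q : (Y × ℝ) × ℝ => (q.1.1, q.2) by fun_prop) hA
    exact measurable_measure_prodMk_left hS
  let mm : ℕ → Y × ℝ → ℝ≥0∞ := fun i z => volume {t | t ∈ JJ L i z.2 ∧ (z.1, t) ∈ B}
  have hmm : ∀ i, Measurable (mm i) := hmeas B hB
  have hmle : ∀ i z, mm i z ≤ ((L:ℝ≥0∞) ^ i)⁻¹ := fun i z => by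
    rw [← JJ_vol hL i z.2]; exact measure_mono fun t ht => ht.1
  -- slice lemma
  have hslice : ∀ A : Set (Y × ℝ), MeasurableSet A → ∀ A' : Set (Y × ℝ), ∀ c : ℝ≥0∞,
      MeasurableSet A' → (∀ y, volume {t | (y,t) ∈ A} ≤ c * volume {t | (y,t) ∈ A'}) →
      (μ.prod volume) A ≤ c * (μ.prod volume) A' := by
    intro A hA A' c hA' h
    rw [Measure.prod_apply hA, Measure.prod_apply hA', ← lintegral_const_mul _ (measurable_measure_prodMk_left hA')]
    exact lintegral_mono h
  set B0 : Set (Y × ℝ) := {z | z ∈ B ∧ κ0 ≤ mm i0 z} with hB0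
  have hB0m : MeasurableSet B0 := hB.inter (measurableSet_le measurable_const (hmm i0))
  have hLp : (L:ℝ≥0∞) ^ i0 ≠ 0 := by
    refine pow_ne_zero _ ?_
    simp; omega
  have hLt : (L:ℝ≥0∞) ^ i0 ≠ ⊤ := ENNReal.pow_ne_top (ENNReal.natCast_ne_top L)
  have hrem : 2 * (μ.prod volume) (B \ B0) ≤ (μ.prod volume) B := by
    have h1 : (μ.prod volume) (B \ B0) ≤ (κ0 * (L:ℝ≥0∞)^i0) * (μ.prod volume) (E ×ˢ Icc (-2:ℝ) 2) := by
      refine hslice _ (hB.diff hB0m) _ _ (hE.prod measurableSet_Icc) fun y => ?_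
      by_cases hy : y ∈ E
      · have e1 : {t | (y,t) ∈ E ×ˢ Icc (-2:ℝ) 2} = Icc (-2) 2 := by ext t; simp [hy]
        rw [e1]
        have := JJ_sum L i0 {t | (y,t) ∈ B \ B0} (measurable_prodMk_left (hB.diff hB0m))
          ((κ0 * (L:ℝ≥0∞)^i0) • volume.restrict (Icc (-2:ℝ) 2)) ?_
        · simpa using this
        · intro s hs
          have hlt : mm i0 (y,s) < κ0 := by
            by_contra hh
            exact hs.2 ⟨hs.1, not_lt.1 hh⟩
          have h2 : volume ({t | (y,t) ∈ B \ B0} ∩ JJ L i0 s) ≤ mm i0 (y,s) :=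
            measure_mono fun t ht => ⟨ht.2, ht.1.1⟩
          refine h2.trans (hlt.le.trans ?_)
          rw [Measure.smul_apply, Measure.restrict_apply (JJ_meas _ _ _)]
          have h3 : JJ L i0 s ∩ Icc (-2) 2 = JJ L i0 s := by
            refine inter_eq_left.2 fun t ht => ?_
            have h4 := JJ_abs hL ht
            have h5 : 1 / (L:ℝ)^i0 ≤ 1 := by
              rw [div_le_one (by positivity)]
              exact one_le_pow₀ (by exact_mod_cast (by omega : 1 ≤ L))
            have h6 := (hBE hs.1).2
            simp only [mem_Icc] at h6 ⊢
            have := abs_le.1 (h4.trans h5)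
            constructor <;> linarith [this.1, this.2, h6.1, h6.2]
          rw [h3, JJ_vol hL, smul_eq_mul, mul_assoc, ENNReal.mul_inv_cancel hLp hLt, mul_one]
      · have e1 : {t | (y,t) ∈ B \ B0} = ∅ := by
          ext t; simp only [mem_ofPred_eq, mem_empty_iff_false, iff_false]
          exact fun h => hy (hBE h.1).1
        rw [e1]; simp
    rw [Measure.prod_prod, Real.volume_Icc] at h1
    have h7 : ENNReal.ofReal (2 - -2) = 4 := by norm_num
    rw [h7] at h1
    calc 2 * (μ.prod volume) (B \ B0) ≤ 2 * ((κ0 * (L:ℝ≥0∞)^i0) * (μ E * 4)) := by gcongr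
      _ = κ0 * (8 * (L:ℝ≥0∞) ^ i0) * μ E := by ring
      _ = α * μ E := by rw [hκ0]
      _ ≤ _ := hα
  have hB0v : (μ.prod volume) B ≤ 2 * (μ.prod volume) B0 := by
    have h1 : (μ.prod volume) B ≤ (μ.prod volume) B0 + (μ.prod volume) (B \ B0) := by
      rw [← measure_sdiff_add_inter B hB0m]
      rw [add_comm]; gcongr; exact inter_subset_right
    have h2 : 2 * (μ.prod volume) B ≤ 2 * (μ.prod volume) B0 + (μ.prod volume) B := by
      calc 2 * (μ.prod volume) B ≤ 2 * ((μ.prod volume) B0 + (μ.prod volume) (B \ B0)) := by gcongr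
        _ = 2 * (μ.prod volume) B0 + 2 * (μ.prod volume) (B \ B0) := by ring
        _ ≤ _ := by gcongr
    rw [two_mul] at h2
    exact ENNReal.le_of_add_le_add_right hb h2
  -- the pieces
  let Bi : ℕ → Set (Y × ℝ) := fun d => {z | z ∈ B0 ∧ c1 ^ d * mm i0 z ≤ mm (i0 + d) z ∧
    mm (i0 + (d + 1)) z ≤ c1 ^ (d+1) * mm i0 z}
  have hBim : ∀ d, MeasurableSet (Bi d) := fun d =>
    hB0m.inter ((measurableSet_le ((hmm i0).const_mul _) (hmm _)).inter
      (measurableSet_le (hmm _) ((hmm i0).const_mul _)))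
  have hcov : B0 ⊆ ⋃ d ∈ Finset.range K, Bi d := by
    intro z hz
    have hbad : ∃ d, mm (i0 + d) z < c1 ^ d * mm i0 z := by
      refine ⟨K, (hmle _ z).trans_lt (hsmall.trans_le ?_)⟩
      gcongr
      exact hz.2
    have hfind := Nat.find_spec hbad
    have hfK : Nat.find hbad ≤ K := by
      refine Nat.find_min' hbad ?_
      refine (hmle _ z).trans_lt (hsmall.trans_le ?_)
      gcongr
      exact hz.2
    have hf0 : Nat.find hbad ≠ 0 := by
      intro h0
      rw [h0] at hfind
      simp at hfind
    obtain ⟨d, hd⟩ := Nat.exists_eq_succ_of_ne_zero hf0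
    have hlast : ¬ mm (i0 + d) z < c1 ^ d * mm i0 z := Nat.find_min hbad (by omega)
    rw [hd] at hfind
    simp only [mem_iUnion, Finset.mem_range]
    exact ⟨d, by omega, hz, not_lt.1 hlast, hfind.le⟩
  have hpig : ∃ d ∈ Finset.range K, (μ.prod volume) B ≤ (2 * K) * (μ.prod volume) (Bi d) := by
    by_contra hcon
    push Not at hcon
    have h1 : (μ.prod volume) B0 ≤ ∑ d ∈ Finset.range K, (μ.prod volume) (Bi d) :=
      (measure_mono hcov).trans (measure_biUnion_finset_le _ _)
    have h2 : ∑ d ∈ Finset.range K, (2 * (K:ℝ≥0∞)) * (μ.prod volume) (Bi d) < ∑ d ∈ Finset.range K, (μ.prod volume) B := by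
      refine ENNReal.sum_lt_sum_of_nonempty (Finset.nonempty_range_iff.2 hK.ne') hcon
    rw [← Finset.mul_sum, Finset.sum_const, Finset.card_range, nsmul_eq_mul] at h2
    have h3 : (K:ℝ≥0∞) * (μ.prod volume) B ≤ (2 * (K:ℝ≥0∞)) * ∑ d ∈ Finset.range K, (μ.prod volume) (Bi d) := by
      calc (K:ℝ≥0∞) * (μ.prod volume) B ≤ K * (2 * (μ.prod volume) B0) := by gcongr
        _ = 2 * (K:ℝ≥0∞) * (μ.prod volume) B0 := by ring
        _ ≤ _ := by gcongr
    exact absurd h2 (not_lt.2 h3)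
  obtain ⟨d, hdK, hdv⟩ := hpig
  rw [Finset.mem_range] at hdK
  let m1 : Y × ℝ → ℝ≥0∞ := fun z => volume {t | t ∈ JJ L (i0+d) z.2 ∧ (z.1, t) ∈ Bi d}
  have hm1 : Measurable m1 := hmeas _ (hBim d) _
  let B2 : Set (Y × ℝ) := {z | z ∈ Bi d ∧ κ1 * mm (i0 + d) z ≤ m1 z}
  have hB2m : MeasurableSet B2 := (hBim d).inter (measurableSet_le ((hmm _).const_mul _) hm1)
  have hrem2 : (μ.prod volume) (Bi d \ B2) ≤ κ1 * (μ.prod volume) B := by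
    refine hslice _ ((hBim d).diff hB2m) _ _ hB fun y => ?_
    have := JJ_sum L (i0+d) {t | (y,t) ∈ Bi d \ B2} (measurable_prodMk_left ((hBim d).diff hB2m))
          (κ1 • volume.restrict {t | (y,t) ∈ B}) ?_
    · simpa using this
    · intro s hs
      have hlt : m1 (y,s) < κ1 * mm (i0+d) (y,s) := by
        by_contra hh
        exact hs.2 ⟨hs.1, not_lt.1 hh⟩
      have h2 : volume ({t | (y,t) ∈ Bi d \ B2} ∩ JJ L (i0+d) s) ≤ m1 (y,s) :=
        measure_mono fun t ht => ⟨ht.2, ht.1.1⟩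
      refine h2.trans (hlt.le.trans ?_)
      rw [Measure.smul_apply, Measure.restrict_apply (JJ_meas _ _ _), smul_eq_mul]
      exact le_of_eq rfl
  have hB1B : Bi d ⊆ B := fun z hz => hz.1.1
  have hvol : κ1 * (μ.prod volume) B ≤ (μ.prod volume) B2 := by
    have h1 : (μ.prod volume) (Bi d) ≤ (μ.prod volume) B2 + (μ.prod volume) (Bi d \ B2) := by
      rw [← measure_sdiff_add_inter (Bi d) hB2m]
      rw [add_comm]; gcongr; exact inter_subset_right
    have h2 : κ1 * (μ.prod volume) B + κ1 * (μ.prod volume) B ≤ (μ.prod volume) (Bi d) := by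
      calc κ1 * (μ.prod volume) B + κ1 * (μ.prod volume) B = 2 * κ1 * (μ.prod volume) B := by ring
        _ ≤ 2 * κ1 * ((2 * K) * (μ.prod volume) (Bi d)) := by gcongr
        _ = (κ1 * (4 * K)) * (μ.prod volume) (Bi d) := by ring
        _ = _ := by rw [hκ1, ENNReal.inv_mul_cancel hK0 hKt, one_mul]
    have h3 : κ1 * (μ.prod volume) B + κ1 * (μ.prod volume) B ≤ (μ.prod volume) B2 + κ1 * (μ.prod volume) B :=
      h2.trans (h1.trans (by gcongr))
    exact ENNReal.le_of_add_le_add_right (ENNReal.mul_ne_top hκ1t hb) h3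
  refine ⟨i0 + d, by omega, by omega, Bi d, B2, hBim d, hB2m, fun z hz => hz.1, hB1B, hvol, ?_⟩
  intro y s hys
  -- translate
  have htr : ∀ A : Set ℝ, volume {τ | s + τ ∈ A} = volume A := fun A =>
    measure_preimage_add volume s A
  set T0 : Set ℝ := {t | t ∈ JJ L (i0+d) s ∧ (y,t) ∈ Bi d} with hT0
  have hT0m : MeasurableSet T0 := (JJ_meas _ _ _).inter (measurable_prodMk_left (hBim d))
  have hTe : {τ | s + τ ∈ JJ L (i0+d) s ∧ (y, s + τ) ∈ Bi d} = {τ | s + τ ∈ T0} := rfl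
  rw [hTe, htr]
  have hlow : κ1 * (c1 ^ K * κ0) ≤ volume T0 := by
    have h1 : κ1 * mm (i0+d) (y,s) ≤ volume T0 := hys.2
    refine le_trans ?_ h1
    gcongr
    refine le_trans ?_ hys.1.2.1
    have hc11 : c1 ≤ 1 := by
      have h8 : c1 ≤ κ1 := by
        rw [← hc1]
        refine le_mul_of_one_le_right (zero_le) ?_
        calc (1:ℝ≥0∞) ≤ 8 * 1 := by norm_num
          _ ≤ 8 * (D + 1) := by gcongr; exact le_add_self
      refine h8.trans ?_
      rw [hκ1, ENNReal.inv_le_one]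
      calc (1:ℝ≥0∞) ≤ 4 * 1 := by norm_num
        _ ≤ 4 * K := by gcongr; exact_mod_cast hK
    gcongr ?_ * ?_
    · exact pow_le_pow_of_le_one (zero_le) hc11 hdK.le
    · exact hys.1.1.2
  have hpos : 0 < volume T0 := by
    refine lt_of_lt_of_le ?_ hlow
    refine ENNReal.mul_pos hκ10 ?_
    exact (lt_of_le_of_lt (zero_le) hsmall).ne'
  have hchild : ∀ s' , (8 * (D+1)) * volume (T0 ∩ JJ L (i0 + (d+1)) s') ≤ volume T0 := by
    intro s'
    rcases (T0 ∩ JJ L (i0 + (d+1)) s').eq_empty_or_nonempty with h0 | ⟨u, hu, hu'⟩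
    · rw [h0]; simp
    · have h1 : volume (T0 ∩ JJ L (i0 + (d+1)) s') ≤ mm (i0 + (d+1)) (y,u) := by
        refine measure_mono fun t ht => ⟨?_, hB1B ht.1.2⟩
        simp only; rw [JJ_eq hu']; exact ht.2
      have h2 : mm (i0 + (d+1)) (y,u) ≤ c1 ^ (d+1) * mm i0 (y,u) := hu.2.2.2
      have h3 : mm i0 (y,u) = mm i0 (y,s) := by
        simp only [mm]
        rw [JJ_eq (JJ_mono hL (by omega : i0 ≤ i0 + d) s hu.1)]
      rw [h3] at h2
      calc (8 * ((D:ℝ≥0∞)+1)) * volume (T0 ∩ JJ L (i0 + (d+1)) s') ≤ (8 * (D+1)) * (c1 ^ (d+1) * mm i0 (y,s)) := by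
            gcongr; exact h1.trans h2
        _ = (c1 * (8 * (D+1))) * (c1 ^ d * mm i0 (y,s)) := by ring
        _ = κ1 * (c1 ^ d * mm i0 (y,s)) := by rw [hc1]
        _ ≤ κ1 * mm (i0+d) (y,s) := by gcongr; exact hys.1.2.1
        _ ≤ _ := hys.2
  refine ⟨⟨?_, ?_, ?_, ?_⟩, hlow⟩
  · exact (measurable_const_add s) hT0m
  · intro τ hτ
    have := JJ_abs hL hτ.1
    rw [add_sub_cancel_left] at this
    exact abs_le.1 this
  · rw [htr]; exact hpos
  · intro a
    rw [htr]
    have h1 : {τ | s + τ ∈ T0} ∩ Icc a (a + 1 / L * (1 / (L:ℝ) ^ (i0+d))) ⊆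
        {τ | s + τ ∈ (T0 ∩ JJ L (i0+(d+1)) (s + a)) ∪ (T0 ∩ JJ L (i0+(d+1)) (s + a + 1 / (L:ℝ)^(i0+(d+1))))} := by
      intro τ hτ
      have hp : (0:ℝ) < (L:ℝ) ^ (i0+(d+1)) := by positivity
      have e : 1 / L * (1 / (L:ℝ) ^ (i0+d)) = 1 / (L:ℝ)^(i0+(d+1)) := by
        rw [one_div_mul_one_div, ← pow_succ', add_assoc]
      rw [e] at hτ
      have h2 : (L:ℝ) ^ (i0+(d+1)) * (s + a) ≤ (L:ℝ) ^ (i0+(d+1)) * (s + τ) := by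
        gcongr; exact hτ.2.1
      have h3 : (L:ℝ) ^ (i0+(d+1)) * (s + τ) ≤ (L:ℝ) ^ (i0+(d+1)) * (s + a) + 1 := by
        have : (L:ℝ) ^ (i0+(d+1)) * (s + τ) ≤ (L:ℝ) ^ (i0+(d+1)) * (s + (a + 1 / (L:ℝ)^(i0+(d+1)))) := by
          gcongr; exact hτ.2.2
        refine this.trans (le_of_eq ?_)
        field_simp
        ring
      have h4 : (L:ℝ) ^ (i0+(d+1)) * (s + a + 1 / (L:ℝ)^(i0+(d+1))) = (L:ℝ) ^ (i0+(d+1)) * (s + a) + 1 := by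
        field_simp
      have f1 := Int.floor_le_floor h2
      have f2 := Int.floor_le_floor h3
      rw [Int.floor_add_one] at f2
      rcases (by omega : ⌊(L:ℝ) ^ (i0+(d+1)) * (s + τ)⌋ = ⌊(L:ℝ) ^ (i0+(d+1)) * (s + a)⌋ ∨
        ⌊(L:ℝ) ^ (i0+(d+1)) * (s + τ)⌋ = ⌊(L:ℝ) ^ (i0+(d+1)) * (s + a)⌋ + 1) with h | h
      · exact Or.inl ⟨hτ.1, h⟩
      · refine Or.inr ⟨hτ.1, ?_⟩
        simp only [JJ, mem_ofPred_eq]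
        rw [h4, Int.floor_add_one, h]
    calc (4 * ((D:ℝ≥0∞)+1)) * volume ({τ | s + τ ∈ T0} ∩ Icc a (a + 1 / L * (1 / (L:ℝ) ^ (i0+d))))
        ≤ (4 * (D+1)) * (volume (T0 ∩ JJ L (i0+(d+1)) (s + a)) + volume (T0 ∩ JJ L (i0+(d+1)) (s + a + 1 / (L:ℝ)^(i0+(d+1))))) := by
          gcongr
          exact (measure_mono h1).trans ((htr _).le.trans (measure_union_le _ _))
      _ ≤ volume T0 := by
          have a1 := hchild (s+a)
          have a2 := hchild (s + a + 1 / (L:ℝ)^(i0+(d+1)))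
          set x := volume (T0 ∩ JJ L (i0+(d+1)) (s + a))
          set z := volume (T0 ∩ JJ L (i0+(d+1)) (s + a + 1 / (L:ℝ)^(i0+(d+1))))
          rcases le_total x z with h | h
          · calc (4 * ((D:ℝ≥0∞)+1)) * (x + z) ≤ (4 * (D+1)) * (z + z) := by gcongr
              _ = (8 * (D+1)) * z := by ring
              _ ≤ _ := a2
          · calc (4 * ((D:ℝ≥0∞)+1)) * (x + z) ≤ (4 * (D+1)) * (x + x) := by gcongr
              _ = (8 * (D+1)) * x := by ring
              _ ≤ _ := a1

end

set_option linter.unusedVariables false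
open MeasureTheory Set Metric
open scoped ENNReal NNReal
noncomputable section

lemma prod_tsum_ennreal {ι : Type} : ∀ (k : ℕ) (a : Fin k → ι → ℝ≥0∞),
    ∏ j, ∑' m, a j m = ∑' m : Fin k → ι, ∏ j, a j (m j)
  | 0, a => by simp
  | k+1, a => by
    rw [Fin.prod_univ_succ, prod_tsum_ennreal k fun j => a j.succ]
    rw [← (Fin.consEquiv fun _ : Fin (k+1) => ι).tsum_eq]
    rw [ENNReal.tsum_prod', ← ENNReal.tsum_mul_right]
    refine tsum_congr fun m0 => ?_
    rw [← ENNReal.tsum_mul_left]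
    refine tsum_congr fun m => ?_
    rw [Fin.prod_univ_succ]
    simp [Fin.consEquiv]

lemma dyadic_le (g : ℝ≥0∞) : g ≤ ∑' m : ℤ, {t : ℝ≥0∞ | (2:ℝ≥0∞) ^ m ≤ t}.indicator (fun _ => (2:ℝ≥0∞) ^ (m+1)) g := by
  rcases eq_or_ne g 0 with rfl | h0
  · simp
  rcases eq_or_ne g ⊤ with rfl | ht
  · have : ∀ n : ℕ, (2:ℝ≥0∞) ^ n ≤ ∑' m : ℤ, {t : ℝ≥0∞ | (2:ℝ≥0∞) ^ m ≤ t}.indicator (fun _ => (2:ℝ≥0∞) ^ (m+1)) ⊤ := by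
      intro n
      refine le_trans ?_ (ENNReal.le_tsum ((n:ℤ) - 1))
      rw [indicator_of_mem (by simp)]
      rw [sub_add_cancel, zpow_natCast]
    refine le_of_eq (Eq.symm ?_)
    refine ENNReal.eq_top_of_forall_nnreal_le fun r => ?_
    obtain ⟨n, hn⟩ := pow_unbounded_of_one_lt r (one_lt_two)
    refine le_trans ?_ (this n)
    exact_mod_cast hn.le
  · obtain ⟨m, h1, h2⟩ := ENNReal.exists_mem_Ico_zpow h0 ht (by norm_num : (1:ℝ≥0∞) < 2) (by norm_num)
    refine h2.le.trans ?_
    refine le_trans ?_ (ENNReal.le_tsum m)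
    rw [indicator_of_mem (by exact h1)]

lemma geo_int (r : ℝ≥0∞) (hr : r < 1) : ∑' m : ℤ, r ^ m.natAbs ≠ ⊤ := by
  have h1 : ∑' m : ℤ, r ^ m.natAbs ≤ ∑' n : ℕ, r ^ n + ∑' n : ℕ, r ^ n := by
    let e : ℤ ≃ ℕ ⊕ ℕ := Equiv.intEquivNatSumNat
    rw [← e.symm.tsum_eq, ENNReal.summable.tsum_sum (by exact ENNReal.summable)]
    refine add_le_add (ENNReal.tsum_le_tsum fun n => ?_) (ENNReal.tsum_le_tsum fun n => ?_)
    · exact le_of_eq rfl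
    · have : (e.symm (Sum.inr n)).natAbs = n + 1 := rfl
      rw [this, pow_succ]
      exact mul_le_of_le_one_right' hr.le
  refine ne_top_of_le_ne_top ?_ h1
  rw [ENNReal.tsum_geometric]
  have : (1 - r)⁻¹ ≠ ⊤ := ENNReal.inv_ne_top.2 (tsub_pos_of_lt hr).ne'
  simp [this]

lemma strong_type {k : ℕ} {Z Y : Type*} [MeasurableSpace Z] [MeasurableSpace Y] (ρ : Measure Z) (μ : Measure Y)
    (π : Fin k → Z → Y) (hπ : ∀ j, Measurable (π j)) (P : Fin k → ℝ) (hP : ∀ j, 1 ≤ P j)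
    (η : ℝ) (hη : 0 < η) (hηP : ∀ j, η ≤ (P j)⁻¹) (C : ℝ≥0∞) (hC : C ≠ ⊤)
    (HN : ∀ j (S : Set Y), MeasurableSet S → μ S = 0 → ρ (π j ⁻¹' S) = 0)
    (HR : ∀ q : Fin k → ℝ, (∀ j, |q j - (P j)⁻¹| ≤ η) → ∀ S : Fin k → Set Y, (∀ j, MeasurableSet (S j)) →
      (∀ j, μ (S j) ≠ ⊤) → ρ (⋂ j, π j ⁻¹' (S j)) ≤ C * ∏ j, μ (S j) ^ q j) :
    ∃ C' : ℝ≥0, ∀ f : Fin k → Y → ℝ≥0∞, (∀ j, Measurable (f j)) →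
      ∫⁻ x, ∏ j, f j (π j x) ∂ρ ≤ C' * ∏ j, (∫⁻ y, f j y ^ P j ∂μ) ^ (P j)⁻¹ := by
  classical
  set r : ℝ≥0∞ := (2:ℝ≥0∞) ^ (-η) with hr
  have hr1 : r < 1 := ENNReal.rpow_lt_one_of_one_lt_of_neg (by norm_num) (by linarith)
  set G : ℝ≥0∞ := ∑' m : ℤ, 2 * r ^ m.natAbs with hG
  have hGt : G ≠ ⊤ := by
    rw [hG, ENNReal.tsum_mul_left]
    exact ENNReal.mul_ne_top (by norm_num) (geo_int r hr1)
  have hP0 : ∀ j, 0 < P j := fun j => lt_of_lt_of_le one_pos (hP j)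
  -- normalized bound
  have main : ∀ g : Fin k → Y → ℝ≥0∞, (∀ j, Measurable (g j)) → (∀ j, ∫⁻ y, g j y ^ P j ∂μ ≤ 1) →
      ∫⁻ x, ∏ j, g j (π j x) ∂ρ ≤ C * G ^ k := by
    intro g hg hg1
    let S : Fin k → ℤ → Set Y := fun j m => {y | (2:ℝ≥0∞) ^ m ≤ g j y}
    have hSm : ∀ j m, MeasurableSet (S j m) := fun j m => measurableSet_le measurable_const (hg j)
    have hSv : ∀ j m, μ (S j m) ≤ (2:ℝ≥0∞) ^ (-(m:ℝ) * P j) := by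
      intro j m
      have h1 := mul_meas_ge_le_lintegral (μ := μ) ((hg j).pow_const (P j)) (((2:ℝ≥0∞) ^ m) ^ P j)
      have h2 : {y | ((2:ℝ≥0∞) ^ m) ^ P j ≤ g j y ^ P j} = S j m := by
        ext y
        exact ENNReal.rpow_le_rpow_iff (hP0 j)
      rw [h2] at h1
      have h3 := h1.trans (hg1 j)
      have h4 : ((2:ℝ≥0∞) ^ m) ^ P j = (2:ℝ≥0∞) ^ ((m:ℝ) * P j) := by
        rw [← ENNReal.rpow_intCast, ← ENNReal.rpow_mul]
      rw [h4, mul_comm] at h3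
      rw [neg_mul, ENNReal.rpow_neg, ← one_div]
      refine (ENNReal.le_div_iff_mul_le (Or.inl ?_) (Or.inl ?_)).2 h3
      · exact (ENNReal.rpow_pos (by norm_num) (by norm_num)).ne'
      · exact ENNReal.rpow_ne_top_of_ne_zero (by norm_num) (by norm_num)
    have hpt : ∀ x, ∏ j, g j (π j x) ≤ ∑' m : Fin k → ℤ, ∏ j, (π j ⁻¹' S j (m j)).indicator (fun _ => (2:ℝ≥0∞) ^ (m j + 1)) x := by
      intro x
      rw [← prod_tsum_ennreal k (fun j m => (π j ⁻¹' S j m).indicator (fun _ => (2:ℝ≥0∞) ^ (m + 1)) x)]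
      refine Finset.prod_le_prod' fun j _ => ?_
      refine (dyadic_le _).trans (ENNReal.tsum_le_tsum fun m => ?_)
      exact le_of_eq rfl
    refine (lintegral_mono hpt).trans ?_
    rw [lintegral_tsum]
    swap
    · intro m
      refine Measurable.aemeasurable ?_
      refine Finset.measurable_prod _ fun j _ => ?_
      exact measurable_const.indicator (hπ j (hSm _ _))
    have hGk : C * G ^ k = ∑' m : Fin k → ℤ, C * ∏ j, (2 * r ^ (m j).natAbs) := by
      rw [ENNReal.tsum_mul_left, ← prod_tsum_ennreal k (fun (j : Fin k) (m : ℤ) => 2 * r ^ m.natAbs)]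
      simp [hG]
    rw [hGk]
    refine ENNReal.tsum_le_tsum fun m => ?_
    have e1 : ∀ x, ∏ j, (π j ⁻¹' S j (m j)).indicator (fun _ => (2:ℝ≥0∞) ^ (m j + 1)) x =
        (⋂ j, π j ⁻¹' S j (m j)).indicator (fun _ => ∏ j, (2:ℝ≥0∞) ^ (m j + 1)) x := by
      intro x
      by_cases hx : x ∈ ⋂ j, π j ⁻¹' S j (m j)
      · rw [indicator_of_mem hx]
        refine Finset.prod_congr rfl fun j _ => ?_
        rw [indicator_of_mem (mem_iInter.1 hx j)]
      · rw [indicator_of_notMem hx]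
        simp only [mem_iInter, not_forall] at hx
        obtain ⟨j, hj⟩ := hx
        exact Finset.prod_eq_zero (Finset.mem_univ j) (indicator_of_notMem hj _)
    simp only [e1]
    rw [lintegral_indicator_const (MeasurableSet.iInter fun j => hπ j (hSm _ _))]
    let q : Fin k → ℝ := fun j => (P j)⁻¹ + (if 0 ≤ m j then η else -η)
    have hq : ∀ j, |q j - (P j)⁻¹| ≤ η := by
      intro j
      simp only [q, add_sub_cancel_left]
      split_ifs
      · rw [abs_of_pos hη]
      · rw [abs_neg, abs_of_pos hη]
    have hq0 : ∀ j, 0 ≤ q j := by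
      intro j
      have := (abs_le.1 (hq j)).1
      linarith [hηP j]
    have hfin : ∀ j, μ (S j (m j)) ≠ ⊤ := fun j =>
      ne_top_of_le_ne_top (ENNReal.rpow_ne_top_of_ne_zero (by norm_num) (by norm_num)) (hSv j (m j))
    calc (∏ j, (2:ℝ≥0∞) ^ (m j + 1)) * ρ (⋂ j, π j ⁻¹' S j (m j))
        ≤ (∏ j, (2:ℝ≥0∞) ^ (m j + 1)) * (C * ∏ j, μ (S j (m j)) ^ q j) := by
          gcongr; exact HR q hq _ (fun j => hSm _ _) hfin
      _ = C * ∏ j, ((2:ℝ≥0∞) ^ (m j + 1) * μ (S j (m j)) ^ q j) := by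
          rw [Finset.prod_mul_distrib]; ring
      _ ≤ _ := by
          refine mul_le_mul_right (Finset.prod_le_prod' fun j _ => ?_) _
          calc (2:ℝ≥0∞) ^ (m j + 1) * μ (S j (m j)) ^ q j ≤ (2:ℝ≥0∞) ^ (m j + 1) * ((2:ℝ≥0∞) ^ (-(m j:ℝ) * P j)) ^ q j := by
                exact mul_le_mul_right (ENNReal.rpow_le_rpow (hSv j (m j)) (hq0 j)) _
            _ = (2:ℝ≥0∞) ^ (((m j : ℝ) + 1) + (-(m j:ℝ) * P j) * q j) := by
                rw [← ENNReal.rpow_mul, ENNReal.rpow_add _ _ (by norm_num) (by norm_num)]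
                congr 1
                rw [← ENNReal.rpow_intCast]; push_cast; rfl
            _ ≤ (2:ℝ≥0∞) ^ ((1:ℝ) + (-η) * ((m j).natAbs : ℝ)) := by
                refine ENNReal.rpow_le_rpow_of_exponent_le (by norm_num) ?_
                have hnat : ((m j).natAbs : ℝ) = |(m j : ℝ)| := by
                  rw [Nat.cast_natAbs]; push_cast; rfl
                rw [hnat]
                have hPP : P j * (P j)⁻¹ = 1 := mul_inv_cancel₀ (hP0 j).ne'
                simp only [q]
                split_ifs with h
                · have h' : (0:ℝ) ≤ m j := by exact_mod_cast h
                  rw [abs_of_nonneg h']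
                  have := mul_le_mul_of_nonneg_left (hP j) (mul_nonneg h' hη.le)
                  nlinarith
                · have h' : (m j:ℝ) ≤ 0 := by exact_mod_cast (not_le.1 h).le
                  rw [abs_of_nonpos h']
                  have := mul_le_mul_of_nonneg_left (hP j) (mul_nonneg (neg_nonneg.2 h') hη.le)
                  nlinarith
            _ = _ := by
                rw [ENNReal.rpow_add _ _ (by norm_num) (by norm_num), ENNReal.rpow_one, ENNReal.rpow_mul,
                  ENNReal.rpow_natCast]
  have hCG : C * G ^ k ≠ ⊤ := ENNReal.mul_ne_top hC (ENNReal.pow_ne_top hGt)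
  refine ⟨(C * G ^ k).toNNReal + 1, fun f hf => ?_⟩
  have hco : (((C * G ^ k).toNNReal + 1 : ℝ≥0) : ℝ≥0∞) = C * G ^ k + 1 := by
    rw [ENNReal.coe_add, ENNReal.coe_toNNReal hCG]; rfl
  rw [hco]
  let N : Fin k → ℝ≥0∞ := fun j => (∫⁻ y, f j y ^ P j ∂μ) ^ (P j)⁻¹
  change _ ≤ (C * G ^ k + 1) * ∏ j, N j
  by_cases h0 : ∃ j, N j = 0
  · obtain ⟨j, hj⟩ := h0
    have h1 : ∫⁻ y, f j y ^ P j ∂μ = 0 := by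
      have := (ENNReal.rpow_eq_zero_iff_of_pos (inv_pos.2 (hP0 j))).1 hj
      exact this
    have h2 : μ {y | f j y ≠ 0} = 0 := by
      have := (lintegral_eq_zero_iff ((hf j).pow_const (P j))).1 h1
      rw [Filter.EventuallyEq, ae_iff] at this
      convert this using 2
      ext y
      simp [ENNReal.rpow_eq_zero_iff_of_pos (hP0 j), (hP0 j).not_gt]
    have h3 := HN j {y | f j y ≠ 0} ((hf j) (measurableSet_singleton 0).compl) h2
    have h4 : ∫⁻ x, ∏ j, f j (π j x) ∂ρ = 0 := by
      rw [lintegral_eq_zero_iff (show Measurable fun x => ∏ j, f j (π j x) from Finset.measurable_prod _ fun j _ => (hf j).comp (hπ j)), Filter.EventuallyEq, ae_iff]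
      refine measure_mono_null (fun x hx => ?_) h3
      intro hx0
      exact hx (Finset.prod_eq_zero (Finset.mem_univ j) hx0)
    rw [h4]; exact zero_le
  push Not at h0
  by_cases ht : ∃ j, N j = ⊤
  · obtain ⟨j, hj⟩ := ht
    have : ∏ j, N j = ⊤ := by
      rw [← Finset.mul_prod_erase _ _ (Finset.mem_univ j), hj, ENNReal.top_mul]
      exact Finset.prod_ne_zero_iff.2 fun i _ => h0 i
    rw [this, ENNReal.mul_top (by simp)]
    exact le_top
  push Not at ht
  have hg := main (fun j y => (N j)⁻¹ * f j y) (fun j => (hf j).const_mul _) (fun j => by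
    have e : ∀ y, ((N j)⁻¹ * f j y) ^ P j = ((N j)⁻¹) ^ P j * f j y ^ P j := fun y =>
      ENNReal.mul_rpow_of_nonneg _ _ (hP0 j).le
    simp only [e]
    rw [lintegral_const_mul _ ((hf j).pow_const _), ENNReal.inv_rpow]
    have e2 : N j ^ P j = ∫⁻ y, f j y ^ P j ∂μ := by
      simp only [N]
      rw [← ENNReal.rpow_mul, inv_mul_cancel₀ (hP0 j).ne', ENNReal.rpow_one]
    rw [← e2]
    exact ENNReal.inv_mul_le_one _)
  have e3 : ∀ x, ∏ j, f j (π j x) = (∏ j, N j) * ∏ j, ((N j)⁻¹ * f j (π j x)) := by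
    intro x
    rw [← Finset.prod_mul_distrib]
    refine Finset.prod_congr rfl fun j _ => ?_
    rw [← mul_assoc, ENNReal.mul_inv_cancel (h0 j) (ht j), one_mul]
  simp only [e3]
  rw [lintegral_const_mul _ (show Measurable fun x => ∏ j, ((N j)⁻¹ * f j (π j x)) from Finset.measurable_prod _ fun j _ => ((hf j).comp (hπ j)).const_mul _), mul_comm]
  gcongr
  exact hg.trans le_self_add

end

set_option linter.unusedVariables false
open MeasureTheory Set Metric
open scoped ENNReal NNReal
noncomputable section

def QP {n k : ℕ} (π : Fin k → E n → E (n - 1)) (b : Fin k → ℝ) : Prop :=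
  ∀ ε : ℝ, 0 < ε → ∃ U ∈ nhds (0 : E n), ∃ c : ℝ, 0 < c ∧ ∀ Ω : Set (E n), Ω ⊆ U → MeasurableSet Ω →
    0 < volume Ω → ∀ S : Fin k → Set (E (n-1)), (∀ j, MeasurableSet (S j)) → (∀ j, MapsTo (π j) Ω (S j)) →
    ∀ (α : Fin k → ℝ) (αs : ℝ), 0 < αs → (∀ j, αs ≤ α j) → (∀ j, α j ≤ 1) →
    (∀ j, ENNReal.ofReal (α j) * volume (S j) ≤ volume Ω) →
    c * αs ^ ε * ∏ j, α j ^ b j ≤ (volume Ω).toReal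

lemma QP_mono {n k : ℕ} (π : Fin k → E n → E (n - 1)) (b b' : Fin k → ℝ) (h : ∀ j, b j ≤ b' j)
    (hQ : QP π b) : QP π b' := by
  intro ε hε
  obtain ⟨U, hU, c, hc, H⟩ := hQ ε hε
  refine ⟨U, hU, c, hc, fun Ω h1 h2 h3 S h4 h5 α αs h6 h7 h8 h9 => le_trans ?_ (H Ω h1 h2 h3 S h4 h5 α αs h6 h7 h8 h9)⟩
  have : 0 < αs ^ ε := Real.rpow_pos_of_pos h6 _
  have h0 : ∀ j, 0 < α j := fun j => h6.trans_le (h7 j)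
  refine mul_le_mul_of_nonneg_left ?_ (by positivity)
  refine Finset.prod_le_prod (fun j _ => (Real.rpow_pos_of_pos (h0 j) _).le) fun j _ => ?_
  exact Real.rpow_le_rpow_of_exponent_ge (h0 j) (h8 j) (h j)

lemma QP_convex {n k : ℕ} (π : Fin k → E n → E (n - 1)) : Convex ℝ {b | QP π b} := by
  intro b1 h1 b2 h2 s t hs ht hst ε hε
  obtain ⟨U1, hU1, c1, hc1, H1⟩ := h1 ε hε
  obtain ⟨U2, hU2, c2, hc2, H2⟩ := h2 ε hε
  refine ⟨U1 ∩ U2, Filter.inter_mem hU1 hU2, c1 ^ s * c2 ^ t, by positivity,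
    fun Ω h1 h2 h3 S h4 h5 α αs h6 h7 h8 h9 => ?_⟩
  have a1 := H1 Ω (h1.trans inter_subset_left) h2 h3 S h4 h5 α αs h6 h7 h8 h9
  have a2 := H2 Ω (h1.trans inter_subset_right) h2 h3 S h4 h5 α αs h6 h7 h8 h9
  have h0 : ∀ j, 0 < α j := fun j => h6.trans_le (h7 j)
  have hp : ∀ b : Fin k → ℝ, 0 < ∏ j, α j ^ b j := fun b => Finset.prod_pos fun j _ => Real.rpow_pos_of_pos (h0 j) _
  have hae : 0 < αs ^ ε := Real.rpow_pos_of_pos h6 _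
  set v := (volume Ω).toReal
  have hv : 0 < v := lt_of_lt_of_le (by have := hp b1; positivity) a1
  have e1 : (c1 * αs ^ ε * ∏ j, α j ^ b1 j) ^ s ≤ v ^ s := Real.rpow_le_rpow (by have := hp b1; positivity) a1 hs
  have e2 : (c2 * αs ^ ε * ∏ j, α j ^ b2 j) ^ t ≤ v ^ t := Real.rpow_le_rpow (by have := hp b2; positivity) a2 ht
  have e3 := mul_le_mul e1 e2 (by have := hp b2; positivity) (by positivity)
  rw [← Real.rpow_add hv, hst, Real.rpow_one] at e3
  refine le_trans (le_of_eq ?_) e3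
  rw [Real.mul_rpow (by positivity) (hp b1).le, Real.mul_rpow hc1.le hae.le,
    Real.mul_rpow (by positivity) (hp b2).le, Real.mul_rpow hc2.le hae.le]
  have e4 : αs ^ ε = (αs ^ ε) ^ s * (αs ^ ε) ^ t := by
    rw [← Real.rpow_add hae, hst, Real.rpow_one]
  have e5 : ∏ j, α j ^ ((s • b1 + t • b2) j) = (∏ j, α j ^ b1 j) ^ s * (∏ j, α j ^ b2 j) ^ t := by
    rw [← Real.finsetProd_rpow _ _ (fun j _ => (Real.rpow_pos_of_pos (h0 j) _).le),
      ← Real.finsetProd_rpow _ _ (fun j _ => (Real.rpow_pos_of_pos (h0 j) _).le), ← Finset.prod_mul_distrib]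
    refine Finset.prod_congr rfl fun j _ => ?_
    rw [← Real.rpow_mul (h0 j).le, ← Real.rpow_mul (h0 j).le, ← Real.rpow_add (h0 j)]
    congr 1
    simp; ring
  rw [e5]
  nth_rewrite 1 [e4]
  ring

/-- algebra: from the lower bound on `v` in terms of `α` to the restricted type bound -/
lemma restr_alg {k : ℕ} (v : ℝ) (hv : 0 < v) (e b q : Fin k → ℝ) (he : ∀ j, 0 < e j) (c C0 : ℝ) (hc : 0 < c) (hC0 : 0 < C0)
    (σ : ℝ) (hσ : 0 < σ) (hq : ∑ j, q j = σ + 1) (hb : ∀ j, b j * σ = q j)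
    (H : c * ∏ j, (v / (C0 * e j)) ^ b j ≤ v) : v ≤ (c⁻¹) ^ σ * C0 ^ (σ + 1) * ∏ j, e j ^ q j := by
  have h0 : ∀ j, 0 < v / (C0 * e j) := fun j => by have := he j; positivity
  have hp : 0 < ∏ j, (v / (C0 * e j)) ^ b j := Finset.prod_pos fun j _ => Real.rpow_pos_of_pos (h0 j) _
  have h1 := Real.rpow_le_rpow (by positivity) H hσ.le
  rw [Real.mul_rpow hc.le hp.le, ← Real.finsetProd_rpow _ _ (fun j _ => (Real.rpow_pos_of_pos (h0 j) _).le)] at h1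
  have h2 : ∏ j, ((v / (C0 * e j)) ^ b j) ^ σ = v ^ (σ+1) / (C0 ^ (σ+1) * ∏ j, e j ^ q j) := by
    have : ∀ j, ((v / (C0 * e j)) ^ b j) ^ σ = v ^ q j / (C0 ^ q j * e j ^ q j) := by
      intro j
      rw [← Real.rpow_mul (h0 j).le, hb, Real.div_rpow hv.le (by have := he j; positivity), Real.mul_rpow hC0.le (he j).le]
    simp only [this]
    rw [Finset.prod_div_distrib, Finset.prod_mul_distrib, ← Real.rpow_sum_of_pos hv, ← Real.rpow_sum_of_pos hC0, hq]
  rw [h2, Real.rpow_add hv, Real.rpow_one] at h1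
  have hep : 0 < ∏ j, e j ^ q j := Finset.prod_pos fun j _ => Real.rpow_pos_of_pos (he j) _
  have hvs : 0 < v ^ σ := Real.rpow_pos_of_pos hv _
  have hcs : 0 < c ^ σ := Real.rpow_pos_of_pos hc _
  have hCs : 0 < C0 ^ (σ+1) := Real.rpow_pos_of_pos hC0 _
  rw [Real.inv_rpow hc.le]
  have h3 : c ^ σ * v ≤ C0 ^ (σ+1) * ∏ j, e j ^ q j := by
    rw [← mul_div_assoc, div_le_iff₀ (by positivity)] at h1
    refine le_of_mul_le_mul_left ?_ hvs
    linarith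
  calc v = (c ^ σ)⁻¹ * (c ^ σ * v) := by field_simp
    _ ≤ (c ^ σ)⁻¹ * (C0 ^ (σ+1) * ∏ j, e j ^ q j) := by gcongr
    _ = _ := by ring

end

set_option linter.unusedVariables false
open MeasureTheory Set Metric
open scoped ENNReal NNReal
noncomputable section

lemma exists_shift {n k : ℕ} (X : Fin k → E n → E n) (b : Fin k → ℝ) (hb : b ∈ interior (newtonP n k X))
    (π : Fin k → E n → E (n - 1))
    (hQ : ∀ I : Fin n → List (Fin k), (∀ i, I i ≠ []) → lam X I 0 ≠ 0 → QP π (fun j => (degI I j : ℝ))) :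
    ∃ δ > 0, (∀ j, δ ≤ b j) ∧ ∃ b' : Fin k → ℝ, (∀ j, b' j ≤ b j - δ) ∧ QP π b' := by
  obtain ⟨r, hr, hball⟩ := Metric.mem_nhds_iff.1 (mem_interior_iff_mem_nhds.1 hb)
  have h1 : (fun j => b j - r / 2) ∈ newtonP n k X := by
    apply hball
    rw [mem_ball, dist_pi_lt_iff hr]
    intro j
    rw [Real.dist_eq]
    rw [show b j - r / 2 - b j = -(r/2) by ring, abs_neg, abs_of_pos (by linarith)]
    linarith
  obtain ⟨b', hb', hd⟩ := Metric.mem_closure_iff.1 h1 (r/4) (by linarith)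
  have hle : ∀ j, b' j ≤ b j - r / 4 := by
    intro j
    have := (dist_pi_lt_iff (by linarith)).1 hd j
    rw [Real.dist_eq] at this
    have := (abs_lt.1 this).1
    linarith
  have hS : {b : Fin k → ℝ | ∃ I : Fin n → List (Fin k),
    (∀ i, I i ≠ []) ∧ lam X I 0 ≠ 0 ∧ ∀ j, (degI I j : ℝ) ≤ b j} ⊆ {b | QP π b} := by
    rintro b ⟨I, h1, h2, h3⟩
    exact QP_mono π _ b h3 (hQ I h1 h2)
  have hS0 : {b : Fin k → ℝ | ∃ I : Fin n → List (Fin k),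
    (∀ i, I i ≠ []) ∧ lam X I 0 ≠ 0 ∧ ∀ j, (degI I j : ℝ) ≤ b j} ⊆ Ici 0 := by
    rintro b ⟨I, h1, h2, h3⟩
    intro j
    exact le_trans (by simp) (h3 j)
  refine ⟨r/4, by linarith, fun j => ?_, b', hle, convexHull_min hS (QP_convex π) hb'⟩
  have : 0 ≤ b' j := (convexHull_min hS0 (convex_Ici 0) hb') j
  linarith [hle j]

lemma restricted {n k : ℕ} (π : Fin k → E n → E (n - 1)) (hπm : ∀ j, Measurable (π j)) (b' : Fin k → ℝ)
    (hQ : QP π b')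
    (hbase : ∃ U ∈ nhds (0 : E n), ∃ C0 : ℝ, 1 ≤ C0 ∧ ∀ Ω ⊆ U, MeasurableSet Ω → ∀ j S, MeasurableSet S →
      MapsTo (π j) Ω S → volume Ω ≤ ENNReal.ofReal C0 * volume S)
    (δ : ℝ) (hδ : 0 < δ) (q : Fin k → ℝ) (hq : 1 < ∑ j, q j) (hqb : ∀ j, b' j ≤ q j / (∑ j, q j - 1) - δ) :
    ∃ U : Set (E n), IsOpen U ∧ (0 : E n) ∈ U ∧
      (∀ j (S : Set (E (n-1))), MeasurableSet S → volume S = 0 → volume.restrict U (π j ⁻¹' S) = 0) ∧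
      ∃ η0 : ℝ, 0 < η0 ∧ ∃ C : ℝ≥0∞, C ≠ ⊤ ∧ 
      ∀ q' : Fin k → ℝ, (∀ j, |q' j - q j| ≤ η0) → ∀ S : Fin k → Set (E (n-1)), (∀ j, MeasurableSet (S j)) →
      (∀ j, volume (S j) ≠ ⊤) → volume.restrict U (⋂ j, π j ⁻¹' (S j)) ≤ C * ∏ j, volume (S j) ^ q' j := by
  obtain ⟨U1, hU1, C0, hC0, HB⟩ := hbase
  obtain ⟨U2, hU2, c', hc', HQ⟩ := hQ (δ/2) (by linarith)
  obtain ⟨U, hUs, hUo, h0U⟩ := _root_.mem_nhds_iff.1 (Filter.inter_mem hU1 hU2)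
  -- continuity in q
  have hcont : ∀ j, ContinuousAt (fun q' : Fin k → ℝ => q' j / (∑ j, q' j - 1)) q := by
    intro j
    refine ContinuousAt.div (continuous_apply j).continuousAt (by fun_prop) (by linarith)
  have hnear : ∀ᶠ q' in nhds q, (1 < ∑ j, q' j ∧ ∑ j, q' j < ∑ j, q j + 1) ∧ ∀ j, b' j + δ / 2 ≤ q' j / (∑ j, q' j - 1) := by
    refine Filter.Eventually.and ?_ ?_
    · have hs : ContinuousAt (fun q' : Fin k → ℝ => ∑ j, q' j) q := by fun_prop
      exact (hs.eventually (lt_mem_nhds hq)).and (hs.eventually (gt_mem_nhds (by simp)))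
    · refine Filter.eventually_all.2 fun j => ?_
      refine ((hcont j).eventually (lt_mem_nhds (a := b' j + δ/2) ?_)).mono fun q' h => le_of_lt h
      linarith [hqb j]
  obtain ⟨η, hη, hball⟩ := Metric.nhds_basis_closedBall.mem_iff.1 hnear
  set c := min c' 1 with hcdef
  have hc : 0 < c := lt_min hc' one_pos
  set R := ∑ j, q j with hR
  refine ⟨U, hUo, h0U, ?_, η, hη, ENNReal.ofReal ((c⁻¹) ^ R * C0 ^ (R+1)), ENNReal.ofReal_ne_top, ?_⟩
  · intro j S hS hS0
    rw [Measure.restrict_apply (hπm j hS)]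
    have := HB (π j ⁻¹' S ∩ U) (inter_subset_right.trans (hUs.trans inter_subset_left)) ((hπm j hS).inter hUo.measurableSet)
      j S hS (fun x hx => hx.1)
    rw [hS0, mul_zero] at this
    exact le_antisymm this zero_le
  · intro q' hq' S hS hSt
    have hq'' : q' ∈ closedBall q η := by
      rw [mem_closedBall, dist_pi_le_iff hη.le]
      exact hq'
    obtain ⟨⟨hs1, hs2⟩, hb⟩ := hball hq''
    have hIm : MeasurableSet (⋂ j, π j ⁻¹' (S j)) := MeasurableSet.iInter fun j => hπm j (hS j)
    rw [Measure.restrict_apply hIm]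
    set Ω := (⋂ j, π j ⁻¹' (S j)) ∩ U with hΩ
    have hΩm : MeasurableSet Ω := hIm.inter hUo.measurableSet
    have hmaps : ∀ j, MapsTo (π j) Ω (S j) := fun j x hx => mem_iInter.1 hx.1 j
    have hΩ1 : Ω ⊆ U1 := inter_subset_right.trans (hUs.trans inter_subset_left)
    have hΩ2 : Ω ⊆ U2 := inter_subset_right.trans (hUs.trans inter_subset_right)
    rcases eq_or_ne (volume Ω) 0 with h0 | h0
    · rw [h0]; exact zero_le
    have hle := fun j => HB Ω hΩ1 hΩm j (S j) (hS j) (hmaps j)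
    have hS0 : ∀ j, volume (S j) ≠ 0 := by
      intro j hj
      have := hle j
      rw [hj, mul_zero] at this
      exact h0 (le_antisymm this zero_le)
    have hk : 0 < k := by
      rcases Nat.eq_zero_or_pos k with rfl | h
      · simp at hs1; linarith
      · exact h
    have hfin : volume Ω ≠ ⊤ := ne_top_of_le_ne_top (ENNReal.mul_ne_top ENNReal.ofReal_ne_top (hSt ⟨0, hk⟩)) (hle ⟨0, hk⟩)
    set v := (volume Ω).toReal with hv
    have hvpos : 0 < v := ENNReal.toReal_pos h0 hfin
    let e : Fin k → ℝ := fun j => (volume (S j)).toReal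
    have he : ∀ j, 0 < e j := fun j => ENNReal.toReal_pos (hS0 j) (hSt j)
    let α : Fin k → ℝ := fun j => v / (C0 * e j)
    have hα0 : ∀ j, 0 < α j := fun j => by have := he j; simp only [α]; positivity
    have hα1 : ∀ j, α j ≤ 1 := by
      intro j
      have h1 := ENNReal.toReal_mono (ENNReal.mul_ne_top ENNReal.ofReal_ne_top (hSt j)) (hle j)
      rw [ENNReal.toReal_mul, ENNReal.toReal_ofReal (by linarith)] at h1
      have := he j
      simp only [α]
      rw [div_le_one (by positivity)]
      exact h1
    have hmain := HQ Ω hΩ2 hΩm (pos_iff_ne_zero.2 h0) S hS hmaps α (∏ j, α j) (Finset.prod_pos fun j _ => hα0 j)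
      (fun j => by
        rw [← Finset.mul_prod_erase _ _ (Finset.mem_univ j)]
        exact mul_le_of_le_one_right (hα0 j).le (Finset.prod_le_one (fun i _ => (hα0 i).le) fun i _ => hα1 i))
      hα1 (fun j => by
        rw [← ENNReal.ofReal_toReal (hSt j), ← ENNReal.ofReal_mul (hα0 j).le, ← ENNReal.ofReal_toReal hfin]
        refine ENNReal.ofReal_le_ofReal ?_
        change v / (C0 * e j) * e j ≤ v
        have := he j
        rw [div_mul_eq_mul_div, div_le_iff₀ (by positivity)]
        have : v * e j * 1 ≤ v * e j * C0 := by gcongr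
        linarith)
    set σ := ∑ j, q' j - 1 with hσ
    have hσ0 : 0 < σ := by linarith
    have hfinal := restr_alg v hvpos e (fun j => q' j / σ) q' he c C0 hc (by linarith) σ hσ0 (by rw [hσ]; ring)
      (fun j => by field_simp) (by
        refine le_trans ?_ hmain
        rw [← Real.finsetProd_rpow _ _ (fun j _ => (hα0 j).le), mul_assoc, ← Finset.prod_mul_distrib]
        refine mul_le_mul (min_le_left _ _) ?_ (Finset.prod_nonneg fun j _ => (Real.rpow_pos_of_pos (hα0 j) _).le) hc'.le
        refine Finset.prod_le_prod (fun j _ => (Real.rpow_pos_of_pos (hα0 j) _).le) fun j _ => ?_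
        rw [← Real.rpow_add (hα0 j)]
        refine Real.rpow_le_rpow_of_exponent_ge (hα0 j) (hα1 j) ?_
        linarith [hb j])
    have hconst : (c⁻¹) ^ σ * C0 ^ (σ + 1) ≤ (c⁻¹) ^ R * C0 ^ (R+1) := by
      have hci : 1 ≤ c⁻¹ := (one_le_inv₀ hc).2 (min_le_right _ _)
      have h1 : σ ≤ R := by linarith
      refine mul_le_mul (Real.rpow_le_rpow_of_exponent_le hci h1) (Real.rpow_le_rpow_of_exponent_le hC0 (by linarith))
        (by positivity) (by positivity)
    have e1 : ∏ j, volume (S j) ^ q' j = ENNReal.ofReal (∏ j, e j ^ q' j) := by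
      rw [ENNReal.ofReal_prod_of_nonneg fun j _ => (Real.rpow_pos_of_pos (he j) _).le]
      refine Finset.prod_congr rfl fun j _ => ?_
      rw [← ENNReal.ofReal_rpow_of_pos (he j), ENNReal.ofReal_toReal (hSt j)]
    rw [e1, ← ENNReal.ofReal_mul (by positivity), ← ENNReal.ofReal_toReal hfin]
    refine ENNReal.ofReal_le_ofReal (hfinal.trans ?_)
    gcongr

lemma top_level (n k : ℕ)
    (π : Fin k → E n → E (n - 1))
    (hπs : ∀ j, ContDiff ℝ (⊤ : ℕ∞) (π j))
    (X : Fin k → E n → E n)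
    (p : Fin k → ℝ≥0∞) (hp1 : ∀ j, 1 ≤ p j) (hp : 1 < ∑ j, (p j)⁻¹)
    (hb : bOf p ∈ interior (newtonP n k X))
    (hQ : ∀ I : Fin n → List (Fin k), (∀ i, I i ≠ []) → lam X I 0 ≠ 0 → QP π (fun j => (degI I j : ℝ)))
    (hbase : ∃ U ∈ nhds (0 : E n), ∃ C0 : ℝ, 1 ≤ C0 ∧ ∀ Ω ⊆ U, MeasurableSet Ω → ∀ j S, MeasurableSet S →
      MapsTo (π j) Ω S → volume Ω ≤ ENNReal.ofReal C0 * volume S) :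
    ∃ U ∈ nhds (0 : E n), ∀ a : E n → ℝ,
      ContDiff ℝ (⊤ : ℕ∞) a → HasCompactSupport a → tsupport a ⊆ U →
      ∃ C : ℝ≥0, ∀ f : Fin k → E (n - 1) → ℝ, (∀ j, Measurable (f j)) →
        ENNReal.ofReal |∫ x, (∏ j, f j (π j x)) * a x| ≤
          (C : ℝ≥0∞) * ∏ j, eLpNorm (f j) (p j) volume := by
  obtain ⟨δ, hδ, hbδ, b', hb', hQb⟩ := exists_shift X _ hb π hQ
  have hpinv : ∀ j, (p j)⁻¹ ≠ ⊤ := fun j => ENNReal.inv_ne_top.2 (lt_of_lt_of_le one_pos (hp1 j)).ne'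
  have hsum : 1 < ∑ j, ((p j)⁻¹).toReal := by
    rw [← ENNReal.toReal_sum fun j _ => hpinv j]
    have := (ENNReal.toReal_lt_toReal (by simp) (ENNReal.sum_ne_top.2 fun j _ => hpinv j)).2 hp
    simpa using this
  have hbpos : ∀ j, 0 < ((p j)⁻¹).toReal := by
    intro j
    have h1 : 0 < bOf p j := hδ.trans_le (hbδ j)
    rw [bOf] at h1
    have h2 : 0 < (∑ j, ((p j)⁻¹).toReal) - 1 := by linarith
    exact (div_pos_iff_of_pos_right h2).1 h1
  have hpt : ∀ j, p j ≠ ⊤ := by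
    intro j h
    have := hbpos j
    simp [h] at this
  have hπm : ∀ j, Measurable (π j) := fun j => (hπs j).continuous.measurable
  obtain ⟨U, hUo, h0U, HN, η0, hη0, C, hC, HR⟩ := restricted π hπm b' hQb hbase δ hδ (fun j => ((p j)⁻¹).toReal) hsum hb'
  refine ⟨U, hUo.mem_nhds h0U, fun a ha hac haU => ?_⟩
  -- choose eta
  obtain ⟨η, hη, hη1, hη2⟩ : ∃ η > 0, η ≤ η0 ∧ ∀ j, η ≤ ((p j)⁻¹).toReal := by
    have : ∀ᶠ η in nhdsWithin (0:ℝ) (Ioi 0), η ≤ η0 ∧ ∀ j, η ≤ ((p j)⁻¹).toReal := by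
      refine Filter.Eventually.filter_mono nhdsWithin_le_nhds ?_
      refine Filter.Eventually.and (Iic_mem_nhds hη0) (Filter.eventually_all.2 fun j => Iic_mem_nhds (hbpos j))
    obtain ⟨η, h1, h2⟩ := (this.and self_mem_nhdsWithin).exists
    exact ⟨η, h2, h1.1, h1.2⟩
  have hPi : ∀ j, ((p j).toReal)⁻¹ = ((p j)⁻¹).toReal := fun j => (ENNReal.toReal_inv _).symm
  obtain ⟨C', hC'⟩ := strong_type (volume.restrict U) (volume : Measure (E (n-1))) π hπm (fun j => (p j).toReal)
    (fun j => by
      have := (ENNReal.toReal_le_toReal (by simp) (hpt j)).2 (hp1 j)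
      simpa using this) η hη (fun j => by rw [hPi]; exact hη2 j) C hC HN
    (fun q hq => HR q fun j => by rw [← hPi]; exact (hq j).trans hη1)
  obtain ⟨M, hM⟩ := hac.exists_bound_of_continuous ha.continuous
  refine ⟨(M.toNNReal) * C', fun f hf => ?_⟩
  rw [← Real.norm_eq_abs, ofReal_norm_eq_enorm]
  refine (enorm_integral_le_lintegral_enorm _).trans ?_
  have e1 : ∀ j, eLpNorm (f j) (p j) volume = (∫⁻ y, ‖f j y‖ₑ ^ (p j).toReal) ^ ((p j).toReal)⁻¹ := by
    intro j
    rw [eLpNorm_eq_lintegral_rpow_enorm_toReal (lt_of_lt_of_le one_pos (hp1 j)).ne' (hpt j), one_div]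
  simp only [e1]
  rw [ENNReal.coe_mul, mul_assoc]
  refine le_trans ?_ (mul_le_mul_right (hC' (fun j y => ‖f j y‖ₑ) (fun j => (hf j).enorm)) _)
  rw [← lintegral_const_mul _ (show Measurable fun x => ∏ j, ‖f j (π j x)‖ₑ from Finset.measurable_prod _ fun j _ => ((hf j).comp (hπm j)).enorm), ← lintegral_indicator hUo.measurableSet]
  refine lintegral_mono fun x => ?_
  by_cases hx : x ∈ U
  · rw [indicator_of_mem hx, enorm_mul, mul_comm]
    refine mul_le_mul' ?_ (le_of_eq ?_)
    · rw [← ofReal_norm_eq_enorm]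
      exact ENNReal.ofReal_le_ofReal (hM x)
    · simp only [enorm_eq_nnnorm, nnnorm_prod, ENNReal.coe_finset_prod]
  · rw [indicator_of_notMem hx]
    have : a x = 0 := by
      by_contra h
      exact hx (haU (subset_tsupport _ h))
    simp [this]

end

set_option linter.unusedVariables false
open MeasureTheory Set Metric
open scoped ENNReal NNReal
noncomputable section

lemma inv_straight {E' F' : Type*} [NormedAddCommGroup E'] [NormedSpace ℝ E'] [CompleteSpace E']
    [NormedAddCommGroup F'] [NormedSpace ℝ F'] [FiniteDimensional ℝ F']
    (Φ : E' → F') (hΦ : ContDiff ℝ (⊤ : ℕ∞) Φ) (h0 : Φ 0 = 0) (A : E' ≃L[ℝ] F')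
    (hA : fderiv ℝ Φ 0 = (A : E' →L[ℝ] F')) :
    ∃ Ψ : F' → E', ContDiff ℝ (⊤ : ℕ∞) Ψ ∧ Ψ 0 = 0 ∧ (∀ᶠ x in nhds (0 : E'), Ψ (Φ x) = x) ∧
      (∀ᶠ u in nhds (0 : F'), Φ (Ψ u) = u) := by
  have hne : ((⊤ : ℕ∞) : WithTop ℕ∞) ≠ 0 := by simp
  have hdiff : ∀ x, HasFDerivAt Φ (fderiv ℝ Φ x) x := fun x => (hΦ.differentiable hne x).hasFDerivAt
  have hA' : HasFDerivAt Φ (A : E' →L[ℝ] F') 0 := hA ▸ hdiff 0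
  let e := hΦ.contDiffAt.toOpenPartialHomeomorph Φ hA' hne
  have he : ∀ x, e x = Φ x := fun x => rfl
  have h0s : (0:E') ∈ e.source := hΦ.contDiffAt.mem_toOpenPartialHomeomorph_source hA' hne
  have h0t : (0:F') ∈ e.target := by
    have := e.map_source h0s
    rwa [he, h0] at this
  have hs0 : e.symm 0 = 0 := by
    have := e.left_inv h0s
    rwa [he, h0] at this
  have hcs : ContinuousAt e.symm 0 := e.continuousAt_symm h0t
  have hinv : ∀ᶠ x in nhds (0:E'), fderiv ℝ Φ x ∈ range ((↑) : (E' ≃L[ℝ] F') → (E' →L[ℝ] F')) := by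
    have hc : ContinuousAt (fderiv ℝ Φ) 0 := (hΦ.continuous_fderiv hne).continuousAt
    have := ContinuousLinearEquiv.nhds A
    rw [← hA] at this
    exact hc.eventually this
  have hsm : ∀ᶠ u in nhds (0:F'), u ∈ e.target ∧ ContDiffAt ℝ (⊤ : ℕ∞) e.symm u := by
    have h1 : ∀ᶠ u in nhds (0:F'), fderiv ℝ Φ (e.symm u) ∈ range ((↑) : (E' ≃L[ℝ] F') → (E' →L[ℝ] F')) := by
      have : Filter.Tendsto e.symm (nhds 0) (nhds 0) := by
        have := hcs.tendsto
        rwa [hs0] at this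
      exact this.eventually hinv
    filter_upwards [h1, e.open_target.mem_nhds h0t] with u ⟨B, hB⟩ hu
    refine ⟨hu, e.contDiffAt_symm (f₀' := B) hu ?_ ?_⟩
    · rw [hB]; exact hdiff _
    · exact hΦ.contDiffAt
  obtain ⟨r, hr, hball⟩ := Metric.mem_nhds_iff.1 hsm
  let χ : ContDiffBump (0:F') := ⟨r/4, r/2, by linarith, by linarith⟩
  have hχ1 : ∀ᶠ u in nhds (0:F'), χ u = 1 := χ.eventuallyEq_one
  refine ⟨fun u => χ u • e.symm u, ?_, ?_, ?_, ?_⟩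
  · rw [contDiff_iff_contDiffAt]
    intro u
    by_cases hu : u ∈ ball (0:F') r
    · exact χ.contDiff.contDiffAt.smul (hball hu).2
    · have : (fun u => χ u • e.symm u) =ᶠ[nhds u] fun _ => 0 := by
        have hopen : IsOpen (closedBall (0:F') (r/2))ᶜ := isClosed_closedBall.isOpen_compl
        have hmem : u ∈ (closedBall (0:F') (r/2))ᶜ := by
          intro h
          apply hu
          rw [mem_closedBall] at h
          rw [mem_ball]; linarith
        filter_upwards [hopen.mem_nhds hmem] with w hw
        have : χ w = 0 := χ.zero_of_le_dist (by
          simp only [mem_compl_iff, mem_closedBall, not_le] at hw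
          exact hw.le)
        rw [this, zero_smul]
      exact contDiffAt_const.congr_of_eventuallyEq this
  · simp [hs0]
  · have h1 : ∀ᶠ x in nhds (0:E'), χ (Φ x) = 1 := by
      have : Filter.Tendsto Φ (nhds 0) (nhds 0) := by
        have := hΦ.continuous.tendsto 0
        rwa [h0] at this
      exact this.eventually hχ1
    filter_upwards [h1, e.open_source.mem_nhds h0s] with x hx hxs
    rw [hx, one_smul]
    exact e.left_inv hxs
  · filter_upwards [hχ1, e.open_target.mem_nhds h0t] with u hu hut
    rw [hu, one_smul]
    exact e.right_inv hut

/-- Lipschitz maps between spaces of equal dimension increase measure by at most a constant. -/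
lemma lip_meas {E' F' : Type*} [NormedAddCommGroup E'] [NormedSpace ℝ E'] [FiniteDimensional ℝ E']
    [MeasurableSpace E'] [BorelSpace E']
    [NormedAddCommGroup F'] [NormedSpace ℝ F'] [FiniteDimensional ℝ F'] [MeasurableSpace F'] [BorelSpace F']
    (μ : Measure E') [μ.IsAddHaarMeasure] (ν : Measure F') [ν.IsAddHaarMeasure]
    (hd : Module.finrank ℝ E' = Module.finrank ℝ F') (f : E' → F') (hf : ContDiff ℝ (⊤ : ℕ∞) f) (x : E') :
    ∃ U ∈ nhds x, ∃ C : ℝ≥0, 0 < C ∧ ∀ A ⊆ U, ν (f '' A) ≤ C * μ A := by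
  obtain ⟨K, t, ht, hK⟩ := ((hf.of_le (by exact_mod_cast le_top)).contDiffAt (x := x)).exists_lipschitzOnWith
  have hμ := Measure.isAddLeftInvariant_eq_smul (Measure.hausdorffMeasure (Module.finrank ℝ E') : Measure E') μ
  have hν := Measure.isAddLeftInvariant_eq_smul ν (Measure.hausdorffMeasure (Module.finrank ℝ F') : Measure F')
  obtain ⟨a, hat, ha⟩ : ∃ a : ℝ≥0∞, a ≠ ⊤ ∧ (Measure.hausdorffMeasure (Module.finrank ℝ E') : Measure E') = a • μ := ⟨_, ENNReal.coe_ne_top, hμ⟩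
  obtain ⟨b, hbt, hb⟩ : ∃ b : ℝ≥0∞, b ≠ ⊤ ∧ ν = b • (Measure.hausdorffMeasure (Module.finrank ℝ F') : Measure F') := ⟨_, ENNReal.coe_ne_top, hν⟩
  have hKt : (K : ℝ≥0∞) ^ (Module.finrank ℝ E' : ℝ) ≠ ⊤ :=
    ENNReal.rpow_ne_top_of_nonneg (by positivity) ENNReal.coe_ne_top
  set C : ℝ≥0∞ := b * (K : ℝ≥0∞) ^ (Module.finrank ℝ E' : ℝ) * a with hC
  have hCt : C ≠ ⊤ := ENNReal.mul_ne_top (ENNReal.mul_ne_top hbt hKt) hat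
  refine ⟨t, ht, C.toNNReal + 1, by positivity, fun A hA => ?_⟩
  rw [ENNReal.coe_add, ENNReal.coe_toNNReal hCt]
  have h1 := (hK.mono hA).hausdorffMeasure_image_le (d := Module.finrank ℝ E') (by positivity)
  have h2 : ν (f '' A) = b * Measure.hausdorffMeasure (Module.finrank ℝ E' : ℝ) (f '' A) := by
    rw [hb, hd]; rfl
  have h3 : (Measure.hausdorffMeasure (Module.finrank ℝ E' : ℝ) : Measure E') A = a * μ A := by
    rw [ha]; rfl
  rw [h2]
  calc b * Measure.hausdorffMeasure (Module.finrank ℝ E' : ℝ) (f '' A) ≤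
      b * ((K : ℝ≥0∞) ^ (Module.finrank ℝ E' : ℝ) * (a * μ A)) := by rw [← h3]; gcongr
    _ = C * μ A := by rw [hC]; ring
    _ ≤ _ := by gcongr; exact le_self_add

def PhiM {n : ℕ} (π : E n → E (n-1)) (c : Fin n) (x : E n) : E (n-1) × ℝ := (π x, x c)

lemma PhiM_contDiff {n : ℕ} (π : E n → E (n-1)) (hπ : ContDiff ℝ (⊤ : ℕ∞) π) (c : Fin n) :
    ContDiff ℝ (⊤ : ℕ∞) (PhiM π c) :=
  hπ.prodMk (EuclideanSpace.proj (𝕜 := ℝ) c).contDiff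

lemma PhiM_fderiv {n : ℕ} (π : E n → E (n-1)) (hπ : ContDiff ℝ (⊤ : ℕ∞) π) (c : Fin n) (x : E n) :
    fderiv ℝ (PhiM π c) x = (fderiv ℝ π x).prod (EuclideanSpace.proj (𝕜 := ℝ) c) := by
  have h1 : HasFDerivAt π (fderiv ℝ π x) x := (hπ.differentiable (by simp) x).hasFDerivAt
  exact (h1.prodMk (EuclideanSpace.proj (𝕜 := ℝ) c).hasFDerivAt).fderiv

lemma exists_straight {n : ℕ} (hn : 2 ≤ n) (π : E n → E (n-1)) (hπ : ContDiff ℝ (⊤ : ℕ∞) π)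
    (hsub : Function.Surjective (fderiv ℝ π 0)) (h0 : π 0 = 0) (X : E n → E n) (hX0 : X 0 ≠ 0)
    (htan : ∀ x, fderiv ℝ π x (X x) = 0) :
    ∃ c : Fin n, X 0 c ≠ 0 ∧ ∃ Ψ : E (n-1) × ℝ → E n, ContDiff ℝ (⊤ : ℕ∞) Ψ ∧ Ψ 0 = 0 ∧
      (∀ᶠ x in nhds (0 : E n), Ψ (PhiM π c x) = x) ∧ (∀ᶠ u in nhds (0 : E (n-1) × ℝ), PhiM π c (Ψ u) = u) := by
  obtain ⟨c, hc⟩ : ∃ c, X 0 c ≠ 0 := by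
    by_contra h
    push Not at h
    exact hX0 (by ext i; simpa using h i)
  refine ⟨c, hc, ?_⟩
  have hfd := PhiM_fderiv π hπ c 0
  have hker : ∀ v, fderiv ℝ π 0 v = 0 → ∃ a : ℝ, a • X 0 = v := by
    have h1 : Module.finrank ℝ (LinearMap.ker (fderiv ℝ π 0 : E n →ₗ[ℝ] E (n-1))) = 1 := by
      have h2 := LinearMap.finrank_range_add_finrank_ker (fderiv ℝ π 0 : E n →ₗ[ℝ] E (n-1))
      have h3 : LinearMap.range (fderiv ℝ π 0 : E n →ₗ[ℝ] E (n-1)) = ⊤ := LinearMap.range_eq_top.2 hsub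
      rw [h3, finrank_top] at h2
      simp at h2
      omega
    intro v hv
    have hne : (⟨X 0, htan 0⟩ : LinearMap.ker (fderiv ℝ π 0 : E n →ₗ[ℝ] E (n-1))) ≠ 0 := by
      intro h
      exact hX0 (congrArg Subtype.val h)
    obtain ⟨a, ha⟩ := (finrank_eq_one_iff_of_nonzero' _ hne).1 h1 ⟨v, hv⟩
    exact ⟨a, congrArg Subtype.val ha⟩
  have hinj : Function.Injective (fderiv ℝ (PhiM π c) 0) := by
    rw [injective_iff_map_eq_zero]
    intro v hv
    rw [hfd] at hv
    have h1 : fderiv ℝ π 0 v = 0 := congrArg Prod.fst hv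
    have h2 : v c = 0 := congrArg Prod.snd hv
    obtain ⟨a, rfl⟩ := hker v h1
    have : a * X 0 c = 0 := h2
    rcases mul_eq_zero.1 this with h | h
    · rw [h, zero_smul]
    · exact absurd h hc
  have hdim : Module.finrank ℝ (E n) = Module.finrank ℝ (E (n-1) × ℝ) := by
    simp; omega
  let A0 : E n ≃ₗ[ℝ] E (n-1) × ℝ := LinearEquiv.ofInjectiveOfFinrankEq (fderiv ℝ (PhiM π c) 0 : E n →ₗ[ℝ] E (n-1) × ℝ) hinj hdim
  let A : E n ≃L[ℝ] E (n-1) × ℝ := A0.toContinuousLinearEquiv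
  refine inv_straight (PhiM π c) (PhiM_contDiff π hπ c) ?_ A ?_
  · simp [PhiM, h0]
  · ext v <;> rfl

end

set_option linter.unusedVariables false
open MeasureTheory Set Metric
open scoped ENNReal NNReal
noncomputable section

lemma XW_cons {n k : ℕ} (X : Fin k → E n → E n) (j : Fin k) (w : List (Fin k)) (hw : w ≠ []) :
    XW X (j :: w) = lieB (XW X w) (X j) := by
  cases w with
  | nil => exact absurd rfl hw
  | cons a l => rfl

lemma lieB_contDiff {n : ℕ} {X Y : E n → E n} (hX : ContDiff ℝ (⊤ : ℕ∞) X) (hY : ContDiff ℝ (⊤ : ℕ∞) Y) :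
    ContDiff ℝ (⊤ : ℕ∞) (lieB X Y) := by
  unfold lieB
  have h1 : ContDiff ℝ (⊤ : ℕ∞) (fderiv ℝ Y) := hY.fderiv_right (by simp)
  have h2 : ContDiff ℝ (⊤ : ℕ∞) (fderiv ℝ X) := hX.fderiv_right (by simp)
  exact (h1.clm_apply hX).sub (h2.clm_apply hY)

lemma XW_contDiff {n k : ℕ} (X : Fin k → E n → E n) (hX : ∀ j, ContDiff ℝ (⊤ : ℕ∞) (X j)) (w : List (Fin k)) :
    ContDiff ℝ (⊤ : ℕ∞) (XW X w) := by
  induction w with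
  | nil => exact contDiff_const
  | cons j w ih =>
    by_cases hw : w = []
    · subst hw; exact hX j
    · rw [XW_cons X j w hw]; exact lieB_contDiff ih (hX j)

lemma lieB_congr {n : ℕ} {X Y X' Y' : E n → E n} {x : E n} (h1 : X =ᶠ[nhds x] X') (h2 : Y =ᶠ[nhds x] Y') :
    lieB X Y =ᶠ[nhds x] lieB X' Y' := by
  have h3 := h1.fderiv (𝕜 := ℝ)
  have h4 := h2.fderiv (𝕜 := ℝ)
  filter_upwards [h1, h2, h3, h4] with y a b c d
  simp [lieB, a, b, c, d]

inductive Comb {n k : ℕ} (X : Fin k → E n → E n) (d : Fin k → ℕ) : (E n → E n) → Prop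
  | base (w : List (Fin k)) (hw : w ≠ []) (hd : ∀ j, w.count j ≤ d j) : Comb X d (XW X w)
  | smul (g : E n → ℝ) (hg : ContDiff ℝ (⊤ : ℕ∞) g) (Y : E n → E n) (hY : Comb X d Y) : Comb X d (fun x => g x • Y x)
  | add (Y Z : E n → E n) (hY : Comb X d Y) (hZ : Comb X d Z) : Comb X d (fun x => Y x + Z x)

lemma Comb.contDiff {n k : ℕ} {X : Fin k → E n → E n} (hX : ∀ j, ContDiff ℝ (⊤ : ℕ∞) (X j)) {d : Fin k → ℕ} {Y : E n → E n}
    (h : Comb X d Y) : ContDiff ℝ (⊤ : ℕ∞) Y := by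
  induction h with
  | base w hw hd => exact XW_contDiff X hX w
  | smul g hg Y hY ih => exact hg.smul ih
  | add Y Z hY hZ ih1 ih2 => exact ih1.add ih2

lemma Comb.mono {n k : ℕ} {X : Fin k → E n → E n} {d d' : Fin k → ℕ} (hdd : ∀ j, d j ≤ d' j) {Y : E n → E n}
    (h : Comb X d Y) : Comb X d' Y := by
  induction h with
  | base w hw hd => exact .base w hw fun j => (hd j).trans (hdd j)
  | smul g hg Y hY ih => exact .smul g hg Y ih
  | add Y Z hY hZ ih1 ih2 => exact .add Y Z ih1 ih2

lemma Comb.bracket {n k : ℕ} {X : Fin k → E n → E n} (hX : ∀ j, ContDiff ℝ (⊤ : ℕ∞) (X j)) {d d' : Fin k → ℕ}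
    (j : Fin k) (hdd : ∀ i, d i + (if i = j then 1 else 0) ≤ d' i) {Y : E n → E n}
    (g : E n → ℝ) (hg : ContDiff ℝ (⊤ : ℕ∞) g)
    (h : Comb X d Y) : Comb X d' (lieB Y (fun x => g x • X j x)) := by
  have hd1 : ∀ i, d i ≤ d' i := fun i => by have := hdd i; omega
  have hXj : Comb X d' (X j) := by
    have := Comb.base (X := X) (d := d') [j] (by simp) (fun i => by
      have := hdd i
      by_cases h : i = j
      · subst h; simp at this ⊢; omega
      · rw [List.count_eq_zero_of_not_mem (by simpa using h)]; omega)
    exact this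
  have hgd : ∀ x, HasFDerivAt g (fderiv ℝ g x) x := fun x => (hg.differentiable (by simp) x).hasFDerivAt
  have hXd : ∀ x, HasFDerivAt (X j) (fderiv ℝ (X j) x) x := fun x => ((hX j).differentiable (by simp) x).hasFDerivAt
  have hgX : ContDiff ℝ (⊤ : ℕ∞) (fun x => g x • X j x) := hg.smul (hX j)
  induction h with
  | base w hw hd =>
    have h1 : Comb X d' (XW X (j :: w)) := .base _ (by simp) (fun i => by
      have := hdd i
      have := hd i
      rw [List.count_cons]
      by_cases h : i = j
      · subst h; simp at *; omega
      · rw [if_neg h] at *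
        rw [if_neg (by simpa using fun h' => h h'.symm)]; omega)
    rw [XW_cons X j w hw] at h1
    have hXw := XW_contDiff X hX w
    have hc : ContDiff ℝ (⊤ : ℕ∞) (fun x => fderiv ℝ g x (XW X w x)) :=
      (hg.fderiv_right (m := (⊤ : ℕ∞)) (by simp)).clm_apply hXw
    convert Comb.add _ _ (Comb.smul g hg _ h1) (Comb.smul _ hc _ hXj) using 1
    funext x
    have := ((hgd x).smul (hXd x)).fderiv
    simp only [lieB]
    erw [this]
    simp [smul_sub]
    abel
  | smul a ha Y hY ih =>
    have hYd : ∀ x, HasFDerivAt Y (fderiv ℝ Y x) x := fun x => (((hY.contDiff hX).differentiable (by simp)) x).hasFDerivAt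
    have had : ∀ x, HasFDerivAt a (fderiv ℝ a x) x := fun x => (ha.differentiable (by simp) x).hasFDerivAt
    have hc : ContDiff ℝ (⊤ : ℕ∞) (fun x => - fderiv ℝ a x (g x • X j x)) :=
      ((ha.fderiv_right (m := (⊤ : ℕ∞)) (by simp)).clm_apply hgX).neg
    convert Comb.add _ _ (Comb.smul a ha _ ih) (Comb.smul _ hc _ (hY.mono hd1)) using 1
    funext x
    have := ((had x).smul (hYd x)).fderiv
    simp only [lieB]
    erw [this]
    simp [smul_sub]
    module
  | add Y Z hY hZ ih1 ih2 =>
    convert Comb.add _ _ ih1 ih2 using 1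
    funext x
    have h1 : fderiv ℝ (fun x => Y x + Z x) x = fderiv ℝ Y x + fderiv ℝ Z x :=
      fderiv_fun_add ((hY.contDiff hX).differentiable (by simp) x) ((hZ.contDiff hX).differentiable (by simp) x)
    simp only [lieB, h1]
    simp
    abel

lemma XW_comb {n k : ℕ} {X Xt : Fin k → E n → E n} (hX : ∀ j, ContDiff ℝ (⊤ : ℕ∞) (Xt j)) (g : Fin k → E n → ℝ)
    (hg : ∀ j, ContDiff ℝ (⊤ : ℕ∞) (g j)) (hXX : ∀ j, ∀ᶠ x in nhds 0, X j x = g j x • Xt j x)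
    (w : List (Fin k)) (hw : w ≠ []) :
    ∃ Y, Comb Xt (fun j => w.count j) Y ∧ XW X w =ᶠ[nhds 0] Y := by
  induction w with
  | nil => exact absurd rfl hw
  | cons j w ih =>
    by_cases hw' : w = []
    · subst hw'
      exact ⟨_, Comb.smul (g j) (hg j) _ (Comb.base [j] (by simp) (fun _ => le_rfl)), hXX j⟩
    · obtain ⟨Y, hY, hYe⟩ := ih hw'
      refine ⟨_, hY.bracket hX j (fun i => ?_) (g j) (hg j), ?_⟩
      · rw [List.count_cons]
        by_cases h : i = j
        · subst h; simp
        · rw [if_neg h, if_neg (by simpa using fun h' => h h'.symm)]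
      · rw [XW_cons X j w hw']
        exact lieB_congr hYe (hXX j)

lemma Comb.span {n k : ℕ} {X : Fin k → E n → E n} {d : Fin k → ℕ} {Y : E n → E n} (h : Comb X d Y) (x : E n) :
    Y x ∈ Submodule.span ℝ {v | ∃ w : List (Fin k), w ≠ [] ∧ (∀ j, w.count j ≤ d j) ∧ v = XW X w x} := by
  induction h with
  | base w hw hd => exact Submodule.subset_span ⟨w, hw, hd, rfl⟩
  | smul g hg Y hY ih => exact Submodule.smul_mem _ _ ih
  | add Y Z hY hZ ih1 ih2 => exact Submodule.add_mem _ ih1 ih2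

lemma multi_span {n : ℕ} {M : Type*} [AddCommGroup M] [Module ℝ M] (f : MultilinearMap ℝ (fun _ : Fin n => M) ℝ)
    (S : Fin n → Set M) (hS : ∀ v, (∀ i, v i ∈ S i) → f v = 0) (v : Fin n → M)
    (hv : ∀ i, v i ∈ Submodule.span ℝ (S i)) : f v = 0 := by
  have key : ∀ T : Finset (Fin n), ∀ v : Fin n → M, (∀ i ∈ T, v i ∈ Submodule.span ℝ (S i)) → (∀ i ∉ T, v i ∈ S i) → f v = 0 := by
    intro T
    induction T using Finset.induction_on with
    | empty => intro v _ h; exact hS v fun i => h i (by simp)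
    | insert a T ha ih =>
      intro v h1 h2
      have h3 : ∀ u ∈ Submodule.span ℝ (S a), f (Function.update v a u) = 0 := by
        intro u hu
        induction hu using Submodule.span_induction with
        | mem u hu =>
          apply ih
          · intro i hi
            have : i ≠ a := fun h => ha (h ▸ hi)
            rw [Function.update_of_ne this]
            exact h1 i (by simp [hi])
          · intro i hi
            by_cases h : i = a
            · subst h; simpa using hu
            · rw [Function.update_of_ne h]; exact h2 i (by simp [h, hi])
        | zero => exact f.map_update_zero v a
        | add x y _ _ hx hy => rw [f.map_update_add, hx, hy, add_zero]
        | smul c x _ hx => rw [f.map_update_smul, hx, smul_zero]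
      have := h3 (v a) (h1 a (by simp))
      simpa using this
  exact key Finset.univ v (fun i _ => hv i) (fun i h => absurd (Finset.mem_univ i) h)

/-- determinant of a family of vectors in `E n` as a multilinear map -/
def detE (n : ℕ) : MultilinearMap ℝ (fun _ : Fin n => E n) ℝ :=
  (Matrix.detRowAlternating (n := Fin n) (R := ℝ)).toMultilinearMap.compLinearMap
    (fun _ => (WithLp.linearEquiv 2 ℝ (Fin n → ℝ)).toLinearMap)

lemma detE_apply {n : ℕ} (v : Fin n → E n) : detE n v = Matrix.det (Matrix.of fun i i' => v i i') := rfl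

lemma lam_transfer {n k : ℕ} {X Xt : Fin k → E n → E n} (hX : ∀ j, ContDiff ℝ (⊤ : ℕ∞) (Xt j)) (g : Fin k → E n → ℝ)
    (hg : ∀ j, ContDiff ℝ (⊤ : ℕ∞) (g j)) (hXX : ∀ j, ∀ᶠ x in nhds 0, X j x = g j x • Xt j x)
    (I : Fin n → List (Fin k)) (hI : ∀ i, I i ≠ []) (hl : lam X I 0 ≠ 0) :
    ∃ I' : Fin n → List (Fin k), (∀ i, I' i ≠ []) ∧ (∀ j, degI I' j ≤ degI I j) ∧ lam Xt I' 0 ≠ 0 := by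
  by_contra hcon
  push Not at hcon
  apply hl
  have := multi_span (detE n) (fun i => {v | ∃ w : List (Fin k), w ≠ [] ∧ (∀ j, w.count j ≤ (I i).count j) ∧ v = XW Xt w 0})
    (fun v hv => by
      choose I' h1 h2 h3 using hv
      have := hcon I' h1 (fun j => Finset.sum_le_sum fun i _ => h2 i j)
      rw [detE_apply]
      rw [lam] at this
      convert this using 5
      rw [h3]) (fun i => XW X (I i) 0) (fun i => by
      obtain ⟨Y, hY, hYe⟩ := XW_comb hX g hg hXX (I i) (hI i)
      rw [show XW X (I i) 0 = Y 0 from hYe.self_of_nhds]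
      exact hY.span 0)
  exact this

/-- potential -/
def Pot {n k : ℕ} (I : Fin n → List (Fin k)) : ℕ := ∑ i : Fin n, (i : ℕ) * (I i).length

lemma length_eq_count {k : ℕ} (w : List (Fin k)) : w.length = ∑ j, w.count j := by
  induction w with
  | nil => simp
  | cons a w ih => simp [List.count_cons, Finset.sum_add_distrib, ih]

lemma pot_max {n k : ℕ} {X : Fin k → E n → E n} 
    (I : Fin n → List (Fin k)) (hI : ∀ i, I i ≠ []) (hl : lam X I 0 ≠ 0) :
    ∃ I' : Fin n → List (Fin k), (∀ i, I' i ≠ []) ∧ (degI I' = degI I) ∧ lam X I' 0 ≠ 0 ∧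
      ∀ I'' : Fin n → List (Fin k), (∀ i, I'' i ≠ []) → degI I'' = degI I → Pot I' < Pot I'' → lam X I'' 0 = 0 := by
  classical
  set Bd := n * ∑ j, degI I j
  have hbd : ∀ I'' : Fin n → List (Fin k), degI I'' = degI I → Pot I'' ≤ Bd := by
    intro I'' h
    have : ∑ j, degI I j = ∑ i, (I'' i).length := by
      rw [← h]; simp only [degI, length_eq_count]; exact Finset.sum_comm
    simp only [Bd]
    rw [this, Pot, Finset.mul_sum]
    exact Finset.sum_le_sum fun i _ => Nat.mul_le_mul_right _ i.2.le
  let Pr : ℕ → Prop := fun q => ∃ I' : Fin n → List (Fin k), (∀ i, I' i ≠ []) ∧ (degI I' = degI I) ∧ lam X I' 0 ≠ 0 ∧ Pot I' = q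
  have hP : Pr (Pot I) := ⟨I, hI, rfl, hl, rfl⟩
  obtain ⟨I', h1, h2, h3, h4⟩ := Nat.findGreatest_spec (hbd I rfl) hP
  refine ⟨I', h1, h2, h3, fun I'' a b c => ?_⟩
  by_contra hne
  have := Nat.findGreatest_is_greatest (P := Pr) (n := Bd) (k := Pot I'') (by rw [← h4]; exact c) (hbd I'' b)
  exact this ⟨I'', a, b, hne, rfl⟩

end

set_option linter.unusedVariables false
open MeasureTheory Set Metric
open scoped ENNReal NNReal
noncomputable section

abbrev HS (n : ℕ) : Type := E (n-1) × ℝ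

/-- straightening data -/
structure SD (n k : ℕ) (π : Fin k → E n → E (n-1)) where
  hπ : ∀ j, ContDiff ℝ (⊤ : ℕ∞) (π j)
  hπ0 : ∀ j, π j 0 = 0
  c : Fin k → Fin n
  Ψ : Fin k → HS n → E n
  hΨ : ∀ j, ContDiff ℝ (⊤ : ℕ∞) (Ψ j)
  hΨ0 : ∀ j, Ψ j 0 = 0
  left : ∀ j, ∀ᶠ x in nhds (0 : E n), Ψ j (PhiM (π j) (c j) x) = x
  right : ∀ j, ∀ᶠ u in nhds (0 : HS n), PhiM (π j) (c j) (Ψ j u) = u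

namespace SD
variable {n k : ℕ} {π : Fin k → E n → E (n-1)} (S : SD n k π)

def Φ (j : Fin k) : E n → HS n := PhiM (π j) (S.c j)

lemma hΦ (j : Fin k) : ContDiff ℝ (⊤ : ℕ∞) (S.Φ j) := PhiM_contDiff _ (S.hπ j) _

lemma hΦ0 (j : Fin k) : S.Φ j 0 = 0 := by
  unfold Φ PhiM
  rw [S.hπ0 j]; rfl

/-- the straightened flow -/
def phi (j : Fin k) (t : ℝ) (x : E n) : E n := S.Ψ j (S.Φ j x + t • ((0 : E (n-1)), (1:ℝ)))

def Xt (j : Fin k) (x : E n) : E n := fderiv ℝ (S.Ψ j) (S.Φ j x) (0, 1)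

lemma Xt_contDiff (j : Fin k) : ContDiff ℝ (⊤ : ℕ∞) (S.Xt j) :=
  (((S.hΨ j).fderiv_right (m := (⊤ : ℕ∞)) (by simp)).comp (S.hΦ j)).clm_apply contDiff_const

lemma phi_contDiff (j : Fin k) : ContDiff ℝ (⊤ : ℕ∞) (fun z : E n × ℝ => S.phi j z.2 z.1) := by
  have h1 : ContDiff ℝ (⊤ : ℕ∞) (fun z : E n × ℝ => S.Φ j z.1 + z.2 • ((0 : E (n-1)), (1:ℝ))) :=
    ((S.hΦ j).comp contDiff_fst).add (contDiff_snd.smul contDiff_const)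
  exact (S.hΨ j).comp h1

lemma phi_zero (j : Fin k) : S.phi j 0 0 = 0 := by
  simp [phi, S.hΦ0 j, S.hΨ0 j]

lemma DD_left (j : Fin k) : ∀ᶠ x in nhds (0 : E n), ∀ v, fderiv ℝ (S.Ψ j) (S.Φ j x) (fderiv ℝ (S.Φ j) x v) = v := by
  have h1 : (fun x => S.Ψ j (S.Φ j x)) =ᶠ[nhds 0] id := S.left j
  filter_upwards [h1.fderiv (𝕜 := ℝ)] with x hx v
  have h2 : HasFDerivAt (fun x => S.Ψ j (S.Φ j x)) _ x :=
    (((S.hΨ j).differentiable (by simp) (S.Φ j x)).hasFDerivAt).comp x ((S.hΦ j).differentiable (by simp) x).hasFDerivAt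
  rw [h2.fderiv] at hx
  have := congrArg (fun T => T v) hx
  simpa using this

lemma DD_right (j : Fin k) : ∀ᶠ u in nhds (0 : HS n), ∀ v, fderiv ℝ (S.Φ j) (S.Ψ j u) (fderiv ℝ (S.Ψ j) u v) = v := by
  have h1 : (fun x => S.Φ j (S.Ψ j x)) =ᶠ[nhds 0] id := S.right j
  filter_upwards [h1.fderiv (𝕜 := ℝ)] with x hx v
  have h2 : HasFDerivAt (fun x => S.Φ j (S.Ψ j x)) _ x :=
    (((S.hΦ j).differentiable (by simp) (S.Ψ j x)).hasFDerivAt).comp x ((S.hΨ j).differentiable (by simp) x).hasFDerivAt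
  rw [h2.fderiv] at hx
  have := congrArg (fun T => T v) hx
  simpa using this

lemma tendΦ (j : Fin k) : Filter.Tendsto (S.Φ j) (nhds 0) (nhds 0) := by
  have := (S.hΦ j).continuous.tendsto 0
  rwa [S.hΦ0 j] at this

lemma tendΨ (j : Fin k) : Filter.Tendsto (S.Ψ j) (nhds 0) (nhds 0) := by
  have := (S.hΨ j).continuous.tendsto 0
  rwa [S.hΨ0 j] at this

/-- `DΨ(u) DΦ(Ψ u) = 1` and so on -/
lemma DD_left' (j : Fin k) : ∀ᶠ u in nhds (0 : HS n), ∀ v, fderiv ℝ (S.Ψ j) u (fderiv ℝ (S.Φ j) (S.Ψ j u) v) = v := by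
  filter_upwards [(S.tendΨ j).eventually (S.DD_left j), S.right j] with u h1 h2 v
  have := h1 v
  rwa [show S.Φ j (S.Ψ j u) = u from h2] at this

lemma DD_right' (j : Fin k) : ∀ᶠ x in nhds (0 : E n), ∀ v, fderiv ℝ (S.Φ j) x (fderiv ℝ (S.Ψ j) (S.Φ j x) v) = v := by
  filter_upwards [(S.tendΦ j).eventually (S.DD_right j), S.left j] with x h1 h2 v
  have := h1 v
  rwa [show S.Ψ j (S.Φ j x) = x from h2] at this

end SD

lemma exists_SD {n k : ℕ} (hn : 2 ≤ n)
    (π : Fin k → E n → E (n - 1))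
    (hπs : ∀ j, ContDiff ℝ (⊤ : ℕ∞) (π j))
    (hπsub : ∀ j x, Function.Surjective (fderiv ℝ (π j) x))
    (hπ0 : ∀ j, π j 0 = 0)
    (X : Fin k → E n → E n)
    (hXs : ∀ j, ContDiff ℝ (⊤ : ℕ∞) (X j))
    (hXne : ∀ j x, X j x ≠ 0)
    (htan : ∀ j x, fderiv ℝ (π j) x (X j x) = 0) :
    ∃ S : SD n k π, ∀ j, ∀ᶠ x in nhds 0, X j x = X j x (S.c j) • S.Xt j x := by
  choose c hc Ψ h1 h2 h3 h4 using fun j => exists_straight hn (π j) (hπs j) (hπsub j 0) (hπ0 j) (X j) (hXne j 0) (htan j)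
  let S : SD n k π := ⟨hπs, hπ0, c, Ψ, h1, h2, h3, h4⟩
  refine ⟨S, fun j => ?_⟩
  filter_upwards [S.DD_left j] with x hx
  have := hx (X j x)
  rw [show S.Φ j = PhiM (π j) (S.c j) from rfl, PhiM_fderiv _ (hπs j)] at this
  rw [ContinuousLinearMap.prod_apply, htan j x] at this
  rw [SD.Xt, ← map_smul]
  rw [show S.Φ j = PhiM (π j) (S.c j) from rfl]
  conv_lhs => rw [← this]
  congr 1
  simp

lemma finrank_HS {n : ℕ} (hn : 2 ≤ n) : Module.finrank ℝ (E n) = Module.finrank ℝ (HS n) := by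
  simp [HS]; omega

instance volHS (n : ℕ) : (volume : Measure (HS n)).IsAddHaarMeasure := by
  have : (volume : Measure (HS n)) = (volume : Measure (E (n-1))).prod (volume : Measure ℝ) := rfl
  rw [this]; infer_instance

lemma base_bound {n k : ℕ} (hn : 2 ≤ n) {π : Fin k → E n → E (n-1)} (S : SD n k π) :
    ∃ U ∈ nhds (0 : E n), ∃ C0 : ℝ, 1 ≤ C0 ∧ ∀ Ω ⊆ U, MeasurableSet Ω → ∀ j A, MeasurableSet A →
      MapsTo (π j) Ω A → volume Ω ≤ ENNReal.ofReal C0 * volume A := by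
  choose W hW C hC0 hC using fun j => lip_meas (volume : Measure (HS n)) (volume : Measure (E n)) (finrank_HS hn).symm (S.Ψ j) (S.hΨ j) 0
  refine ⟨⋂ j, {x | S.Φ j x ∈ W j ∧ S.Ψ j (S.Φ j x) = x ∧ |(S.Φ j x).2| ≤ 1}, ?_, 1 + ∑ j, (C j : ℝ) * 2, ?_, ?_⟩
  · rw [Filter.iInter_mem]
    intro j
    have h1 := (S.tendΦ j).eventually (hW j)
    have h2 : ∀ᶠ x in nhds (0 : E n), |(S.Φ j x).2| < 1 := by
      have : Continuous fun x => |(S.Φ j x).2| := ((S.hΦ j).continuous.snd).abs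
      exact this.continuousAt.eventually_lt (continuousAt_const (y := (1:ℝ))) (by simp [S.hΦ0 j])
    filter_upwards [h1, S.left j, h2] with x a b c
    exact ⟨a, b, c.le⟩
  · have : 0 ≤ ∑ j, (C j : ℝ) * 2 := by positivity
    linarith
  · intro Ω hΩ hm j A hA hmap
    have hU := fun x hx => mem_iInter.1 (hΩ (a := x) hx) j
    have h1 : Ω ⊆ S.Ψ j '' (S.Φ j '' Ω) := fun x hx => ⟨_, ⟨x, hx, rfl⟩, (hU x hx).2.1⟩
    have h2 : S.Φ j '' Ω ⊆ A ×ˢ Icc (-1) 1 := by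
      rintro _ ⟨x, hx, rfl⟩
      exact ⟨hmap hx, abs_le.1 (hU x hx).2.2⟩
    calc volume Ω ≤ volume (S.Ψ j '' (S.Φ j '' Ω)) := measure_mono h1
      _ ≤ C j * volume (S.Φ j '' Ω) := hC j _ (by rintro _ ⟨x, hx, rfl⟩; exact (hU x hx).1)
      _ ≤ C j * volume (A ×ˢ Icc (-1:ℝ) 1) := by gcongr
      _ = C j * (volume A * 2) := by
        rw [Measure.volume_eq_prod, Measure.prod_prod, Real.volume_Icc]; norm_num
      _ = ENNReal.ofReal ((C j : ℝ) * 2) * volume A := by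
        rw [ENNReal.ofReal_mul (by positivity), ENNReal.ofReal_coe_nnreal]
        norm_num; ring
      _ ≤ _ := by
        gcongr
        have := Finset.single_le_sum (f := fun j => (C j : ℝ) * 2) (fun i _ => by positivity) (Finset.mem_univ j)
        linarith

end

set_option linter.unusedVariables false
open MeasureTheory Set Metric
open scoped ENNReal NNReal
noncomputable section

namespace SD
variable {n k : ℕ} {π : Fin k → E n → E (n-1)} (S : SD n k π)

abbrev eH (n : ℕ) : HS n := ((0 : E (n-1)), (1:ℝ))

/-- pull-back operator -/
def pbo (j : Fin k) (t : ℝ) (x : E n) : E n →L[ℝ] E n :=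
  (fderiv ℝ (S.Ψ j) (S.Φ j x)).comp (fderiv ℝ (S.Φ j) (S.phi j t x))

/-- `(flow map)` -/
def flm : (m : ℕ) → (Fin m → Fin k) → E n × (Fin m → ℝ) → E n
  | 0, _, z => z.1
  | m+1, js, z => flm m (Fin.tail js) (S.phi (js 0) (z.2 0) z.1, Fin.tail z.2)

def pbv : (m : ℕ) → (Fin m → Fin k) → Fin m → E n × (Fin m → ℝ) → E n
  | 0, _, p, _ => p.elim0
  | m+1, js, p, z => Fin.cases (S.Xt (js 0) z.1)
      (fun q => S.pbo (js 0) (z.2 0) z.1 (pbv m (Fin.tail js) q (S.phi (js 0) (z.2 0) z.1, Fin.tail z.2))) p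

/-- step map -/
def stp (m : ℕ) (j : Fin k) (z : E n × (Fin (m+1) → ℝ)) : E n × (Fin m → ℝ) := (S.phi j (z.2 0) z.1, Fin.tail z.2)

lemma stp_contDiff (m : ℕ) (j : Fin k) : ContDiff ℝ (⊤ : ℕ∞) (S.stp m j) := by
  refine ContDiff.prodMk ?_ ?_
  · exact (S.phi_contDiff j).comp (contDiff_fst.prodMk ((contDiff_apply ℝ ℝ (0 : Fin (m+1))).comp contDiff_snd))
  · rw [contDiff_pi]
    intro i
    exact (contDiff_apply ℝ ℝ (i.succ)).comp contDiff_snd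

lemma stp_zero (m : ℕ) (j : Fin k) : S.stp m j 0 = 0 := by
  refine Prod.ext ?_ ?_
  · simp [stp, phi_zero]
  · funext i; simp [stp, Fin.tail]

lemma stp_tend (m : ℕ) (j : Fin k) : Filter.Tendsto (S.stp m j) (nhds 0) (nhds 0) := by
  have := (S.stp_contDiff m j).continuous.tendsto 0
  rwa [S.stp_zero m j] at this

lemma flm_contDiff (m : ℕ) (js : Fin m → Fin k) : ContDiff ℝ (⊤ : ℕ∞) (S.flm m js) := by
  induction m with
  | zero => exact contDiff_fst
  | succ m ih => exact (ih (Fin.tail js)).comp (S.stp_contDiff m (js 0))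

lemma pbo_contDiff (j : Fin k) : ContDiff ℝ (⊤ : ℕ∞) (fun z : E n × ℝ => S.pbo j z.2 z.1) := by
  unfold pbo
  have h1 : ContDiff ℝ (⊤ : ℕ∞) (fun z : E n × ℝ => fderiv ℝ (S.Ψ j) (S.Φ j z.1)) :=
    ((S.hΨ j).fderiv_right (m := (⊤ : ℕ∞)) (by simp)).comp ((S.hΦ j).comp contDiff_fst)
  have h2 : ContDiff ℝ (⊤ : ℕ∞) (fun z : E n × ℝ => fderiv ℝ (S.Φ j) (S.phi j z.2 z.1)) :=
    ((S.hΦ j).fderiv_right (m := (⊤ : ℕ∞)) (by simp)).comp (S.phi_contDiff j)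
  exact h1.clm_comp h2

/-- derivative of the step map in the `x` variable -/
lemma phi_fderiv_x (j : Fin k) (t : ℝ) (x : E n) : HasFDerivAt (fun x => S.phi j t x)
    ((fderiv ℝ (S.Ψ j) (S.Φ j x + t • eH n)).comp (fderiv ℝ (S.Φ j) x)) x := by
  have h1 : HasFDerivAt (fun x => S.Φ j x + t • eH n) (fderiv ℝ (S.Φ j) x) x :=
    ((S.hΦ j).differentiable (by simp) x).hasFDerivAt.add_const _
  exact (((S.hΨ j).differentiable (by simp) (S.Φ j x + t • eH n)).hasFDerivAt).comp x h1

lemma phi_deriv_t (j : Fin k) (t : ℝ) (x : E n) : HasDerivAt (fun t => S.phi j t x)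
    (fderiv ℝ (S.Ψ j) (S.Φ j x + t • eH n) (eH n)) t := by
  have h1 : HasDerivAt (fun t : ℝ => S.Φ j x + t • eH n) (eH n) t := by
    have := ((hasDerivAt_id t).smul_const (eH n)).const_add (S.Φ j x)
    simpa using this
  exact (((S.hΨ j).differentiable (by simp) (S.Φ j x + t • eH n)).hasFDerivAt).comp_hasDerivAt t h1

lemma stp_x (m : ℕ) (j : Fin k) (z : E n × (Fin (m+1) → ℝ)) (v : E n) :
    fderiv ℝ (S.stp m j) z (v, 0) = (fderiv ℝ (S.Ψ j) (S.Φ j z.1 + z.2 0 • eH n) (fderiv ℝ (S.Φ j) z.1 v), 0) := by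
  have h1 := ((S.stp_contDiff m j).differentiable (by simp) z).hasFDerivAt
  have h2 : HasFDerivAt (fun x : E n => (x, z.2)) (ContinuousLinearMap.inl ℝ (E n) (Fin (m+1) → ℝ)) z.1 := hasFDerivAt_prodMk_left _ _
  have h3 : HasFDerivAt (fun x => S.stp m j (x, z.2)) ((fderiv ℝ (S.stp m j) z).comp (ContinuousLinearMap.inl ℝ (E n) (Fin (m+1) → ℝ))) z.1 := HasFDerivAt.comp (g := S.stp m j) (g' := fderiv ℝ (S.stp m j) z) z.1 h1 h2
  have h4 : HasFDerivAt (fun x => S.stp m j (x, z.2)) (((fderiv ℝ (S.Ψ j) (S.Φ j z.1 + z.2 0 • eH n)).comp (fderiv ℝ (S.Φ j) z.1)).prod 0) z.1 :=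
    (S.phi_fderiv_x j (z.2 0) z.1).prodMk (hasFDerivAt_const (Fin.tail z.2) _)
  have := congrArg (fun T => T v) (h3.unique h4)
  simpa using this

lemma stp_t0 (m : ℕ) (j : Fin k) (z : E n × (Fin (m+1) → ℝ)) :
    fderiv ℝ (S.stp m j) z (0, Pi.single 0 1) = (fderiv ℝ (S.Ψ j) (S.Φ j z.1 + z.2 0 • eH n) (eH n), 0) := by
  have h1 := ((S.stp_contDiff m j).differentiable (by simp) z).hasFDerivAt
  have h2 : HasDerivAt (fun t : ℝ => (z.1, z.2 + t • Pi.single (0 : Fin (m+1)) (1:ℝ))) ((0 : E n), Pi.single (0 : Fin (m+1)) (1:ℝ)) 0 := by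
    refine (hasDerivAt_const _ _).prodMk ?_
    have := ((hasDerivAt_id (0:ℝ)).smul_const (Pi.single (0 : Fin (m+1)) (1:ℝ))).const_add (z.2)
    simpa using this
  have h3 : HasDerivAt (fun t : ℝ => S.stp m j (z.1, z.2 + t • Pi.single (0 : Fin (m+1)) (1:ℝ))) (fderiv ℝ (S.stp m j) z (0, Pi.single 0 1)) 0 :=
    HasFDerivAt.comp_hasDerivAt (l := S.stp m j) (l' := fderiv ℝ (S.stp m j) z) (0:ℝ) (by simpa using h1) h2
  have h4 : HasDerivAt (fun t : ℝ => S.stp m j (z.1, z.2 + t • Pi.single (0 : Fin (m+1)) (1:ℝ)))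
      (fderiv ℝ (S.Ψ j) (S.Φ j z.1 + z.2 0 • eH n) (eH n), 0) 0 := by
    have e : (fun t : ℝ => S.stp m j (z.1, z.2 + t • Pi.single (0 : Fin (m+1)) (1:ℝ))) =
      fun t : ℝ => (S.phi j (z.2 0 + t) z.1, Fin.tail z.2) := by
      funext t
      refine Prod.ext ?_ ?_
      · simp [stp]
      · funext i; simp [stp, Fin.tail]
    rw [e]
    refine HasDerivAt.prodMk ?_ (hasDerivAt_const _ _)
    have := (S.phi_deriv_t j (z.2 0 + 0) z.1).comp_const_add (z.2 0) 0
    simpa using this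
  exact h3.unique h4

lemma stp_ts (m : ℕ) (j : Fin k) (z : E n × (Fin (m+1) → ℝ)) (q : Fin m) :
    fderiv ℝ (S.stp m j) z (0, Pi.single q.succ 1) = (0, Pi.single q 1) := by
  have h1 := ((S.stp_contDiff m j).differentiable (by simp) z).hasFDerivAt
  have h2 : HasDerivAt (fun t : ℝ => (z.1, z.2 + t • Pi.single q.succ (1:ℝ))) ((0 : E n), Pi.single q.succ (1:ℝ)) 0 := by
    refine (hasDerivAt_const _ _).prodMk ?_
    have := ((hasDerivAt_id (0:ℝ)).smul_const (Pi.single q.succ (1:ℝ))).const_add (z.2)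
    simpa using this
  have h3 : HasDerivAt (fun t : ℝ => S.stp m j (z.1, z.2 + t • Pi.single q.succ (1:ℝ))) (fderiv ℝ (S.stp m j) z (0, Pi.single q.succ 1)) 0 :=
    HasFDerivAt.comp_hasDerivAt (l := S.stp m j) (l' := fderiv ℝ (S.stp m j) z) (0:ℝ) (by simpa using h1) h2
  have h4 : HasDerivAt (fun t : ℝ => S.stp m j (z.1, z.2 + t • Pi.single q.succ (1:ℝ)))
      (0, Pi.single q 1) 0 := by
    have e : (fun t : ℝ => S.stp m j (z.1, z.2 + t • Pi.single q.succ (1:ℝ))) =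
      fun t : ℝ => (S.phi j (z.2 0) z.1, Fin.tail z.2 + t • Pi.single q (1:ℝ)) := by
      funext t
      refine Prod.ext ?_ ?_
      · simp [stp]
      · funext i
        simp [stp, Fin.tail, Pi.single_apply]
    rw [e]
    refine HasDerivAt.prodMk (hasDerivAt_const _ _) ?_
    have := ((hasDerivAt_id (0:ℝ)).smul_const (Pi.single q (1:ℝ))).const_add (Fin.tail z.2)
    simpa using this
  exact h3.unique h4

/-- all needed identities hold for `(x,t)` near `0` -/
lemma near_id (j : Fin k) (m : ℕ) : ∀ᶠ z in nhds (0 : E n × (Fin (m+1) → ℝ)),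
    (∀ v, fderiv ℝ (S.Φ j) z.1 (fderiv ℝ (S.Ψ j) (S.Φ j z.1) v) = v) ∧
    (∀ v, fderiv ℝ (S.Ψ j) (S.Φ j z.1 + z.2 0 • eH n) (fderiv ℝ (S.Φ j) (S.phi j (z.2 0) z.1) v) = v) := by
  have h1 : Filter.Tendsto (fun z : E n × (Fin (m+1) → ℝ) => z.1) (nhds 0) (nhds 0) := continuous_fst.tendsto' _ _ rfl
  have h2 : Filter.Tendsto (fun z : E n × (Fin (m+1) → ℝ) => S.Φ j z.1 + z.2 0 • eH n) (nhds 0) (nhds 0) := by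
    refine Continuous.tendsto' ?_ _ _ ?_
    · have := (S.hΦ j).continuous
      fun_prop
    · simp [S.hΦ0 j]
  filter_upwards [h1.eventually (S.DD_right' j), h2.eventually (S.DD_left' j)] with z a b
  exact ⟨a, b⟩

lemma flm_pbv (m : ℕ) (js : Fin m → Fin k) : ∀ᶠ z in nhds (0 : E n × (Fin m → ℝ)), ∀ p,
    fderiv ℝ (S.flm m js) z (0, Pi.single p 1) = fderiv ℝ (S.flm m js) z (S.pbv m js p z, 0) := by
  induction m with
  | zero => exact Filter.Eventually.of_forall fun z p => p.elim0
  | succ m ih =>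
    filter_upwards [(S.stp_tend m (js 0)).eventually (ih (Fin.tail js)), S.near_id (js 0) m] with z h1 h2
    have hc : fderiv ℝ (S.flm (m+1) js) z = (fderiv ℝ (S.flm m (Fin.tail js)) (S.stp m (js 0) z)).comp (fderiv ℝ (S.stp m (js 0)) z) := by
      have : S.flm (m+1) js = (S.flm m (Fin.tail js)) ∘ (S.stp m (js 0)) := rfl
      rw [this]
      exact fderiv_comp z ((S.flm_contDiff m _).differentiable (by simp) _) ((S.stp_contDiff m _).differentiable (by simp) _)
    intro p
    rw [hc]
    simp only [ContinuousLinearMap.comp_apply]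
    refine Fin.cases ?_ (fun q => ?_) p
    · rw [S.stp_t0, S.stp_x]
      congr 3
      exact (h2.1 _).symm
    · rw [S.stp_ts, h1, S.stp_x]
      congr 2
      simp only [pbv, Fin.cases_succ, pbo, ContinuousLinearMap.comp_apply]
      rw [h2.1, h2.2]
      rfl

end SD
end

set_option linter.unusedVariables false
open MeasureTheory Set Metric
open scoped ENNReal NNReal
noncomputable section

namespace SD
variable {n k : ℕ} {π : Fin k → E n → E (n-1)} (S : SD n k π)

def hatW (j : Fin k) (W : E n → E n) (u : HS n) : HS n := fderiv ℝ (S.Φ j) (S.Ψ j u) (W (S.Ψ j u))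

def ad (j : Fin k) (W : E n → E n) : E n → E n := lieB (S.Xt j) W

lemma ad_contDiff (j : Fin k) {W : E n → E n} (hW : ContDiff ℝ (⊤ : ℕ∞) W) : ContDiff ℝ (⊤ : ℕ∞) (S.ad j W) :=
  lieB_contDiff (S.Xt_contDiff j) hW

lemma hat_contDiff (j : Fin k) {W : E n → E n} (hW : ContDiff ℝ (⊤ : ℕ∞) W) : ContDiff ℝ (⊤ : ℕ∞) (S.hatW j W) :=
  (((S.hΦ j).fderiv_right (m := (⊤ : ℕ∞)) (by simp)).comp (S.hΨ j)).clm_apply (hW.comp (S.hΨ j))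

lemma hat_deriv (j : Fin k) {W : E n → E n} (hW : ContDiff ℝ (⊤ : ℕ∞) W) :
    ∀ᶠ u in nhds (0 : HS n), fderiv ℝ (S.hatW j W) u (eH n) = S.hatW j (S.ad j W) u := by
  have hD : ContDiff ℝ (⊤ : ℕ∞) (fderiv ℝ (S.Φ j)) := (S.hΦ j).fderiv_right (m := (⊤ : ℕ∞)) (by simp)
  have h1 : (fun x => fderiv ℝ (S.Φ j) x (S.Xt j x)) =ᶠ[nhds 0] fun _ => eH n := by
    filter_upwards [S.DD_right' j] with x hx
    exact hx _
  have h2 := h1.fderiv (𝕜 := ℝ)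
  filter_upwards [(S.tendΨ j).eventually h2, S.right j] with u h3 h4
  have hΨd := ((S.hΨ j).differentiable (by simp) u).hasFDerivAt
  have hc : HasFDerivAt (fun u => fderiv ℝ (S.Φ j) (S.Ψ j u)) ((fderiv ℝ (fderiv ℝ (S.Φ j)) (S.Ψ j u)).comp (fderiv ℝ (S.Ψ j) u)) u :=
    ((hD.differentiable (by simp) _).hasFDerivAt).comp u hΨd
  have hw : HasFDerivAt (fun u => W (S.Ψ j u)) ((fderiv ℝ W (S.Ψ j u)).comp (fderiv ℝ (S.Ψ j) u)) u :=
    ((hW.differentiable (by simp) _).hasFDerivAt).comp u hΨd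
  have h5 : HasFDerivAt (S.hatW j W) _ u := hc.clm_apply hw
  rw [h5.fderiv]
  have h6 : fderiv ℝ (fun x => fderiv ℝ (S.Φ j) x (S.Xt j x)) (S.Ψ j u) (W (S.Ψ j u)) = 0 := by
    rw [h3]; simp
  have h7 := ((hD.differentiable (by simp) (S.Ψ j u)).hasFDerivAt).clm_apply
    (((S.Xt_contDiff j).differentiable (by simp) (S.Ψ j u)).hasFDerivAt)
  rw [h7.fderiv] at h6
  have hxi : fderiv ℝ (S.Ψ j) u (eH n) = S.Xt j (S.Ψ j u) := by
    rw [Xt, show S.Φ j (S.Ψ j u) = u from h4]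
  have hsym : IsSymmSndFDerivAt ℝ (S.Φ j) (S.Ψ j u) :=
    ((S.hΦ j).contDiffAt (x := S.Ψ j u)).isSymmSndFDerivAt (by simp; exact WithTop.coe_le_coe.2 (le_top : (2 : ℕ∞) ≤ ⊤))
  simp [hxi] at h6 ⊢
  rw [hsym.eq (S.Xt j (S.Ψ j u)) (W (S.Ψ j u))]
  rw [hatW, ad, lieB, map_sub]
  have h8 := eq_neg_of_add_eq_zero_right h6
  rw [h8]
  abel

def pbw (j : Fin k) (W : E n → E n) (z : E n × ℝ) : E n := S.pbo j z.2 z.1 (W (S.phi j z.2 z.1))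

lemma pbw_contDiff (j : Fin k) {W : E n → E n} (hW : ContDiff ℝ (⊤ : ℕ∞) W) : ContDiff ℝ (⊤ : ℕ∞) (S.pbw j W) :=
  (S.pbo_contDiff j).clm_apply (hW.comp (S.phi_contDiff j))

lemma pbw_deriv (j : Fin k) {W : E n → E n} (hW : ContDiff ℝ (⊤ : ℕ∞) W) :
    ∀ᶠ z in nhds (0 : E n × ℝ), HasDerivAt (fun t => S.pbw j W (z.1, t)) (S.pbw j (S.ad j W) z) z.2 := by
  have h2 : Filter.Tendsto (fun z : E n × ℝ => S.Φ j z.1 + z.2 • eH n) (nhds 0) (nhds 0) := by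
    refine Continuous.tendsto' ?_ _ _ ?_
    · have := (S.hΦ j).continuous
      fun_prop
    · simp [S.hΦ0 j]
  filter_upwards [h2.eventually (S.hat_deriv j hW)] with z hz
  have h1 : HasDerivAt (fun t : ℝ => S.Φ j z.1 + t • eH n) (eH n) z.2 := by
    have := ((hasDerivAt_id z.2).smul_const (eH n)).const_add (S.Φ j z.1)
    simpa using this
  have h3 : HasDerivAt (fun t : ℝ => S.hatW j W (S.Φ j z.1 + t • eH n)) _ z.2 :=
    HasFDerivAt.comp_hasDerivAt z.2 (((S.hat_contDiff j hW).differentiable (by simp) _).hasFDerivAt) h1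
  rw [hz] at h3
  exact (fderiv ℝ (S.Ψ j) (S.Φ j z.1)).hasFDerivAt.comp_hasDerivAt z.2 h3

lemma pbw_zero (j : Fin k) (W : E n → E n) : ∀ᶠ x in nhds (0 : E n), S.pbw j W (x, 0) = W x := by
  filter_upwards [S.DD_left j, S.left j] with x h1 h2
  have h3 : S.phi j 0 x = x := by
    simp only [phi, zero_smul, add_zero]; exact h2
  simp only [pbw, pbo, h3, ContinuousLinearMap.comp_apply]
  exact h1 _

lemma bdd_near {Z F : Type*} [TopologicalSpace Z] [NormedAddCommGroup F] {f : Z → F} {z : Z} (hf : ContinuousAt f z) :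
    ∃ C : ℝ, 0 ≤ C ∧ ∀ᶠ y in nhds z, ‖f y‖ ≤ C := by
  refine ⟨‖f z‖ + 1, by positivity, ?_⟩
  have := hf.norm.eventually_lt (continuousAt_const (y := ‖f z‖ + 1)) (by simp)
  filter_upwards [this] with y hy using hy.le

lemma pbw_taylor (j : Fin k) (N : ℕ) : ∀ {W : E n → E n}, ContDiff ℝ (⊤ : ℕ∞) W →
    ∃ C : ℝ, 0 ≤ C ∧ ∀ᶠ z in nhds (0 : E n × ℝ),
      ‖S.pbw j W z - ∑ a ∈ Finset.range N, (z.2 ^ a / (a.factorial : ℝ)) • ((S.ad j)^[a] W) z.1‖ ≤ C * |z.2| ^ N := by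
  induction N with
  | zero =>
    intro W hW
    obtain ⟨C, hC, h⟩ := bdd_near ((S.pbw_contDiff j hW).continuous.continuousAt (x := 0))
    exact ⟨C, hC, by simpa using h⟩
  | succ N ih =>
    intro W hW
    obtain ⟨C, hC, h⟩ := ih (S.ad_contDiff j hW)
    refine ⟨C, hC, ?_⟩
    have h0 : ∀ᶠ z in nhds (0 : E n × ℝ), S.pbw j W (z.1, 0) = W z.1 :=
      (continuous_fst.tendsto' (0 : E n × ℝ) 0 rfl).eventually (S.pbw_zero j W)
    obtain ⟨δ, hδ, hball⟩ := Metric.eventually_nhds_iff.1 (h.and ((S.pbw_deriv j hW).and h0))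
    refine Metric.eventually_nhds_iff.2 ⟨δ, hδ, fun z hz => ?_⟩
    have hz1 : ‖z.1‖ < δ := lt_of_le_of_lt (norm_fst_le z) (by simpa using hz)
    have hz2 : |z.2| < δ := lt_of_le_of_lt (norm_snd_le z) (by simpa using hz)
    have hin : ∀ s : ℝ, |s| ≤ |z.2| → dist (z.1, s) (0 : E n × ℝ) < δ := by
      intro s hs
      rw [dist_zero_right, Prod.norm_def]
      exact max_lt hz1 (by simpa using lt_of_le_of_lt hs hz2)
    let F : ℝ → E n := fun s => S.pbw j W (z.1, s) - ∑ a ∈ Finset.range (N+1), (s ^ a / (a.factorial : ℝ)) • ((S.ad j)^[a] W) z.1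
    have hF0 : F 0 = 0 := by
      have := (hball (hin 0 (by simp))).2.2
      simp only [F, Finset.sum_range_succ']
      simp [this]
    have hFd : ∀ s : ℝ, |s| ≤ |z.2| → HasDerivAt F (S.pbw j (S.ad j W) (z.1, s) -
        ∑ a ∈ Finset.range N, (s ^ a / (a.factorial : ℝ)) • ((S.ad j)^[a] (S.ad j W)) z.1) s := by
      intro s hs
      refine HasDerivAt.sub (hball (hin s hs)).2.1 ?_
      simp only [Finset.sum_range_succ']
      have : ∀ a ∈ Finset.range N, HasDerivAt (fun s : ℝ => (s ^ (a+1) / ((a+1).factorial : ℝ)) • ((S.ad j)^[a+1] W) z.1)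
          ((s ^ a / (a.factorial : ℝ)) • ((S.ad j)^[a] (S.ad j W)) z.1) s := by
        intro a _
        have h1 : HasDerivAt (fun s : ℝ => s ^ (a+1) / ((a+1).factorial : ℝ)) (s ^ a / (a.factorial : ℝ)) s := by
          refine ((hasDerivAt_pow (a+1) s).div_const ((a+1).factorial : ℝ)).congr_deriv ?_
          rw [Nat.factorial_succ]
          have : (a.factorial : ℝ) ≠ 0 := by positivity
          push_cast
          field_simp
        exact h1.smul_const _
      have := (HasDerivAt.fun_sum this).add_const (((0:ℕ).factorial : ℝ)⁻¹ • W z.1)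
      simpa using this
    have hb : ∀ s ∈ Icc (-|z.2|) |z.2|, ‖S.pbw j (S.ad j W) (z.1, s) -
        ∑ a ∈ Finset.range N, (s ^ a / (a.factorial : ℝ)) • ((S.ad j)^[a] (S.ad j W)) z.1‖ ≤ C * |z.2|^N := by
      intro s hs
      have hs' := abs_le.2 hs
      refine (hball (hin s hs')).1.trans ?_
      gcongr
    have := Convex.norm_image_sub_le_of_norm_hasDerivWithin_le (f := F) (s := Icc (-|z.2|) |z.2|)
      (fun s hs => (hFd s (abs_le.2 hs)).hasDerivWithinAt) hb (convex_Icc _ _)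
      (show (0:ℝ) ∈ Icc (-|z.2|) |z.2| from ⟨by simp, by simp⟩) (show z.2 ∈ Icc (-|z.2|) |z.2| from ⟨neg_abs_le _, le_abs_self _⟩)
    rw [hF0, sub_zero, sub_zero, Real.norm_eq_abs, mul_assoc, ← pow_succ] at this
    exact this

/-- coefficient vector fields -/
def Vf : (m : ℕ) → (Fin m → Fin k) → Fin m → (Fin m → ℕ) → E n → E n
  | 0, _, p, _ => p.elim0
  | m+1, js, p, γ => Fin.cases (if γ = 0 then S.Xt (js 0) else fun _ => 0)
      (fun q => (S.ad (js 0))^[γ 0] (Vf m (Fin.tail js) q (Fin.tail γ))) p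

lemma Vf_contDiff (m : ℕ) (js : Fin m → Fin k) (p : Fin m) (γ : Fin m → ℕ) : ContDiff ℝ (⊤ : ℕ∞) (S.Vf m js p γ) := by
  induction m with
  | zero => exact p.elim0
  | succ m ih =>
    refine Fin.cases ?_ (fun q => ?_) p
    · simp only [Vf, Fin.cases_zero]
      split_ifs
      · exact S.Xt_contDiff _
      · exact contDiff_const
    · simp only [Vf, Fin.cases_succ]
      have := ih (Fin.tail js) q (Fin.tail γ)
      generalize γ 0 = a
      induction a with
      | zero => exact this
      | succ a iha => rw [Function.iterate_succ_apply']; exact S.ad_contDiff _ iha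

/-- monomial with factorial -/
def mon {m : ℕ} (t : Fin m → ℝ) (γ : Fin m → ℕ) : ℝ := ∏ i, t i ^ γ i / ((γ i).factorial : ℝ)

end SD
end

set_option linter.unusedVariables false
open MeasureTheory Set Metric
open scoped ENNReal NNReal
noncomputable section

namespace SD
variable {n k : ℕ} {π : Fin k → E n → E (n-1)} (S : SD n k π)

lemma mon_le {m : ℕ} (t : Fin m → ℝ) (ht : ‖t‖ ≤ 1) (γ : Fin m → ℕ) : |mon t γ| ≤ 1 := by
  rw [mon, Finset.abs_prod]
  refine Finset.prod_le_one (fun i _ => abs_nonneg _) fun i _ => ?_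
  rw [abs_div, abs_pow, Nat.abs_cast]
  have h1 : |t i| ≤ 1 := (norm_le_pi_norm t i).trans ht
  have h2 : (1:ℝ) ≤ ((γ i).factorial : ℝ) := by exact_mod_cast Nat.one_le_iff_ne_zero.2 (Nat.factorial_ne_zero _)
  exact (div_le_self (by positivity) h2).trans (pow_le_one₀ (abs_nonneg _) h1)

lemma norm_tail_le {m : ℕ} (t : Fin (m+1) → ℝ) : ‖(Fin.tail t : Fin m → ℝ)‖ ≤ ‖t‖ :=
  (pi_norm_le_iff_of_nonneg (norm_nonneg _)).2 fun i => norm_le_pi_norm t i.succ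

lemma sum_split {m N : ℕ} (q : Fin m) (js : Fin (m+1) → Fin k) (t : Fin (m+1) → ℝ) (x : E n) :
    ∑ γ : Fin (m+1) → Fin N, mon t (fun i => (γ i : ℕ)) • S.Vf (m+1) js q.succ (fun i => (γ i : ℕ)) x =
    ∑ γ : Fin m → Fin N, mon (Fin.tail t) (fun i => (γ i : ℕ)) • ∑ a ∈ Finset.range N, (t 0 ^ a / (a.factorial : ℝ)) •
      ((S.ad (js 0))^[a] (S.Vf m (Fin.tail js) q (fun i => (γ i : ℕ)))) x := by
  rw [← (Fin.consEquiv (fun _ : Fin (m+1) => Fin N)).sum_comp, Fintype.sum_prod_type, Finset.sum_comm]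
  refine Finset.sum_congr rfl fun γ _ => ?_
  rw [Finset.smul_sum, Finset.sum_range]
  refine Finset.sum_congr rfl fun a _ => ?_
  rw [smul_smul]
  have e1 : (Fin.tail fun i => ((Fin.consEquiv (fun _ : Fin (m+1) => Fin N)) (a, γ) i : ℕ)) = fun i => (γ i : ℕ) := by
    funext i; simp [Fin.tail, Fin.consEquiv]
  have e2 : ((Fin.consEquiv (fun _ : Fin (m+1) => Fin N)) (a, γ) 0 : ℕ) = a := by simp [Fin.consEquiv]
  simp only [Vf, Fin.cases_succ, e1, e2]
  congr 1
  rw [mon, Fin.prod_univ_succ, e2, mul_comm]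
  congr 1

lemma pbv_taylor (N : ℕ) (hN : 1 ≤ N) (m : ℕ) (js : Fin m → Fin k) (p : Fin m) :
    ∃ C : ℝ, 0 ≤ C ∧ ∀ᶠ z in nhds (0 : E n × (Fin m → ℝ)),
      ‖S.pbv m js p z - ∑ γ : Fin m → Fin N, mon z.2 (fun i => (γ i : ℕ)) • S.Vf m js p (fun i => (γ i : ℕ)) z.1‖ ≤ C * ‖z.2‖ ^ N := by
  induction m with
  | zero => exact p.elim0
  | succ m ih =>
    refine Fin.cases ?_ (fun q => ?_) p
    · refine ⟨0, le_rfl, Filter.Eventually.of_forall fun z => ?_⟩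
      rw [zero_mul, norm_le_zero_iff, sub_eq_zero]
      let γ0 : Fin (m+1) → Fin N := fun _ => ⟨0, hN⟩
      rw [Finset.sum_eq_single γ0]
      · simp only [γ0, pbv, Fin.cases_zero, Vf, mon]
        simp
        have h00 : (fun _ : Fin (m+1) => (0:ℕ)) = 0 := rfl
        rw [if_pos h00]
      · intro γ _ hne
        have : ¬ ((fun i => (γ i : ℕ)) = 0) := by
          intro h
          apply hne
          funext i
          exact Fin.ext (congrFun h i)
        simp [Vf, this]
      · simp
    · obtain ⟨C1, hC1, h1⟩ := ih (Fin.tail js) q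
      have hpc : Continuous fun z : E n × (Fin (m+1) → ℝ) => S.pbo (js 0) (z.2 0) z.1 :=
        (S.pbo_contDiff (js 0)).continuous.comp (by fun_prop : Continuous fun z : E n × (Fin (m+1) → ℝ) => (z.1, z.2 0))
      obtain ⟨C2, hC2, h2⟩ := bdd_near (hpc.continuousAt (x := 0))
      choose C3 hC3 h3 using fun γ : Fin m → Fin N => S.pbw_taylor (js 0) N (S.Vf_contDiff m (Fin.tail js) q (fun i => (γ i : ℕ)))
      refine ⟨C2 * C1 + ∑ γ, C3 γ, by have := Finset.sum_nonneg (fun γ (_ : γ ∈ Finset.univ) => hC3 γ); positivity, ?_⟩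
      have ht : Filter.Tendsto (fun z : E n × (Fin (m+1) → ℝ) => (z.1, z.2 0)) (nhds 0) (nhds 0) :=
        Continuous.tendsto' (by fun_prop) _ _ rfl
      have h3' := (Filter.eventually_all (ι := Fin m → Fin N)).2 fun γ => ht.eventually (h3 γ)
      have h4 : ∀ᶠ z in nhds (0 : E n × (Fin (m+1) → ℝ)), ‖z.2‖ ≤ 1 := by
        have : Continuous fun z : E n × (Fin (m+1) → ℝ) => ‖z.2‖ := by fun_prop
        filter_upwards [this.continuousAt.eventually_lt (continuousAt_const (y := (1:ℝ))) (by simp)] with z hz using hz.le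
      filter_upwards [(S.stp_tend m (js 0)).eventually h1, h2, h3', h4] with z g1 g2 g3 g4
      rw [S.sum_split]
      simp only [pbv, Fin.cases_succ]
      set Q := ∑ γ : Fin m → Fin N, mon (Fin.tail z.2) (fun i => (γ i : ℕ)) • S.Vf m (Fin.tail js) q (fun i => (γ i : ℕ)) (S.phi (js 0) (z.2 0) z.1) with hQ
      have e : S.pbo (js 0) (z.2 0) z.1 (S.pbv m (Fin.tail js) q (S.phi (js 0) (z.2 0) z.1, Fin.tail z.2)) -
         ∑ γ : Fin m → Fin N, mon (Fin.tail z.2) (fun i => (γ i : ℕ)) • ∑ a ∈ Finset.range N, (z.2 0 ^ a / (a.factorial : ℝ)) •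
           ((S.ad (js 0))^[a] (S.Vf m (Fin.tail js) q (fun i => (γ i : ℕ)))) z.1 =
         S.pbo (js 0) (z.2 0) z.1 (S.pbv m (Fin.tail js) q (S.phi (js 0) (z.2 0) z.1, Fin.tail z.2) - Q) +
         ∑ γ : Fin m → Fin N, mon (Fin.tail z.2) (fun i => (γ i : ℕ)) • (S.pbw (js 0) (S.Vf m (Fin.tail js) q (fun i => (γ i : ℕ))) (z.1, z.2 0) - ∑ a ∈ Finset.range N, (z.2 0 ^ a / (a.factorial : ℝ)) •
           ((S.ad (js 0))^[a] (S.Vf m (Fin.tail js) q (fun i => (γ i : ℕ)))) z.1) := by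
        simp only [smul_sub, Finset.sum_sub_distrib, map_sub, hQ, map_sum, map_smul, pbw]
        abel
      rw [e, add_mul, Finset.sum_mul]
      refine (norm_add_le _ _).trans (add_le_add ?_ ?_)
      · refine (ContinuousLinearMap.le_opNorm _ _).trans ?_
        rw [mul_assoc]
        refine mul_le_mul g2 (g1.trans ?_) (norm_nonneg _) hC2
        gcongr
        exact norm_tail_le z.2
      · refine (norm_sum_le _ _).trans (Finset.sum_le_sum fun γ _ => ?_)
        rw [norm_smul]
        refine (mul_le_of_le_one_left (norm_nonneg _) (mon_le _ ((norm_tail_le _).trans g4) _)).trans ((g3 γ).trans ?_)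
        have := hC3 γ
        gcongr
        exact norm_le_pi_norm z.2 0

end SD
end

set_option linter.unusedVariables false
open MeasureTheory Set Metric
open scoped ENNReal NNReal
noncomputable section

lemma detE_continuous (n : ℕ) : Continuous (fun v : Fin n → E n => detE n v) := by
  simp only [detE_apply]
  refine Continuous.matrix_det ?_
  refine continuous_matrix fun i j => ?_
  simp only [Matrix.of_apply]
  fun_prop

lemma detE_diff (n : ℕ) (R : ℝ) (hR : 0 ≤ R) : ∃ K : ℝ, 0 ≤ K ∧ ∀ a b : Fin n → E n, ‖a‖ ≤ R → ‖b‖ ≤ R →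
    |detE n a - detE n b| ≤ K * ‖a - b‖ := by
  let f : ContinuousMultilinearMap ℝ (fun _ : Fin n => E n) ℝ := ⟨detE n, detE_continuous n⟩
  refine ⟨‖f‖ * (Fintype.card (Fin n)) * R ^ (Fintype.card (Fin n) - 1), by positivity, fun a b ha hb => ?_⟩
  have := f.norm_image_sub_le a b
  refine (show |detE n a - detE n b| = ‖f a - f b‖ from rfl).le.trans (this.trans ?_)
  gcongr
  exact max_le ha hb

namespace SD
variable {n k : ℕ} {π : Fin k → E n → E (n-1)} (S : SD n k π)

/-- coefficient in the expansion of the Jacobian -/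
def kap {m N : ℕ} (js : Fin m → Fin k) (act : Fin n → Fin m) (x : E n) (Γ : Fin n → Fin m → Fin N) : ℝ :=
  (∏ i, ∏ l, (((Γ i l : ℕ).factorial : ℝ))⁻¹) * detE n (fun i => S.Vf m js (act i) (fun l => (Γ i l : ℕ)) x)

lemma kap_continuous {m N : ℕ} (js : Fin m → Fin k) (act : Fin n → Fin m) (Γ : Fin n → Fin m → Fin N) :
    Continuous fun x => S.kap js act x Γ := by
  unfold kap
  refine continuous_const.mul ((detE_continuous n).comp ?_)
  exact continuous_pi fun i => (S.Vf_contDiff m js (act i) _).continuous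

def Jt {m : ℕ} (js : Fin m → Fin k) (act : Fin n → Fin m) (z : E n × (Fin m → ℝ)) : ℝ :=
  detE n (fun i => S.pbv m js (act i) z)

lemma Jt_taylor {m : ℕ} (N : ℕ) (hN : 1 ≤ N) (js : Fin m → Fin k) (act : Fin n → Fin m) :
    ∃ C : ℝ, 0 ≤ C ∧ ∀ᶠ z in nhds (0 : E n × (Fin m → ℝ)),
      |S.Jt js act z - ∑ Γ : Fin n → Fin m → Fin N, S.kap js act z.1 Γ * ∏ l, z.2 l ^ (∑ i, (Γ i l : ℕ))| ≤ C * ‖z.2‖ ^ N := by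
  choose C hC h using fun i => S.pbv_taylor N hN m js (act i)
  set P : E n × (Fin m → ℝ) → Fin n → E n := fun z i =>
    ∑ γ : Fin m → Fin N, mon z.2 (fun l => (γ l : ℕ)) • S.Vf m js (act i) (fun l => (γ l : ℕ)) z.1 with hP
  have hPc : Continuous P := by
    refine continuous_pi fun i => ?_
    refine continuous_finset_sum _ fun γ _ => ?_
    have := (S.Vf_contDiff m js (act i) (fun l => (γ l : ℕ))).continuous
    unfold mon
    have h1 : Continuous fun z : E n × (Fin m → ℝ) => ∏ i, z.2 i ^ (γ i : ℕ) / (((γ i : ℕ).factorial : ℕ) : ℝ) := by fun_prop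
    have h2 : Continuous fun z : E n × (Fin m → ℝ) => S.Vf m js (act i) (fun l => (γ l : ℕ)) z.1 := this.comp continuous_fst
    exact h1.smul h2
  have hexp : ∀ z, detE n (P z) = ∑ Γ : Fin n → Fin m → Fin N, S.kap js act z.1 Γ * ∏ l, z.2 l ^ (∑ i, (Γ i l : ℕ)) := by
    intro z
    rw [hP, MultilinearMap.map_sum]
    refine Finset.sum_congr rfl fun Γ _ => ?_
    rw [MultilinearMap.map_smul_univ, smul_eq_mul, kap]
    have : ∏ i, mon z.2 (fun l => (Γ i l : ℕ)) = (∏ i, ∏ l, (((Γ i l : ℕ).factorial : ℝ))⁻¹) * ∏ l, z.2 l ^ (∑ i, (Γ i l : ℕ)) := by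
      have h2 : ∏ l, z.2 l ^ (∑ i, (Γ i l : ℕ)) = ∏ i, ∏ l, z.2 l ^ (Γ i l : ℕ) := by
        rw [Finset.prod_comm]
        refine Finset.prod_congr rfl fun l _ => ?_
        rw [Finset.prod_pow_eq_pow_sum]
      rw [h2, ← Finset.prod_mul_distrib]
      refine Finset.prod_congr rfl fun i _ => ?_
      rw [← Finset.prod_mul_distrib, mon]
      refine Finset.prod_congr rfl fun l _ => ?_
      rw [div_eq_mul_inv, mul_comm]
    rw [this]; ring
  obtain ⟨R, hR, hRb⟩ := bdd_near (hPc.continuousAt (x := 0))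
  set CS := ∑ i, C i with hCS
  have hCS0 : 0 ≤ CS := Finset.sum_nonneg fun i _ => hC i
  obtain ⟨K, hK, hKb⟩ := detE_diff n (R + CS) (by positivity)
  refine ⟨K * CS, by positivity, ?_⟩
  have h4 : ∀ᶠ z in nhds (0 : E n × (Fin m → ℝ)), ‖z.2‖ ≤ 1 := by
    have : Continuous fun z : E n × (Fin m → ℝ) => ‖z.2‖ := by fun_prop
    filter_upwards [this.continuousAt.eventually_lt (continuousAt_const (y := (1:ℝ))) (by simp)] with z hz using hz.le
  filter_upwards [hRb, Filter.eventually_all.2 h, h4] with z g1 g2 g3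
  rw [← hexp, Jt]
  have g4 : ‖(fun i => S.pbv m js (act i) z) - P z‖ ≤ CS * ‖z.2‖ ^ N := by
    refine (pi_norm_le_iff_of_nonneg (by positivity)).2 fun i => ?_
    refine (g2 i).trans ?_
    gcongr
    exact Finset.single_le_sum (f := C) (fun i _ => hC i) (Finset.mem_univ i)
  have g5 : ‖z.2‖ ^ N ≤ 1 := pow_le_one₀ (norm_nonneg _) g3
  have g6 : ‖(fun i => S.pbv m js (act i) z)‖ ≤ R + CS := by
    have := norm_add_le ((fun i => S.pbv m js (act i) z) - P z) (P z)
    rw [sub_add_cancel] at this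
    nlinarith
  have := hKb _ _ g6 (g1.trans (by linarith))
  refine this.trans ?_
  rw [mul_assoc]
  gcongr

end SD
end

set_option linter.unusedVariables false
open MeasureTheory Set Metric
open scoped ENNReal NNReal
noncomputable section

def wd {k : ℕ} : (m : ℕ) → (Fin m → Fin k) → Fin m → (Fin m → ℕ) → List (Fin k)
  | 0, _, _, _ => []
  | m+1, js, p, γ => Fin.cases [js 0] (fun q => List.replicate (γ 0) (js 0) ++ wd m (Fin.tail js) q (Fin.tail γ)) p

lemma wd_ne {k : ℕ} (m : ℕ) (js : Fin m → Fin k) (p : Fin m) (γ : Fin m → ℕ) : wd m js p γ ≠ [] := by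
  induction m with
  | zero => exact p.elim0
  | succ m ih =>
    refine Fin.cases ?_ (fun q => ?_) p
    · simp [wd]
    · simp only [wd, Fin.cases_succ]
      exact List.append_ne_nil_of_right_ne_nil _ (ih _ q _)

lemma wd_count {k : ℕ} (m : ℕ) (js : Fin m → Fin k) (p : Fin m) (γ : Fin m → ℕ) (hγ : ∀ l, p ≤ l → γ l = 0) (j : Fin k) :
    (wd m js p γ).count j = (if js p = j then 1 else 0) + ∑ l, γ l * (if js l = j then 1 else 0) := by
  induction m with
  | zero => exact p.elim0
  | succ m ih =>
    revert hγ
    refine Fin.cases ?_ (fun q => ?_) p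
    · intro hγ
      have : ∀ l, γ l = 0 := fun l => hγ l (Fin.zero_le l)
      simp [wd, this, List.count_cons]
    · intro hγ
      simp only [wd, Fin.cases_succ, List.count_append]
      rw [ih (Fin.tail js) q (Fin.tail γ) (fun l hl => hγ l.succ (Fin.succ_le_succ_iff.2 hl)), Fin.sum_univ_succ, List.count_replicate]
      have e1 : ∑ l, (Fin.tail γ) l * (if Fin.tail js l = j then 1 else 0) = ∑ l : Fin m, γ l.succ * (if js l.succ = j then 1 else 0) := rfl
      have e2 : (if Fin.tail js q = j then 1 else 0) = if js q.succ = j then 1 else 0 := rfl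
      rw [e1, e2]
      generalize ∑ l : Fin m, γ l.succ * (if js l.succ = j then 1 else 0) = A
      generalize (if js q.succ = j then 1 else 0) = B
      by_cases h : js 0 = j <;> simp [h]
      all_goals ring

lemma wd_slice {k : ℕ} (m : ℕ) (js : Fin m → Fin k) (p : Fin m) (o : ℕ) (ho : o ≤ p) (γ : Fin m → ℕ)
    (h1 : ∀ l : Fin m, o ≤ l → l < p → γ l = 1) (h2 : ∀ l : Fin m, (l:ℕ) < o → γ l = 0) :
    wd m js p γ = ((List.ofFn js).take (p+1)).drop o := by
  induction m generalizing o with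
  | zero => exact p.elim0
  | succ m ih =>
    revert ho h1
    refine Fin.cases ?_ (fun q => ?_) p
    · intro ho h1
      have : o = 0 := by simpa using ho
      subst this
      simp [wd]
    · intro ho h1
      simp only [wd, Fin.cases_succ]
      cases o with
      | zero =>
        rw [ih (Fin.tail js) q 0 (by simp) (Fin.tail γ) (fun l _ hl => h1 l.succ (by simp) (Fin.succ_lt_succ_iff.2 hl)) (by simp)]
        rw [h1 0 (by simp) (Fin.succ_pos q)]
        simp [List.ofFn_succ]
        rfl
      | succ o =>
        rw [ih (Fin.tail js) q o (by simpa using ho) (Fin.tail γ)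
          (fun l hl hlq => h1 l.succ (by simpa using hl) (Fin.succ_lt_succ_iff.2 hlq)) (fun l hl => h2 l.succ (by simpa using hl))]
        rw [h2 0 (by simp)]
        simp [List.ofFn_succ]
        rfl

namespace SD
variable {n k : ℕ} {π : Fin k → E n → E (n-1)} (S : SD n k π)

lemma ad_smul (j : Fin k) (s : ℝ) (hs : s = 1 ∨ s = -1) (W : E n → E n) :
    S.ad j (fun x => s • W x) = fun x => s • S.ad j W x := by
  rcases hs with rfl | rfl
  · simp
  · funext x
    have : (fun x => (-1:ℝ) • W x) = -W := by funext x; simp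
    rw [this]
    simp only [ad, lieB, fderiv_neg]
    simp
    abel

lemma ad_XW (j : Fin k) (w : List (Fin k)) (hw : w ≠ []) : S.ad j (XW S.Xt w) = fun x => (-1:ℝ) • XW S.Xt (j :: w) x := by
  funext x
  rw [XW_cons _ _ _ hw]
  simp [ad, lieB]

lemma Vf_eq (m : ℕ) (js : Fin m → Fin k) (p : Fin m) (γ : Fin m → ℕ) :
    ((∀ l, p ≤ l → γ l = 0) → ∃ s : ℝ, (s = 1 ∨ s = -1) ∧ S.Vf m js p γ = fun x => s • XW S.Xt (wd m js p γ) x) ∧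
    (¬ (∀ l, p ≤ l → γ l = 0) → S.Vf m js p γ = fun _ => 0) := by
  induction m with
  | zero => exact p.elim0
  | succ m ih =>
    refine Fin.cases ?_ (fun q => ?_) p
    · have : (∀ l, 0 ≤ l → γ l = 0) ↔ γ = 0 := by
        constructor
        · intro h; funext l; exact h l (Fin.zero_le l)
        · rintro rfl l _; rfl
      rw [this]
      simp only [Vf, Fin.cases_zero, wd]
      constructor
      · intro h
        rw [if_pos h]
        exact ⟨1, Or.inl rfl, by simp; rfl⟩
      · intro h
        rw [if_neg h]
    · have : (∀ l, q.succ ≤ l → γ l = 0) ↔ (∀ l, q ≤ l → (Fin.tail γ) l = 0) := by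
        constructor
        · intro h l hl; exact h l.succ (Fin.succ_le_succ_iff.2 hl)
        · intro h l
          refine Fin.cases (fun hl => absurd hl (by simp)) (fun l hl => h l (Fin.succ_le_succ_iff.1 hl)) l
      rw [this]
      simp only [Vf, Fin.cases_succ, wd]
      obtain ⟨i1, i2⟩ := ih (Fin.tail js) q (Fin.tail γ)
      constructor
      · intro h
        obtain ⟨s, hs, e⟩ := i1 h
        generalize γ 0 = a
        have hne := wd_ne m (Fin.tail js) q (Fin.tail γ)
        induction a with
        | zero => exact ⟨s, hs, by simpa using e⟩
        | succ a iha =>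
          obtain ⟨s', hs', e'⟩ := iha
          refine ⟨s' * (-1), by rcases hs' with rfl | rfl <;> simp, ?_⟩
          rw [Function.iterate_succ_apply', e', S.ad_smul _ _ hs', S.ad_XW _ _ (List.append_ne_nil_of_right_ne_nil _ hne)]
          funext x
          rw [smul_smul]
          rfl
      · intro h
        rw [i2 h]
        generalize γ 0 = a
        induction a with
        | zero => rfl
        | succ a iha =>
          rw [Function.iterate_succ_apply', iha]
          funext x
          simp [ad, lieB]

end SD

structure Layout {n k : ℕ} (I : Fin n → List (Fin k)) where
  m : ℕ
  js : Fin m → Fin k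
  act : Fin n → Fin m
  blk : Fin m → Fin n
  blk_act : ∀ i, blk (act i) = i
  blk_le : ∀ i l, l < act i → blk l ≤ i
  le_act : ∀ l, l ≤ act (blk l)
  count : ∀ j, degI I j = ∑ l, if js l = j then 1 else 0
  len : ∀ i, (I i).length = ∑ l, if blk l = i then 1 else 0
  can : ∀ i (γ : Fin m → ℕ), (∀ l, γ l = if blk l = i ∧ l ≠ act i then 1 else 0) → wd m js (act i) γ = I i

lemma count_sum {k : ℕ} (w : List (Fin k)) (j : Fin k) : w.count j = ∑ r : Fin w.length, if w.get r = j then 1 else 0 := by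
  induction w with
  | nil => simp
  | cons a w ih =>
    rw [List.count_cons, ih]
    simp only [List.length_cons]
    rw [Fin.sum_univ_succ, add_comm]
    by_cases h : a = j <;> simp [h]

lemma exists_layout {n k : ℕ} (I : Fin n → List (Fin k)) (hI : ∀ i, I i ≠ []) : Nonempty (Layout I) := by
  classical
  let len : Fin n → ℕ := fun i => (I i).length
  have hlen : ∀ i, 0 < len i := fun i => List.length_pos_iff.2 (hI i)
  let e : (Σ i : Fin n, Fin (len i)) ≃ Fin (∑ i, len i) := finSigmaFinEquiv
  let off : Fin n → ℕ := fun i => ∑ i' : Fin i, len (Fin.castLE i.2.le i')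
  have he : ∀ s, (e s : ℕ) = off s.1 + s.2 := fun s => finSigmaFinEquiv_apply s
  have hoff' : ∀ i : Fin n, off i = ∑ i' ∈ Finset.univ.filter (fun i' : Fin n => i' < i), len i' := by
    intro i
    refine Finset.sum_bij (fun a _ => Fin.castLE i.2.le a) ?_ ?_ ?_ ?_
    · intro a _; exact Finset.mem_filter.2 ⟨Finset.mem_univ _, a.2⟩
    · intro a _ b _ h; exact Fin.castLE_injective _ h
    · intro b hb
      exact ⟨⟨b, by simpa using hb⟩, by simp, rfl⟩
    · intro a _; rfl
  have hoff : ∀ i i' : Fin n, i < i' → off i + len i ≤ off i' := by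
    intro i i' h
    rw [hoff', hoff', add_comm, ← Finset.sum_insert (by simp)]
    refine Finset.sum_le_sum_of_subset fun a ha => ?_
    simp at ha ⊢
    rcases ha with rfl | ha
    · exact h
    · exact ha.trans h
  let act : Fin n → Fin (∑ i, len i) := fun i => e ⟨i, ⟨len i - 1, by have := hlen i; omega⟩⟩
  let blk : Fin (∑ i, len i) → Fin n := fun l => (e.symm l).1
  let js : Fin (∑ i, len i) → Fin k := fun l => (I (e.symm l).1).get (e.symm l).2
  have hjs : ∀ s : (Σ i : Fin n, Fin (len i)), js (e s) = (I s.1).get s.2 := fun s =>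
    congrArg (fun s' : (Σ i : Fin n, Fin (len i)) => (I s'.1).get s'.2) (e.symm_apply_apply s)
  have hl : ∀ l : Fin (∑ i, len i), (l : ℕ) = off (blk l) + (e.symm l).2 := fun l => by
    conv_lhs => rw [← e.apply_symm_apply l]
    exact he _
  have hact : ∀ i, (act i : ℕ) = off i + (len i - 1) := fun i => he _
  have hba : ∀ i, blk (act i) = i := fun i => by simp [blk, act]
  have hble : ∀ i l, l < act i → blk l ≤ i := by
    intro i l h
    by_contra hc
    push Not at hc
    have h1 := hoff _ _ hc
    have h2 := hl l
    have h3 := hact i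
    have h4 := hlen i
    have h5 : (l:ℕ) < act i := h
    omega
  have hla : ∀ l, l ≤ act (blk l) := by
    intro l
    rw [Fin.le_def, hl l, hact]
    have : ((e.symm l).2 : ℕ) < len (blk l) := (e.symm l).2.2
    omega
  refine ⟨⟨_, js, act, blk, hba, hble, hla, ?_, ?_, ?_⟩⟩
  · intro j
    rw [← e.sum_comp, Fintype.sum_sigma, degI]
    refine Finset.sum_congr rfl fun i _ => ?_
    simp only [hjs]
    exact count_sum (I i) j
  · intro i
    rw [← e.sum_comp, Fintype.sum_sigma]
    simp only [blk, Equiv.symm_apply_apply]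
    rw [Finset.sum_eq_single i]
    · simp [len]
    · intro b _ hb; simp [hb]
    · simp
  · intro i γ hγ
    rw [wd_slice _ js (act i) (off i) (by rw [hact]; omega) γ]
    · have h4 := hlen i
      have h5 := hact i
      have h6 := (act i).2
      refine List.ext_getElem ?_ ?_
      · simp
        have : (I i).length = len i := rfl
        omega
      · intro r h1 h2
        simp only [List.getElem_drop, List.getElem_take, List.getElem_ofFn]
        have : (⟨off i + r, by have : r < len i := h2; omega⟩ : Fin (∑ i, len i)) = e ⟨i, ⟨r, h2⟩⟩ := Fin.ext (he ⟨i, ⟨r, h2⟩⟩).symm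
        rw [this, hjs]
        rfl
    · intro l h1 h2
      have hb : blk l = i := by
        by_contra hc
        have h3 := hble i l h2
        have h4 := hoff _ _ (lt_of_le_of_ne h3 hc)
        have h5 := hl l
        have : ((e.symm l).2 : ℕ) < len (blk l) := (e.symm l).2.2
        omega
      rw [hγ, if_pos ⟨hb, h2.ne⟩]
    · intro l h1
      rw [hγ, if_neg]
      rintro ⟨h2, _⟩
      have h5 := hl l
      rw [h2] at h5
      omega


namespace SD
variable {n k : ℕ} {π : Fin k → E n → E (n-1)} (S : SD n k π)

def bet {n k : ℕ} {I : Fin n → List (Fin k)} (Y : Layout I) (l : Fin Y.m) : ℕ := if l = Y.act (Y.blk l) then 0 else 1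

lemma bet_sum {n k : ℕ} {I : Fin n → List (Fin k)} (Y : Layout I) (l : Fin Y.m) :
    (∑ i, if l = Y.act i then 1 else 0) + bet Y l = 1 := by
  have : ∀ i, (if l = Y.act i then 1 else 0) = if i = Y.blk l then (if l = Y.act (Y.blk l) then 1 else 0) else 0 := by
    intro i
    by_cases h : l = Y.act i
    · have : i = Y.blk l := by rw [h, Y.blk_act]
      rw [if_pos h, if_pos this, ← this, if_pos h]
    · rw [if_neg h]
      by_cases h2 : i = Y.blk l
      · rw [if_pos h2, ← h2, if_neg h]
      · rw [if_neg h2]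
  rw [Finset.sum_congr rfl fun i _ => this i, Finset.sum_ite_eq', if_pos (Finset.mem_univ _), bet]
  split_ifs <;> rfl

lemma detE_smul (s : Fin n → ℝ) (I : Fin n → List (Fin k)) (x : E n) :
    detE n (fun i => s i • XW S.Xt (I i) x) = (∏ i, s i) * lam S.Xt I x := by
  rw [MultilinearMap.map_smul_univ, smul_eq_mul, detE_apply]
  rfl

lemma act_sum {n k : ℕ} {I : Fin n → List (Fin k)} (Y : Layout I) (g : Fin Y.m → ℕ) :
    ∑ l, g l = ∑ i, g (Y.act i) + ∑ l, bet Y l * g l := by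
  have : ∀ i, g (Y.act i) = ∑ l, (if l = Y.act i then 1 else 0) * g l := by intro i; simp
  simp only [this]
  rw [Finset.sum_comm, ← Finset.sum_add_distrib]
  refine Finset.sum_congr rfl fun l _ => ?_
  rw [← Finset.sum_mul, ← add_mul, bet_sum, one_mul]

lemma coef_ne {I : Fin n → List (Fin k)} (hl : lam S.Xt I 0 ≠ 0)
    (hmax : ∀ I'' : Fin n → List (Fin k), (∀ i, I'' i ≠ []) → degI I'' = degI I → Pot I < Pot I'' → lam S.Xt I'' 0 = 0)
    (Y : Layout I) (N : ℕ) (hN : 2 ≤ N) :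
    (∑ Γ : Fin n → Fin Y.m → Fin N, if (fun l => ∑ i, (Γ i l : ℕ)) = bet Y then S.kap Y.js Y.act 0 Γ else 0) ≠ 0 := by
  classical
  let Γc : Fin n → Fin Y.m → Fin N := fun i l => if Y.blk l = i ∧ l ≠ Y.act i then ⟨1, by omega⟩ else ⟨0, by omega⟩
  have hΓc : ∀ i l, (Γc i l : ℕ) = if Y.blk l = i ∧ l ≠ Y.act i then 1 else 0 := by
    intro i l; simp only [Γc]; split_ifs <;> rfl
  have hvan : ∀ i l, Y.act i ≤ l → (Γc i l : ℕ) = 0 := by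
    intro i l h
    rw [hΓc, if_neg]
    rintro ⟨h1, h2⟩
    have := Y.le_act l
    rw [h1] at this
    exact h2 (le_antisymm this h)
  have hone : (fun l => ∑ i, (Γc i l : ℕ)) = bet Y := by
    funext l
    rw [Finset.sum_eq_single (Y.blk l)]
    · rw [hΓc, bet]; simp
    · intro b _ hb; rw [hΓc, if_neg]; rintro ⟨h1, _⟩; exact hb h1.symm
    · simp
  rw [Finset.sum_eq_single Γc]
  · rw [if_pos hone, kap]
    refine mul_ne_zero ?_ ?_
    · exact Finset.prod_ne_zero_iff.2 fun i _ => Finset.prod_ne_zero_iff.2 fun l _ => by positivity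
    · choose s hs e using fun i => (S.Vf_eq Y.m Y.js (Y.act i) (fun l => (Γc i l : ℕ))).1 (hvan i)
      simp only [e]
      rw [S.detE_smul]
      refine mul_ne_zero (Finset.prod_ne_zero_iff.2 fun i _ => ?_) ?_
      · rcases hs i with h | h <;> rw [h] <;> norm_num
      · have : (fun i => wd Y.m Y.js (Y.act i) (fun l => (Γc i l : ℕ))) = I := by
          funext i; exact Y.can i _ (hΓc i)
        rw [this]; exact hl
  · intro Γ _ hne
    by_cases hb : (fun l => ∑ i, (Γ i l : ℕ)) = bet Y
    swap
    · rw [if_neg hb]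
    rw [if_pos hb, kap]
    refine mul_eq_zero_of_right _ ?_
    by_cases hv : ∀ i l, Y.act i ≤ l → (Γ i l : ℕ) = 0
    swap
    · push Not at hv
      obtain ⟨i, l, h1, h2⟩ := hv
      refine MultilinearMap.map_coord_zero _ i ?_
      rw [(S.Vf_eq Y.m Y.js (Y.act i) (fun l => (Γ i l : ℕ))).2 (by push Not; exact ⟨l, h1, h2⟩)]
    choose s hs e using fun i => (S.Vf_eq Y.m Y.js (Y.act i) (fun l => (Γ i l : ℕ))).1 (hv i)
    simp only [e]
    rw [S.detE_smul]
    refine mul_eq_zero_of_right _ ?_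
    have hcount := fun i => wd_count Y.m Y.js (Y.act i) (fun l => (Γ i l : ℕ)) (hv i)
    have hlen : ∀ i, (wd Y.m Y.js (Y.act i) (fun l => (Γ i l : ℕ))).length = 1 + ∑ l, (Γ i l : ℕ) := by
      intro i
      rw [length_eq_count]
      simp only [hcount]
      rw [Finset.sum_add_distrib, Finset.sum_comm]
      simp
    have hbl : ∀ l, ∑ i, (Γ i l : ℕ) = bet Y l := fun l => congrFun hb l
    refine hmax _ (fun i => wd_ne _ _ _ _) ?_ ?_
    · funext j
      rw [Y.count j, degI]
      simp only [hcount]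
      rw [act_sum, Finset.sum_add_distrib, Finset.sum_comm]
      congr 1
      refine Finset.sum_congr rfl fun l _ => ?_
      rw [← Finset.sum_mul, hbl]
    · have hP1 : Pot I = ∑ i : Fin n, (i:ℕ) + ∑ i, ∑ l, (Y.blk l : ℕ) * (Γ i l : ℕ) := by
        have h1 : Pot I = ∑ l, (Y.blk l : ℕ) := by
          simp only [Pot, Y.len, Finset.mul_sum]
          rw [Finset.sum_comm]
          refine Finset.sum_congr rfl fun l _ => ?_
          simp
        rw [h1, act_sum Y]
        simp only [Y.blk_act]
        congr 1
        rw [Finset.sum_comm]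
        refine Finset.sum_congr rfl fun l _ => ?_
        rw [← Finset.mul_sum, hbl, mul_comm]
      have hP2 : Pot (fun i => wd Y.m Y.js (Y.act i) (fun l => (Γ i l : ℕ))) = ∑ i : Fin n, (i:ℕ) + ∑ i : Fin n, ∑ l, (i : ℕ) * (Γ i l : ℕ) := by
        simp only [Pot, hlen, mul_add, mul_one, Finset.sum_add_distrib, Finset.mul_sum]
      rw [hP1, hP2]
      have hle : ∀ i l, (Y.blk l : ℕ) * (Γ i l : ℕ) ≤ (i : ℕ) * (Γ i l : ℕ) := by
        intro i l
        by_cases h : Y.act i ≤ l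
        · rw [hv i l h]; simp
        · exact Nat.mul_le_mul_right _ (Y.blk_le i l (not_le.1 h))
      have hex : ∃ i l, (Γ i l : ℕ) ≠ 0 ∧ Y.blk l ≠ i := by
        by_contra hc
        push Not at hc
        apply hne
        funext i l
        apply Fin.ext
        rw [hΓc]
        have h1 : (Γ (Y.blk l) l : ℕ) = bet Y l := by
          rw [← hbl, Finset.sum_eq_single (Y.blk l)]
          · intro b _ hb
            by_contra h
            exact hb (hc b l h).symm
          · simp
        by_cases h : Y.blk l = i
        · rw [← h, h1, bet]
          simp
        · rw [if_neg (fun h' => h h'.1)]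
          by_contra h'
          exact h (hc i l h')
      obtain ⟨i0, l0, h1, h2⟩ := hex
      refine Nat.add_lt_add_left ?_ _
      refine Finset.sum_lt_sum (fun i _ => Finset.sum_le_sum fun l _ => hle i l) ⟨i0, Finset.mem_univ _, ?_⟩
      refine Finset.sum_lt_sum (fun l _ => hle i0 l) ⟨l0, Finset.mem_univ _, ?_⟩
      refine Nat.mul_lt_mul_of_pos_right ?_ (Nat.pos_of_ne_zero h1)
      have h3 : Y.blk l0 ≤ i0 := by
        refine Y.blk_le i0 l0 (not_le.1 fun h => h1 (hv i0 l0 h))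
      exact Fin.lt_def.1 (lt_of_le_of_ne h3 h2)
  · simp

end SD
end

set_option linter.unusedVariables false
open MeasureTheory Set Metric
open scoped ENNReal NNReal
noncomputable section

lemma detE_comp {n : ℕ} (L : E n →L[ℝ] E n) (v : Fin n → E n) : detE n (fun i => L (v i)) = L.det * detE n v := by
  have h : ∀ v : Fin n → E n, detE n v = (EuclideanSpace.basisFun (Fin n) ℝ).toBasis.det v := by
    intro v
    rw [detE_apply, Module.Basis.det_apply, ← Matrix.det_transpose]
    rfl
  rw [h, h]
  exact (EuclideanSpace.basisFun (Fin n) ℝ).toBasis.det_comp (L : E n →ₗ[ℝ] E n) v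

namespace SD
variable {n k : ℕ} {π : Fin k → E n → E (n-1)} (S : SD n k π)

def Mx {m : ℕ} (js : Fin m → Fin k) (z : E n × (Fin m → ℝ)) : E n →L[ℝ] E n :=
  (fderiv ℝ (S.flm m js) z).comp (ContinuousLinearMap.inl ℝ (E n) (Fin m → ℝ))

lemma Mx_zero {m : ℕ} (js : Fin m → Fin k) : S.Mx js 0 = ContinuousLinearMap.id ℝ (E n) := by
  induction m with
  | zero =>
    have : S.flm 0 js = Prod.fst := rfl
    rw [Mx, this, fderiv_fst]
    ext v; simp
  | succ m ih =>
    have hc : fderiv ℝ (S.flm (m+1) js) 0 = (fderiv ℝ (S.flm m (Fin.tail js)) (S.stp m (js 0) 0)).comp (fderiv ℝ (S.stp m (js 0)) 0) := by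
      have : S.flm (m+1) js = (S.flm m (Fin.tail js)) ∘ (S.stp m (js 0)) := rfl
      rw [this]
      exact fderiv_comp 0 ((S.flm_contDiff m _).differentiable (by simp) _) ((S.stp_contDiff m _).differentiable (by simp) _)
    refine ContinuousLinearMap.ext fun v => ?_
    rw [Mx, hc, S.stp_zero]
    simp only [ContinuousLinearMap.comp_apply, ContinuousLinearMap.inl_apply]
    rw [S.stp_x]
    have h1 := congrArg (fun T => T (fderiv ℝ (S.Ψ (js 0)) (S.Φ (js 0) (0 : E n × (Fin (m+1) → ℝ)).1 + (0 : E n × (Fin (m+1) → ℝ)).2 0 • eH n) (fderiv ℝ (S.Φ (js 0)) (0 : E n × (Fin (m+1) → ℝ)).1 v))) (ih (Fin.tail js))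
    simp only [Mx, ContinuousLinearMap.comp_apply, ContinuousLinearMap.inl_apply] at h1
    rw [h1]
    have h2 := (S.DD_left (js 0)).self_of_nhds v
    simpa using h2

lemma Mx_continuous {m : ℕ} (js : Fin m → Fin k) : Continuous (S.Mx js) := by
  have h1 : Continuous (fderiv ℝ (S.flm m js)) := (S.flm_contDiff m js).continuous_fderiv (by simp)
  exact h1.clm_comp continuous_const

lemma Mx_det {m : ℕ} (js : Fin m → Fin k) : ∀ᶠ z in nhds (0 : E n × (Fin m → ℝ)), 1/2 ≤ |(S.Mx js z).det| := by
  have h1 : Continuous fun z => |(S.Mx js z).det| := (ContinuousLinearMap.continuous_det.comp (S.Mx_continuous js)).abs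
  have h2 : ∀ᶠ z in nhds (0 : E n × (Fin m → ℝ)), 1/2 < |(S.Mx js z).det| := by
    refine (continuousAt_const (y := (1/2:ℝ))).eventually_lt h1.continuousAt ?_
    rw [S.Mx_zero, ContinuousLinearMap.det]
    simp
    norm_num
  filter_upwards [h2] with z hz using hz.le

variable {I : Fin n → List (Fin k)} (Y : Layout I)

def Th (z : E n × (Fin Y.m → ℝ)) : Fin Y.m → ℝ :=
  fun l => if l = Y.act (Y.blk l) then S.flm Y.m Y.js z (Y.blk l) else z.2 l

lemma Th_contDiff : ContDiff ℝ (⊤ : ℕ∞) (S.Th Y) := by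
  rw [contDiff_pi]
  intro l
  by_cases h : l = Y.act (Y.blk l)
  · have : (fun z => S.Th Y z l) = fun z => EuclideanSpace.proj (𝕜 := ℝ) (Y.blk l) (S.flm Y.m Y.js z) := by
      funext z; rw [Th, if_pos h]; rfl
    rw [this]
    exact (EuclideanSpace.proj (𝕜 := ℝ) (Y.blk l)).contDiff.comp (S.flm_contDiff _ _)
  · have : (fun z => S.Th Y z l) = fun z => z.2 l := by
      funext z; rw [Th, if_neg h]
    rw [this]
    exact (contDiff_apply ℝ ℝ l).comp contDiff_snd

lemma Th_fderiv (z v : E n × (Fin Y.m → ℝ)) (l : Fin Y.m) : fderiv ℝ (S.Th Y) z v l =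
    if l = Y.act (Y.blk l) then fderiv ℝ (S.flm Y.m Y.js) z v (Y.blk l) else v.2 l := by
  have h0 : HasFDerivAt (S.Th Y) (fderiv ℝ (S.Th Y) z) z := ((S.Th_contDiff Y).differentiable (by simp) z).hasFDerivAt
  have h1 := (hasFDerivAt_pi'.1 h0) l
  by_cases h : l = Y.act (Y.blk l)
  · have e : (fun z => S.Th Y z l) = fun z => EuclideanSpace.proj (𝕜 := ℝ) (Y.blk l) (S.flm Y.m Y.js z) := by
      funext z; rw [Th, if_pos h]; rfl
    rw [e] at h1
    have h2 : HasFDerivAt (fun z => EuclideanSpace.proj (𝕜 := ℝ) (Y.blk l) (S.flm Y.m Y.js z)) _ z :=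
      (EuclideanSpace.proj (𝕜 := ℝ) (Y.blk l)).hasFDerivAt.comp z ((S.flm_contDiff Y.m Y.js).differentiable (by simp) z).hasFDerivAt
    have h3 := congrArg (fun T => T v) (h1.unique h2)
    rw [if_pos h]
    exact h3
  · have e : (fun z => S.Th Y z l) = fun z => z.2 l := by
      funext z; rw [Th, if_neg h]
    rw [e] at h1
    have h2 : HasFDerivAt (fun z : E n × (Fin Y.m → ℝ) => z.2 l) ((ContinuousLinearMap.proj l).comp (ContinuousLinearMap.snd ℝ (E n) (Fin Y.m → ℝ))) z :=
      ((ContinuousLinearMap.proj l).comp (ContinuousLinearMap.snd ℝ (E n) (Fin Y.m → ℝ))).hasFDerivAt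
    have h3 := congrArg (fun T => T v) (h1.unique h2)
    rw [if_neg h]
    exact h3

lemma Th_det (x : E n) (t : Fin Y.m → ℝ) : (Dt (S.Th Y) x t).det =
    detE n (fun i => fderiv ℝ (S.flm Y.m Y.js) (x, t) (0, Pi.single (Y.act i) 1)) := by
  classical
  rw [ContinuousLinearMap.det, ← LinearMap.det_toMatrix', detE_apply]
  set T := LinearMap.toMatrix' (Dt (S.Th Y) x t : (Fin Y.m → ℝ) →ₗ[ℝ] (Fin Y.m → ℝ)) with hT
  have hTa : ∀ l l', T l l' = if l = Y.act (Y.blk l) then fderiv ℝ (S.flm Y.m Y.js) (x, t) (0, Pi.single l' 1) (Y.blk l) else (Pi.single l' (1:ℝ) : Fin Y.m → ℝ) l := by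
    intro l l'
    rw [hT, LinearMap.toMatrix'_apply]
    exact S.Th_fderiv Y (x, t) (0, Pi.single l' 1) l
  rw [Matrix.twoBlockTriangular_det T (fun l => l = Y.act (Y.blk l))]
  · have e2 : T.toSquareBlockProp (fun l => ¬ l = Y.act (Y.blk l)) = 1 := by
      ext a b
      have := hTa a.1 b.1
      rw [if_neg a.2] at this
      simp only [Matrix.toSquareBlockProp, Matrix.toBlock_apply, this, Pi.single_apply, Matrix.one_apply, Subtype.ext_iff]
    rw [e2, Matrix.det_one, mul_one, ← Matrix.det_transpose]
    let eq : Fin n ≃ {l // l = Y.act (Y.blk l)} :=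
      ⟨fun i => ⟨Y.act i, by rw [Y.blk_act]⟩, fun l => Y.blk l.1, fun i => Y.blk_act i, fun l => Subtype.ext l.2.symm⟩
    rw [← Matrix.det_submatrix_equiv_self eq]
    congr 1
    ext i i'
    simp only [Matrix.submatrix_apply, Matrix.transpose_apply, Matrix.toSquareBlockProp, Matrix.toBlock_apply, hTa, eq, Equiv.coe_fn_mk, Y.blk_act, if_true, Matrix.of_apply]
  · intro a ha b hb
    rw [hTa, if_neg ha, Pi.single_apply, if_neg]
    rintro rfl
    exact ha hb

lemma Th_det_lower : ∀ᶠ z in nhds (0 : E n × (Fin Y.m → ℝ)), 1/2 * |S.Jt Y.js Y.act z| ≤ |(Dt (S.Th Y) z.1 z.2).det| := by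
  filter_upwards [S.flm_pbv Y.m Y.js, S.Mx_det Y.js] with z h1 h2
  rw [S.Th_det]
  have : (fun i => fderiv ℝ (S.flm Y.m Y.js) (z.1, z.2) (0, Pi.single (Y.act i) 1)) = fun i => S.Mx Y.js z (S.pbv Y.m Y.js (Y.act i) z) := by
    funext i
    exact h1 (Y.act i)
  rw [this, detE_comp, abs_mul, Jt]
  gcongr

end SD
end

set_option linter.unusedVariables false
open MeasureTheory Set Metric
open scoped ENNReal NNReal
noncomputable section

lemma one_step {n k : ℕ} (hn : 2 ≤ n) {π : Fin k → E n → E (n-1)} (S : SD n k π) :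
    ∃ U ∈ nhds (0 : E n), ∃ c : ℝ, 0 < c ∧ c ≤ 1 ∧ ∀ (L : ℕ), 2 ≤ L → ∀ (D K i0 : ℕ), 0 < K →
      ∀ j, ∀ Ω ⊆ U, MeasurableSet Ω → ∀ A, MeasurableSet A → MapsTo (π j) Ω A →
      ∀ α : ℝ, 0 < α → ENNReal.ofReal α * volume A ≤ volume Ω →
      ((L:ℝ) ^ (i0 + K))⁻¹ < (1 / (32 * K * (D+1)))^K * (c * α / (8 * (L:ℝ)^i0)) →
      ∃ i, i0 ≤ i ∧ i < i0 + K ∧ ∃ Ω2 ⊆ Ω, MeasurableSet Ω2 ∧ ∃ T : Set (E n × ℝ), MeasurableSet T ∧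
        ENNReal.ofReal (c / (4*K)) * volume Ω ≤ volume Ω2 ∧ ∀ x ∈ Ω2, (∀ t, (x, t) ∈ T → S.phi j t x ∈ Ω) ∧
          Spread D (1 / L) (1 / (L:ℝ)^i) {t | (x, t) ∈ T} ∧
          ENNReal.ofReal (1 / (4*K) * ((1 / (32 * K * (D+1)))^K * (c * α / (8 * (L:ℝ)^i0)))) ≤ volume {t | (x, t) ∈ T} := by
  choose W hW C1 hC10 hC1 using fun j => lip_meas (volume : Measure (HS n)) (volume : Measure (E n)) (finrank_HS hn).symm (S.Ψ j) (S.hΨ j) 0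
  choose V hV C2 hC20 hC2 using fun j => lip_meas (volume : Measure (E n)) (volume : Measure (HS n)) (finrank_HS hn) (S.Φ j) (S.hΦ j) 0
  have hball : ∀ j, ∃ r > 0, ∀ u ∈ ball (0 : HS n) r, u ∈ W j ∧ S.Φ j (S.Ψ j u) = u := by
    intro j
    have := Metric.eventually_nhds_iff_ball.1 ((show ∀ᶠ u in nhds (0 : HS n), u ∈ W j from hW j).and (S.right j))
    exact this
  choose r hr hrb using hball
  let Cs : ℝ := (1 + ∑ j, (C1 j : ℝ)) * (1 + ∑ j, (C2 j : ℝ))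
  have hs1 : 0 ≤ ∑ j, (C1 j : ℝ) := by positivity
  have hs2 : 0 ≤ ∑ j, (C2 j : ℝ) := by positivity
  have hCs : 1 ≤ Cs := by nlinarith
  have hl1 : ∀ j, (C1 j : ℝ) ≤ ∑ j, (C1 j : ℝ) := fun j => Finset.single_le_sum (f := fun j => (C1 j : ℝ)) (fun i _ => by positivity) (Finset.mem_univ j)
  have hl2 : ∀ j, (C2 j : ℝ) ≤ ∑ j, (C2 j : ℝ) := fun j => Finset.single_le_sum (f := fun j => (C2 j : ℝ)) (fun i _ => by positivity) (Finset.mem_univ j)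
  refine ⟨⋂ j, {x | S.Φ j x ∈ ball (0 : HS n) (r j) ∧ S.Ψ j (S.Φ j x) = x ∧ |(S.Φ j x).2| ≤ 1 ∧ x ∈ V j}, ?_, Cs⁻¹, by positivity, inv_le_one_of_one_le₀ hCs, ?_⟩
  · rw [Filter.iInter_mem]
    intro j
    have h1 := (S.tendΦ j).eventually (ball_mem_nhds (0 : HS n) (hr j))
    have h2 : ∀ᶠ x in nhds (0 : E n), |(S.Φ j x).2| < 1 := by
      have : Continuous fun x => |(S.Φ j x).2| := ((S.hΦ j).continuous.snd).abs
      exact this.continuousAt.eventually_lt (continuousAt_const (y := (1:ℝ))) (by simp [S.hΦ0 j])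
    filter_upwards [h1, S.left j, h2, hV j] with x a b c d
    exact ⟨a, b, c.le, d⟩
  intro L hL D K i0 hK j Ω hΩ hΩm A hA hmap α hα hαA hsm
  have hU := fun x hx => mem_iInter.1 (hΩ (a := x) hx) j
  have hLpos : (0:ℝ) < L := by positivity
  have hKpos : (0:ℝ) < K := by positivity
  set B : Set (HS n) := ball 0 (r j) ∩ S.Ψ j ⁻¹' Ω with hBdef
  have hBm : MeasurableSet B := measurableSet_ball.inter ((S.hΨ j).continuous.measurable hΩm)
  have hΦB : S.Φ j '' Ω = B := by
    ext u
    constructor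
    · rintro ⟨x, hx, rfl⟩
      refine ⟨(hU x hx).1, ?_⟩
      show S.Ψ j (S.Φ j x) ∈ Ω
      rw [(hU x hx).2.1]; exact hx
    · rintro ⟨h1, h2⟩
      exact ⟨S.Ψ j u, h2, (hrb j u h1).2⟩
  have hBA : B ⊆ A ×ˢ Icc (-1) 1 := by
    rw [← hΦB]
    rintro _ ⟨x, hx, rfl⟩
    exact ⟨hmap hx, abs_le.1 (hU x hx).2.2.1⟩
  have hBf : volume B ≠ ⊤ := ((measure_mono inter_subset_left).trans_lt measure_ball_lt_top).ne
  have hΩB : ENNReal.ofReal (Cs⁻¹) * volume Ω ≤ ENNReal.ofReal ((1 + ∑ j, (C2 j : ℝ))⁻¹) * volume B := by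
    have h1 : Ω ⊆ S.Ψ j '' B := fun x hx => ⟨_, hΦB ▸ ⟨x, hx, rfl⟩, (hU x hx).2.1⟩
    have h2 : volume Ω ≤ ENNReal.ofReal (C1 j) * volume B := by
      rw [ENNReal.ofReal_coe_nnreal]
      exact (measure_mono h1).trans (hC1 j _ (fun u hu => (hrb j u hu.1).1))
    calc _ ≤ ENNReal.ofReal (Cs⁻¹) * (ENNReal.ofReal (C1 j) * volume B) := by gcongr
      _ = ENNReal.ofReal (Cs⁻¹ * C1 j) * volume B := by
        rw [← mul_assoc, ← ENNReal.ofReal_mul (by positivity)]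
      _ ≤ _ := by
        gcongr
        simp only [Cs]
        rw [mul_inv, mul_comm, ← mul_assoc]
        have : (C1 j : ℝ) * (1 + ∑ j, (C1 j : ℝ))⁻¹ ≤ 1 := by
          rw [← div_eq_mul_inv, div_le_one (by positivity)]; linarith [hl1 j]
        exact mul_le_of_le_one_left (by positivity) this
  have hΩB' : ENNReal.ofReal (Cs⁻¹) * volume Ω ≤ volume B := by
    refine hΩB.trans ?_
    refine mul_le_of_le_one_left zero_le ?_
    rw [ENNReal.ofReal_le_one]
    exact inv_le_one_of_one_le₀ (by linarith)
  have hvol : (volume : Measure (HS n)) = (volume : Measure (E (n-1))).prod (volume : Measure ℝ) := rfl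
  have hL8 : ENNReal.ofReal (8 * (L:ℝ)^i0) = 8 * (L:ℝ≥0∞)^i0 := by
    rw [ENNReal.ofReal_mul (by norm_num), ENNReal.ofReal_pow hLpos.le]; norm_num
  have hkk : ENNReal.ofReal (1 / (4*K)) = (4 * (K:ℝ≥0∞))⁻¹ := by
    rw [one_div, ENNReal.ofReal_inv_of_pos (by positivity), ENNReal.ofReal_mul (by norm_num)]; norm_num
  obtain ⟨i, hi1, hi2, B1, B2, hB1, hB2, hB21, hB1B, hB2v, hsp⟩ := refine_line (volume : Measure (E (n-1))) hL D K i0 hK B hBm A hA hBA hBf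
    (ENNReal.ofReal (Cs⁻¹ * α)) (ENNReal.ofReal (1 / (4*K))) (ENNReal.ofReal (1 / (32 * K * (D+1)))) (ENNReal.ofReal (Cs⁻¹ * α / (8 * (L:ℝ)^i0)))
    (by
      rw [ENNReal.ofReal_mul (by positivity), mul_assoc]
      exact (mul_le_mul_right hαA _).trans hΩB') hkk
    (by
      have : (8 * ((D:ℝ≥0∞) + 1)) = ENNReal.ofReal (8 * (D+1)) := by
        rw [ENNReal.ofReal_mul (by norm_num), ENNReal.ofReal_add (by positivity) (by norm_num)]; norm_num
      rw [this, ← ENNReal.ofReal_mul (by positivity)]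
      congr 1
      field_simp; norm_num)
    (by
      rw [← hL8, ← ENNReal.ofReal_mul (by positivity)]
      congr 1
      field_simp)
    (by
      have : ((L:ℝ≥0∞) ^ (i0 + K))⁻¹ = ENNReal.ofReal (((L:ℝ) ^ (i0 + K))⁻¹) := by
        rw [ENNReal.ofReal_inv_of_pos (by positivity), ENNReal.ofReal_pow hLpos.le]; norm_num
      rw [this, ← ENNReal.ofReal_pow (by positivity), ← ENNReal.ofReal_mul (by positivity)]
      exact (ENNReal.ofReal_lt_ofReal_iff_of_nonneg (by positivity)).2 hsm)
  refine ⟨i, hi1, hi2, Ω ∩ S.Φ j ⁻¹' B2, inter_subset_left, hΩm.inter ((S.hΦ j).continuous.measurable hB2),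
    {z : E n × ℝ | (S.Φ j z.1).2 + z.2 ∈ JJ L i (S.Φ j z.1).2 ∧ ((S.Φ j z.1).1, (S.Φ j z.1).2 + z.2) ∈ B1}, ?_, ?_, ?_⟩
  · have hm : Measurable (S.Φ j) := (S.hΦ j).continuous.measurable
    refine MeasurableSet.inter ?_ ?_
    · exact (show Measurable fun z : E n × ℝ => ((S.Φ j z.1).2, (S.Φ j z.1).2 + z.2) by fun_prop) (JJ_measurable L i)
    · exact ((measurable_fst.comp (hm.comp measurable_fst)).prodMk ((measurable_snd.comp (hm.comp measurable_fst)).add measurable_snd) : Measurable fun z : E n × ℝ => ((S.Φ j z.1).1, (S.Φ j z.1).2 + z.2)) hB1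
  · have h1 : B2 ⊆ S.Φ j '' (Ω ∩ S.Φ j ⁻¹' B2) := by
      intro u hu
      have hu' := hB1B (hB21 hu)
      have e := (hrb j u hu'.1).2
      exact ⟨S.Ψ j u, ⟨hu'.2, by show S.Φ j _ ∈ B2; rw [e]; exact hu⟩, e⟩
    have h2 : volume B2 ≤ ENNReal.ofReal (C2 j) * volume (Ω ∩ S.Φ j ⁻¹' B2) := by
      rw [ENNReal.ofReal_coe_nnreal]
      exact (measure_mono h1).trans (hC2 j _ (fun x hx => (hU x hx.1).2.2.2))
    have e1 : Cs⁻¹ / (4*K) = 1/(4*K) * Cs⁻¹ := by ring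
    rw [e1, ENNReal.ofReal_mul (by positivity), mul_assoc]
    rw [← hvol] at hB2v
    calc _ ≤ ENNReal.ofReal (1/(4*K)) * (ENNReal.ofReal ((1 + ∑ j, (C2 j : ℝ))⁻¹) * volume B) := by gcongr
      _ = ENNReal.ofReal ((1 + ∑ j, (C2 j : ℝ))⁻¹) * (ENNReal.ofReal (1/(4*K)) * volume B) := by ring
      _ ≤ ENNReal.ofReal ((1 + ∑ j, (C2 j : ℝ))⁻¹) * (ENNReal.ofReal (C2 j) * volume (Ω ∩ S.Φ j ⁻¹' B2)) := by
        exact mul_le_mul_right (hB2v.trans h2) _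
      _ = ENNReal.ofReal ((1 + ∑ j, (C2 j : ℝ))⁻¹ * C2 j) * volume (Ω ∩ S.Φ j ⁻¹' B2) := by
        rw [← mul_assoc, ← ENNReal.ofReal_mul (by positivity)]
      _ ≤ _ := by
        refine mul_le_of_le_one_left zero_le ?_
        rw [ENNReal.ofReal_le_one, mul_comm, ← div_eq_mul_inv, div_le_one (by positivity)]
        linarith [hl2 j]
  · intro x hx
    refine ⟨?_, ?_⟩
    · intro t ht
      have h1 := (hB1B ht.2).2
      have e : S.Φ j x + t • ((0 : E (n-1)), (1:ℝ)) = ((S.Φ j x).1, (S.Φ j x).2 + t) := by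
        ext <;> simp
      show S.Ψ j _ ∈ Ω
      rw [e]; exact h1
    · have := hsp (S.Φ j x).1 (S.Φ j x).2 hx.2
      refine ⟨this.1, ?_⟩
      rw [ENNReal.ofReal_mul (by positivity), ENNReal.ofReal_mul (by positivity), ENNReal.ofReal_pow (by positivity)]
      exact this.2

/-- iterated refinement along a path -/
lemma iterate {n k : ℕ} (hn : 2 ≤ n) {π : Fin k → E n → E (n-1)} (S : SD n k π) :
    ∃ U ∈ nhds (0 : E n), ∃ c : ℝ, 0 < c ∧ c ≤ 1 ∧ ∀ (L : ℕ), 2 ≤ L → ∀ (D K i0 M : ℕ), 0 < K →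
      ∀ Ω ⊆ U, MeasurableSet Ω → ∀ A : Fin k → Set (E (n-1)), (∀ j, MeasurableSet (A j)) → (∀ j, MapsTo (π j) Ω (A j)) →
      ∀ (α : Fin k → ℝ) (αs : ℝ), 0 < αs → (∀ j, αs ≤ α j) → (∀ j, ENNReal.ofReal (α j) * volume (A j) ≤ volume Ω) →
      ((L:ℝ) ^ (i0 + K))⁻¹ < (1 / (32 * K * (D+1)))^K * (c * (αs * (c/(4*K))^M) / (8 * (L:ℝ)^i0)) →
      ∀ (m : ℕ), m ≤ M → ∀ (js : Fin m → Fin k), ∃ (idx : Fin m → ℕ) (Aq : Fin (m+1) → Set (E n)) (Sq : Fin m → Set (E n × ℝ)),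
        (∀ i, i0 ≤ idx i ∧ idx i < i0 + K) ∧ Aq (Fin.last m) = Ω ∧ (∀ i, Aq i ⊆ Ω) ∧ MeasurableSet (Aq 0) ∧ (∀ i, MeasurableSet (Sq i)) ∧
        (ENNReal.ofReal (c / (4*K)))^m * volume Ω ≤ volume (Aq 0) ∧
        (∀ i, ∀ x ∈ Aq i.castSucc, (∀ t, (x, t) ∈ Sq i → S.phi (js i) t x ∈ Aq i.succ) ∧
          Spread D (1 / L) (1 / (L:ℝ)^(idx i)) {t | (x, t) ∈ Sq i} ∧
          ENNReal.ofReal (1 / (4*K) * ((1 / (32 * K * (D+1)))^K * (c * (α (js i) * (c/(4*K))^M) / (8 * (L:ℝ)^i0)))) ≤ volume {t | (x, t) ∈ Sq i}) := by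
  obtain ⟨U, hU, c, hc, hc1, H⟩ := one_step hn S
  refine ⟨U, hU, c, hc, hc1, ?_⟩
  intro L hL D K i0 M hK Ω hΩ hΩm A hA hmap α αs hαs hα hαA hsm m
  have hLpos : (0:ℝ) < L := by positivity
  have hKpos : (1:ℝ) ≤ K := by exact_mod_cast hK
  have hρ1 : c / (4*K) ≤ 1 := by rw [div_le_one (by positivity)]; linarith
  induction m with
  | zero =>
    intro _ js
    exact ⟨Fin.elim0, fun _ => Ω, Fin.elim0, fun i => i.elim0, rfl, fun _ => Subset.rfl, hΩm, fun i => i.elim0, by simp, fun i => i.elim0⟩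
  | succ m ih =>
    intro hmM js
    obtain ⟨idx, Aq, Sq, h1, h2, h3, h4, h5, h6, h7⟩ := ih (by omega) (Fin.tail js)
    obtain ⟨i, hi1, hi2, Ω2, hΩ2, hΩ2m, T, hT, hv, hx⟩ := H L hL D K i0 hK (js 0) (Aq 0) ((h3 0).trans hΩ) h4 (A (js 0)) (hA _)
      (fun x hx => hmap _ (h3 0 hx)) (α (js 0) * (c/(4*K))^M) (mul_pos (hαs.trans_le (hα _)) (by positivity))
      (by
        refine le_trans ?_ h6
        rw [mul_comm (α _), ENNReal.ofReal_mul (by positivity), mul_assoc]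
        refine mul_le_mul' ?_ (hαA _)
        rw [← ENNReal.ofReal_pow (by positivity)]
        apply ENNReal.ofReal_le_ofReal
        exact pow_le_pow_of_le_one (by positivity) hρ1 (by omega))
      (by
        refine hsm.trans_le ?_
        have := hα (js 0)
        gcongr)
    refine ⟨Fin.cons i idx, Fin.cons Ω2 Aq, Fin.cons T Sq, ?_, ?_, ?_, ?_, ?_, ?_, ?_⟩
    · intro l
      refine Fin.cases ⟨hi1, hi2⟩ (fun l => ?_) l
      exact h1 l
    · rw [← Fin.succ_last, Fin.cons_succ]; exact h2
    · intro l
      refine Fin.cases ?_ (fun l => ?_) l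
      · exact hΩ2.trans (h3 0)
      · exact h3 l
    · exact hΩ2m
    · intro l
      refine Fin.cases ?_ (fun l => ?_) l
      · exact hT
      · exact h5 l
    · rw [pow_succ', mul_assoc]
      exact (mul_le_mul_right h6 _).trans hv
    · intro l
      refine Fin.cases ?_ (fun l => ?_) l
      · intro x hx'
        exact hx x hx'
      · intro x hx'
        have : x ∈ Aq l.castSucc := by
          rw [← Fin.succ_castSucc] at hx'
          exact hx'
        exact h7 l x this

end

set_option linter.unusedVariables false
open MeasureTheory Set Metric
open scoped ENNReal NNReal
noncomputable section

lemma vol_W {n k : ℕ} {I : Fin n → List (Fin k)} (Y : Layout I) (Ω : Set (E n)) (hΩ : MeasurableSet Ω) (w : Fin Y.m → ℝ) (hw : ∀ l, 0 < w l) :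
    volume {u : Fin Y.m → ℝ | WithLp.toLp 2 (fun i => u (Y.act i)) ∈ Ω ∧ ∀ l, ¬ l = Y.act (Y.blk l) → u l ∈ Icc (-w l) (w l)} ≤
      ENNReal.ofReal (2^Y.m * ∏ l, w l ^ SD.bet Y l) * volume Ω := by
  classical
  let eq : Fin n ≃ {l // l = Y.act (Y.blk l)} :=
      ⟨fun i => ⟨Y.act i, by rw [Y.blk_act]⟩, fun l => Y.blk l.1, fun i => Y.blk_act i, fun l => Subtype.ext l.2.symm⟩
  let W1 : Set ({l // l = Y.act (Y.blk l)} → ℝ) := {v | WithLp.toLp 2 (fun i => v (eq i)) ∈ Ω}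
  let W2 : Set ({l // ¬ l = Y.act (Y.blk l)} → ℝ) := Set.pi univ fun l => Icc (-w l) (w l)
  have hmp : MeasurePreserving (fun v : {l // l = Y.act (Y.blk l)} → ℝ => (WithLp.toLp 2 (fun i => v (eq i)) : E n)) volume volume := by
    have h1 := volume_measurePreserving_piCongrLeft (fun _ : Fin n => ℝ) eq.symm
    have h2 := (PiLp.volume_preserving_toLp (Fin n)).comp h1
    have hfe : (fun v : {l // l = Y.act (Y.blk l)} → ℝ => (WithLp.toLp 2 (fun i => v (eq i)) : E n)) = (@WithLp.toLp 2 (Fin n → ℝ)) ∘ (MeasurableEquiv.piCongrLeft (fun _ : Fin n => ℝ) eq.symm) := ?_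
    · rw [hfe]; exact h2
    funext v
    simp only [Function.comp]
    congr 1
    funext i
    have := MeasurableEquiv.piCongrLeft_apply_apply (β := fun _ : Fin n => ℝ) eq.symm v (eq i)
    simp only [Equiv.symm_apply_apply] at this
    exact this.symm
  have hW1m : MeasurableSet W1 := hmp.measurable hΩ
  have hW1 : volume W1 = volume Ω := hmp.measure_preimage hΩ.nullMeasurableSet
  have hW2m : MeasurableSet W2 := MeasurableSet.univ_pi fun l => measurableSet_Icc
  have e : {u : Fin Y.m → ℝ | WithLp.toLp 2 (fun i => u (Y.act i)) ∈ Ω ∧ ∀ l, ¬ l = Y.act (Y.blk l) → u l ∈ Icc (-w l) (w l)} =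
      MeasurableEquiv.piEquivPiSubtypeProd (fun _ : Fin Y.m => ℝ) (fun l => l = Y.act (Y.blk l)) ⁻¹' (W1 ×ˢ W2) := by
    ext u
    constructor
    · rintro ⟨h1, h2⟩
      exact ⟨h1, fun l _ => h2 l.1 l.2⟩
    · rintro ⟨h1, h2⟩
      exact ⟨h1, fun l hl => h2 ⟨l, hl⟩ trivial⟩
  rw [e, (volume_preserving_piEquivPiSubtypeProd (fun _ : Fin Y.m => ℝ) (fun l => l = Y.act (Y.blk l))).measure_preimage (hW1m.prod hW2m).nullMeasurableSet,
    Measure.volume_eq_prod, Measure.prod_prod, hW1, mul_comm, volume_pi_pi]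
  gcongr
  simp only [Real.volume_Icc]
  rw [← ENNReal.ofReal_prod_of_nonneg (fun l _ => by have := hw l; linarith)]
  apply ENNReal.ofReal_le_ofReal
  have h3 : (2:ℝ)^Y.m = ∏ l : Fin Y.m, 2 := by simp
  rw [h3, ← Finset.prod_mul_distrib]
  rw [← Fintype.prod_subtype_mul_prod_subtype (fun l => l = Y.act (Y.blk l)) (fun l => 2 * w l ^ SD.bet Y l)]
  have h4 : ∀ l : {l // ¬ l = Y.act (Y.blk l)}, w l - - w l = 2 * w l ^ SD.bet Y l := by
    intro l
    rw [SD.bet, if_neg l.2]; ring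
  rw [Finset.prod_congr rfl (fun l _ => h4 l)]
  refine le_mul_of_one_le_left (Finset.prod_nonneg fun l _ => by have := hw l; positivity) ?_
  have h5 : ∀ l : {l // l = Y.act (Y.blk l)}, 2 * w l ^ SD.bet Y l = 2 := by
    intro l
    rw [SD.bet, if_pos l.2]; ring
  rw [Finset.prod_congr rfl (fun l _ => h5 l), Finset.prod_const]
  exact one_le_pow₀ (by norm_num)

namespace SD
variable {n k : ℕ} {π : Fin k → E n → E (n-1)} (S : SD n k π)

lemma tree_flm (m : ℕ) : ∀ (js : Fin m → Fin k) (Aq : Fin (m+1) → Set (E n)) (Sq : Fin m → Set (E n × ℝ))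
    (w : Fin m → ℝ) (hA : ∀ i, ∀ x ∈ Aq i.castSucc, (∀ t, (x, t) ∈ Sq i → S.phi (js i) t x ∈ Aq i.succ) ∧ {t | (x, t) ∈ Sq i} ⊆ Icc (-w i) (w i))
    (x : E n) (hx : x ∈ Aq 0) (t : Fin m → ℝ) (ht : t ∈ TTree m Sq (fun i => S.phi (js i)) x),
    S.flm m js (x, t) ∈ Aq (Fin.last m) ∧ ∀ l, t l ∈ Icc (-w l) (w l) := by
  induction m with
  | zero =>
    intro js Aq Sq w hA x hx t ht
    exact ⟨hx, fun l => l.elim0⟩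
  | succ m ih =>
    intro js Aq Sq w hA x hx t ht
    have h1 := hA 0 x hx
    have h2 := ih (Fin.tail js) (Fin.tail Aq) (Fin.tail Sq) (Fin.tail w) (fun i => hA i.succ) (S.phi (js 0) (t 0) x) (h1.1 _ ht.1) (Fin.tail t) ht.2
    refine ⟨h2.1, fun l => ?_⟩
    refine Fin.cases ?_ (fun l => ?_) l
    · exact h1.2 ht.1
    · exact h2.2 l

variable {I : Fin n → List (Fin k)}

lemma core (hn : 2 ≤ n) (hl : lam S.Xt I 0 ≠ 0)
    (hmax : ∀ I'' : Fin n → List (Fin k), (∀ i, I'' i ≠ []) → degI I'' = degI I → Pot I < Pot I'' → lam S.Xt I'' 0 = 0)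
    (Y : Layout I) (N : ℕ) (hN : 2 ≤ N) (R : ℕ) (hR : 1 ≤ R) :
    ∃ U ∈ nhds (0 : E n), ∃ r1 : ℝ, 0 < r1 ∧ ∃ κ : ℝ, 0 < κ ∧ ∃ C : ℝ, 0 ≤ C ∧ ∀ x ∈ U, ∀ (r η : ℝ) (w : Fin Y.m → ℝ),
      0 < r → r ≤ r1 → 0 < η → (∀ l, 0 < w l ∧ w l ≤ r) →
      C * r ^ N ≤ 1/2 * (η * (κ * ∏ l, w l ^ bet Y l)) → r ^ R ≤ 1/4 * (η * (κ * ∏ l, w l ^ bet Y l)) →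
      ∀ (G : Set (Fin Y.m → ℝ)) (Ω : Set (E n)), MeasurableSet G → MeasurableSet Ω →
      (∀ t ∈ G, S.flm Y.m Y.js (x, t) ∈ Ω ∧ (∀ l, t l ∈ Icc (-w l) (w l)) ∧
        η * (|∑ Γ : Fin n → Fin Y.m → Fin N, if (fun l => ∑ i, (Γ i l : ℕ)) = bet Y then S.kap Y.js Y.act x Γ else 0| * ∏ l, w l ^ bet Y l) ≤
          |∑ Γ : Fin n → Fin Y.m → Fin N, S.kap Y.js Y.act x Γ * ∏ l, t l ^ (∑ i, (Γ i l : ℕ))|) →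
      ENNReal.ofReal (1/4 * (η * κ)) * volume G ≤ ENNReal.ofReal ((2 * (R+1))^Y.m * 2^Y.m) * volume Ω := by
  classical
  have hm : 0 < Y.m := (Y.act ⟨0, by omega⟩).pos
  obtain ⟨r0, hr0, hmb⟩ := mult_bound hm (S.Th Y) (S.Th_contDiff Y) R hR
  obtain ⟨C, hC, hJ⟩ := S.Jt_taylor N (by omega) Y.js Y.act
  set co : E n → ℝ := fun x => |∑ Γ : Fin n → Fin Y.m → Fin N, if (fun l => ∑ i, (Γ i l : ℕ)) = bet Y then S.kap Y.js Y.act x Γ else 0| with hco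
  have hco0 : 0 < co 0 := abs_pos.2 (S.coef_ne hl hmax Y N hN)
  have hcoc : Continuous co := by
    refine (continuous_finset_sum _ fun Γ _ => ?_).abs
    split_ifs
    · exact S.kap_continuous Y.js Y.act Γ
    · exact continuous_const
  obtain ⟨ρ, hρ, hball⟩ := Metric.eventually_nhds_iff_ball.1 (hJ.and (S.Th_det_lower Y))
  have hev : ∀ᶠ x in nhds (0 : E n), co 0 / 2 < co x :=
    (continuousAt_const (y := co 0 / 2)).eventually_lt hcoc.continuousAt (by linarith)
  refine ⟨{x | co 0 / 2 < co x} ∩ (ball 0 ρ ∩ ball 0 1), Filter.inter_mem hev (Filter.inter_mem (ball_mem_nhds _ hρ) (ball_mem_nhds _ one_pos)), min r0 (ρ/2), by positivity, co 0 / 2, by positivity, C, hC, ?_⟩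
  rintro x ⟨hx1, hx2, hx3⟩ r η w hr hr1 hη hw h1 h2 G Ω hG hΩ hGt
  have hP : 0 < ∏ l, w l ^ bet Y l := Finset.prod_pos fun l _ => pow_pos (hw l).1 _
  set δ := 1/4 * (η * (co 0 / 2 * ∏ l, w l ^ bet Y l)) with hδ
  have hδ0 : 0 < δ := by positivity
  have hnorm : ∀ t ∈ G, ‖t‖ ≤ r := fun t ht => by
    rw [pi_norm_le_iff_of_nonneg hr.le]
    intro l
    rw [Real.norm_eq_abs]
    exact (abs_le.2 ((hGt t ht).2.1 l)).trans (hw l).2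
  have hdet : ∀ t ∈ G, δ ≤ |(Dt (S.Th Y) x t).det| := by
    intro t ht
    have hz : (x, t) ∈ ball (0 : E n × (Fin Y.m → ℝ)) ρ := by
      rw [mem_ball_zero_iff, Prod.norm_def, max_lt_iff]
      refine ⟨mem_ball_zero_iff.1 hx2, ?_⟩
      have := (hnorm t ht).trans (hr1.trans (min_le_right _ _))
      show ‖t‖ < ρ
      linarith
    obtain ⟨hJ', hD⟩ := hball _ hz
    refine le_trans ?_ hD
    have h3 := (hGt t ht).2.2
    have h4 : C * ‖t‖^N ≤ C * r^N := by
      have := hnorm t ht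
      gcongr
    have h5 : η * (co 0 / 2 * ∏ l, w l ^ bet Y l) ≤ η * (co x * ∏ l, w l ^ bet Y l) := by
      have : co 0 / 2 ≤ co x := le_of_lt hx1
      gcongr
    have h6 := abs_sub_abs_le_abs_sub (∑ Γ : Fin n → Fin Y.m → Fin N, S.kap Y.js Y.act x Γ * ∏ l, t l ^ (∑ i, (Γ i l : ℕ))) (S.Jt Y.js Y.act (x, t))
    rw [abs_sub_comm] at hJ'
    simp only at hJ'
    simp only [hco] at h5 h1 ⊢
    simp only [hδ, hco]
    linarith
  have hA := area_mult hm (fun t => S.Th Y (x, t)) (fun t => Dt (S.Th Y) x t) (fun t => hasFDerivAt_Dt _ (S.Th_contDiff Y) x t) G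
    {u : Fin Y.m → ℝ | WithLp.toLp 2 (fun i => u (Y.act i)) ∈ Ω ∧ ∀ l, ¬ l = Y.act (Y.blk l) → u l ∈ Icc (-w l) (w l)} hG
    (by
      intro t ht
      refine ⟨?_, ?_⟩
      · have : WithLp.toLp 2 (fun i => S.Th Y (x, t) (Y.act i)) = S.flm Y.m Y.js (x, t) := by
          ext i
          show S.Th Y (x, t) (Y.act i) = _
          rw [Th, Y.blk_act, if_pos rfl]
        rw [this]; exact (hGt t ht).1
      · intro l hl
        show S.Th Y (x, t) l ∈ _
        rw [Th, if_neg hl]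
        exact (hGt t ht).2.1 l)
    (fun t ht h0 => by
      have := hdet t ht
      rw [h0, abs_zero] at this
      linarith)
    ((2 * (R+1))^Y.m)
    (fun u Z hZ => hmb x r (mem_ball_zero_iff.1 hx3).le hr (hr1.trans (min_le_left _ _)) u Z (fun z hz =>
      ⟨hnorm z (hZ z hz).1, (hZ z hz).2, h2.trans (hdet z (hZ z hz).1)⟩))
  have hB : ENNReal.ofReal δ * volume G ≤ ∫⁻ t in G, ENNReal.ofReal |(Dt (S.Th Y) x t).det| := by
    rw [← setLIntegral_const]
    exact setLIntegral_mono' hG fun t ht => ENNReal.ofReal_le_ofReal (hdet t ht)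
  have hW := vol_W Y Ω hΩ w (fun l => (hw l).1)
  set P := ∏ l, w l ^ bet Y l with hPdef
  have hfin : ENNReal.ofReal P * (ENNReal.ofReal (1/4 * (η * (co 0 / 2))) * volume G) ≤
      ENNReal.ofReal P * (ENNReal.ofReal ((2 * (R+1))^Y.m * 2^Y.m) * volume Ω) := by
    calc _ = ENNReal.ofReal δ * volume G := by
          rw [← mul_assoc, ← ENNReal.ofReal_mul hP.le]; congr 2; rw [hδ]; ring
      _ ≤ _ := hB
      _ ≤ _ := hA
      _ ≤ ((2 * (R+1))^Y.m : ℕ) * (ENNReal.ofReal (2^Y.m * P) * volume Ω) := by gcongr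
      _ = _ := by
        rw [← ENNReal.ofReal_natCast, ← mul_assoc, ← mul_assoc, ← ENNReal.ofReal_mul (by positivity), ← ENNReal.ofReal_mul hP.le]
        congr 2
        push_cast; ring
  exact (ENNReal.mul_le_mul_iff_right (by simpa using hP) ENNReal.ofReal_ne_top).1 hfin

end SD
end

set_option linter.unusedVariables false
open MeasureTheory Set Metric
open scoped ENNReal NNReal
noncomputable section

lemma params (n m : ℕ) (hn : 1 ≤ n) (hm : 1 ≤ m) (ε : ℝ) (hε : 0 < ε) :
    ∃ i0 M N : ℕ, 1 ≤ i0 ∧ 1 ≤ M ∧ 2 ≤ N ∧ n*N*m + (i0 + (M+1))*m + 1 ≤ i0*N ∧ (((n*N + i0)*m : ℕ) : ℝ) ≤ ε * M := by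
  obtain ⟨Q0, hQ0⟩ := exists_nat_ge (4*n*m^2/ε)
  obtain ⟨Q, hQ, hQ1⟩ : ∃ Q : ℕ, 4*n*m^2/ε ≤ Q ∧ 1 ≤ Q := ⟨Q0 + 1, by push_cast; linarith, by omega⟩
  have hQp : (1:ℝ) ≤ Q := by exact_mod_cast hQ1
  set i0 := n*m + Q with hi0
  set A : ℝ := n*m*((i0+1)*m+1) + 2*n*m + i0*m with hA
  obtain ⟨M0, hM0⟩ := exists_nat_ge (4*A/ε)
  set M := M0 + 1 with hM
  have hMA : 4*A ≤ ε * M := by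
    rw [div_le_iff₀ hε] at hM0
    rw [hM]; push_cast; nlinarith
  set N := ((i0+(M+1))*m+1)/Q + 2 with hN
  have hNQ : (i0+(M+1))*m+1 ≤ N*Q := by
    have := Nat.lt_div_mul_add (a := (i0+(M+1))*m+1) (b := Q) (by omega)
    rw [hN]; nlinarith
  have hNle : (N:ℝ) ≤ (((i0+(M+1))*m+1 : ℕ) : ℝ)/Q + 2 := by
    rw [hN]; push_cast
    have := @Nat.cast_div_le ℝ _ _ _ ((i0+(M+1))*m+1) Q
    push_cast at this
    linarith
  refine ⟨i0, M, N, by omega, by omega, Nat.le_add_left _ _, ?_, ?_⟩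
  · rw [hi0]; nlinarith
  · push_cast
    push_cast at hNle
    rw [div_le_iff₀ hε] at hQ
    have hnm : (0:ℝ) ≤ n*m := by positivity
    have h1 : (n:ℝ)*m*N ≤ n*m*(((i0+(M+1))*m+1)/Q + 2) := mul_le_mul_of_nonneg_left hNle hnm
    have h2 : (n:ℝ)*m*(((i0+(M+1))*m+1)/Q + 2) = (n*m^2*M)/Q + (n*m*((i0+1)*m+1))/Q + 2*n*m := by
      field_simp; ring
    have h3 : ((n:ℝ)*m^2*M)/Q ≤ ε*M/4 := by
      rw [div_le_iff₀ (by linarith)]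
      have : (0:ℝ) ≤ M := by positivity
      nlinarith
    have h4 : ((n:ℝ)*m*((i0+1)*m+1))/Q ≤ n*m*((i0+1)*m+1) := div_le_self (by positivity) hQp
    have h5 : 0 ≤ ε*M := by positivity
    nlinarith

lemma choose_L (M : ℕ) (hM : 1 ≤ M) (L0 : ℝ) (hL0 : 1 ≤ L0) (a : ℝ) (ha : 0 < a) (ha1 : a ≤ (L0^M)⁻¹) :
    ∃ L : ℕ, L0 ≤ L ∧ ((L:ℝ)^M)⁻¹ ≤ a ∧ ∀ p : ℕ, ∀ ε : ℝ, (p:ℝ) ≤ ε * M → (2^p)⁻¹ * a^ε ≤ ((L:ℝ)^p)⁻¹ := by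
  have hMp : (0:ℝ) < M := by exact_mod_cast hM
  have ha1' : a ≤ 1 := ha1.trans (inv_le_one_of_one_le₀ (one_le_pow₀ hL0))
  set y : ℝ := a ^ (-(1/(M:ℝ))) with hy
  have hyp : ∀ p : ℕ, y^p = a ^ (-((p:ℝ)/M)) := by
    intro p
    rw [hy, ← Real.rpow_natCast, ← Real.rpow_mul ha.le]; congr 1; ring
  have hyM : y^M = a⁻¹ := by
    rw [hyp, div_self hMp.ne', Real.rpow_neg_one]
  have hy0 : 0 < y := Real.rpow_pos_of_pos ha _
  have hyL : L0 ≤ y := by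
    have : L0^M ≤ y^M := by
      rw [hyM]; exact (le_inv_comm₀ ha (by positivity)).1 ha1
    exact le_of_pow_le_pow_left₀ (by omega) hy0.le this
  refine ⟨⌈y⌉₊, hyL.trans (Nat.le_ceil y), ?_, ?_⟩
  · rw [inv_le_comm₀ (by have := Nat.le_ceil y; positivity) ha, ← hyM]
    exact pow_le_pow_left₀ hy0.le (Nat.le_ceil y) M
  · intro p ε hp
    have h1 : ((⌈y⌉₊ : ℕ) : ℝ) ≤ 2*y := by
      have := Nat.ceil_lt_add_one hy0.le
      linarith
    have hpos : (0:ℝ) < ⌈y⌉₊ := hy0.trans_le (Nat.le_ceil y)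
    have h2 : ((⌈y⌉₊ : ℕ) : ℝ)^p ≤ 2^p * y^p := by
      rw [← mul_pow]; exact pow_le_pow_left₀ hpos.le h1 p
    have h3 : a^ε ≤ (y^p)⁻¹ := by
      rw [hyp, Real.rpow_neg ha.le, inv_inv]
      apply Real.rpow_le_rpow_of_exponent_ge ha ha1'
      rw [div_le_iff₀ hMp]; exact hp
    calc (2^p)⁻¹ * a^ε ≤ (2^p)⁻¹ * (y^p)⁻¹ := by gcongr
      _ = (2^p * y^p)⁻¹ := by rw [mul_inv]
      _ ≤ _ := inv_anti₀ (by positivity) h2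

lemma prod_js {n k : ℕ} {I : Fin n → List (Fin k)} (Y : Layout I) (α : Fin k → ℝ) :
    ∏ l, α (Y.js l) = ∏ j, α j ^ (degI I j : ℝ) := by
  classical
  have h : ∀ l, α (Y.js l) = ∏ j, α j ^ (if Y.js l = j then 1 else 0) := by
    intro l
    rw [Finset.prod_eq_single (Y.js l)] <;> simp +contextual [eq_comm]
  rw [Finset.prod_congr rfl (fun l _ => h l), Finset.prod_comm]
  refine Finset.prod_congr rfl fun j _ => ?_
  rw [Finset.prod_pow_eq_pow_sum, Real.rpow_natCast, Y.count]

set_option maxHeartbeats 2000000 in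
lemma QP_layout {n k : ℕ} (hn : 2 ≤ n) {π : Fin k → E n → E (n-1)} (S : SD n k π) {I : Fin n → List (Fin k)} (hl : lam S.Xt I 0 ≠ 0)
    (hmax : ∀ I'' : Fin n → List (Fin k), (∀ i, I'' i ≠ []) → degI I'' = degI I → Pot I < Pot I'' → lam S.Xt I'' 0 = 0)
    (Y : Layout I) : QP π (fun j => (degI I j : ℝ)) := by
  intro ε hε
  have hm : 1 ≤ Y.m := (Y.act ⟨0, by omega⟩).pos
  obtain ⟨i0, M, N, hi0, hM, hN, hpar, hparε⟩ := params n Y.m (by omega) hm ε hε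
  obtain ⟨U1, hU1, c, hc, hc1, hit⟩ := iterate hn S
  obtain ⟨U2, hU2, r1, hr1, κ, hκ, C, hC, hcore⟩ := S.core hn hl hmax Y N hN N (by omega)
  set m := Y.m with hmdef
  set D := n*N with hD
  set K := M+1 with hK
  set ρ : ℝ := c / (4*K) with hρ
  have hρ0 : 0 < ρ := by positivity
  set c1 : ℝ := (1 / (32 * K * (D+1)))^K with hc1d
  have hc10 : 0 < c1 := by positivity
  set c5 : ℝ := c1 * (c * ρ^m / 8) with hc5
  have hc50 : 0 < c5 := by positivity
  have hcP := cPoly_pos D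
  set c2 : ℝ := cPoly D ^ m * κ with hc2
  have hc20 : 0 < c2 := by positivity
  set c6 : ℝ := 1/(4*K) * c5 / 2 with hc6
  have hc60 : 0 < c6 := by positivity
  set Cst : ℝ := (2 * (N+1))^m * 2^m with hCst
  have hCst0 : 0 < Cst := by positivity
  set p := (D + i0) * m with hp
  set L0 : ℝ := 2 + 1/c5 + 1/r1 + 2*C/c2 + 4/c2 with hL0
  have hL02 : 2 ≤ L0 := by
    have : 0 ≤ 1/c5 + 1/r1 + 2*C/c2 + 4/c2 := by positivity
    linarith
  set α0 : ℝ := (L0^M)⁻¹ with hα0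
  have hα00 : 0 < α0 := by positivity
  have hα01 : α0 ≤ 1 := inv_le_one_of_one_le₀ (one_le_pow₀ (by linarith))
  refine ⟨U1 ∩ (U2 ∩ ball 0 1), Filter.inter_mem hU1 (Filter.inter_mem hU2 (ball_mem_nhds _ one_pos)),
    1/4 * c2 * c6^m / Cst * ((2^p)⁻¹ * α0^ε), by positivity, ?_⟩
  intro Ω hΩ hΩm hΩ0 A hA hmap α αs hαs hαsα hα1 hαA
  have hfinΩ : volume Ω ≠ ⊤ := ((measure_mono (fun x hx => (hΩ hx).2.2)).trans_lt measure_ball_lt_top).ne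
  have hαs1 : αs ≤ 1 := (hαsα (Y.js ⟨0, hm⟩)).trans (hα1 _)
  set β := min αs α0 with hβ
  have hβ0 : 0 < β := lt_min hαs hα00
  obtain ⟨L, hLL0, hLM, hLp⟩ := choose_L M hM L0 (by linarith) β hβ0 (min_le_right _ _)
  have hLr : (2:ℝ) ≤ L := hL02.trans hLL0
  have hL2 : 2 ≤ L := by exact_mod_cast hLr
  have hLpos : (0:ℝ) < L := by linarith
  have q1 : 0 ≤ 1/c5 := by positivity
  have q2 : 0 ≤ 1/r1 := by positivity
  have q3 : 0 ≤ 2*C/c2 := by positivity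
  have q4 : 0 ≤ 4/c2 := by positivity
  have hLc5 : 1/(L:ℝ) < c5 := by
    rw [div_lt_comm₀ hLpos hc50]; linarith
  have hLr1 : 1/(L:ℝ) ≤ r1 := by
    rw [div_le_comm₀ hLpos hr1]; linarith
  have hLC : 2*C ≤ L * c2 := by
    rw [← div_le_iff₀ hc20]; linarith
  have hL4 : 4 ≤ L * c2 := by
    rw [← div_le_iff₀ hc20]; linarith
  obtain ⟨idx, Aq, Sq, hidx, hlast, hAΩ, hA0m, hSqm, hA0v, hstep⟩ := hit L hL2 D K i0 m (by omega) Ω (fun x hx => (hΩ hx).1) hΩm A hA hmap α β hβ0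
    (fun j => (min_le_left _ _).trans (hαsα j)) hαA
    (by
      have e1 : c1 * (c * (β * ρ^m) / (8 * (L:ℝ)^i0)) = c5 * β * ((L:ℝ)^i0)⁻¹ := by
        rw [hc5]; field_simp
      rw [e1]
      have e2 : ((L:ℝ)^(i0 + K))⁻¹ = (1/L) * ((L:ℝ)^M)⁻¹ * ((L:ℝ)^i0)⁻¹ := by
        rw [hK, ← add_assoc, pow_succ, pow_add]; field_simp
      rw [e2]
      have : (1/(L:ℝ)) * ((L:ℝ)^M)⁻¹ < c5 * β := mul_lt_mul hLc5 hLM (by positivity) hc50.le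
      gcongr) m le_rfl Y.js
  have hA0 : 0 < volume (Aq 0) := lt_of_lt_of_le (ENNReal.mul_pos (pow_ne_zero _ (by simpa using hρ0)) hΩ0.ne') hA0v
  obtain ⟨x, hx⟩ := nonempty_of_measure_ne_zero hA0.ne'
  set w : Fin m → ℝ := fun l => 1 / (L:ℝ)^(idx l) with hw
  have hw0 : ∀ l, 0 < w l := fun l => by positivity
  set η : ℝ := (cPoly D * (1/(L:ℝ))^D)^m with hη
  have hη0 : 0 < η := by positivity
  set r : ℝ := 1 / (L:ℝ)^i0 with hr
  have hwr : ∀ l, w l ≤ r := fun l =>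
    one_div_le_one_div_of_le (by positivity) (pow_le_pow_right₀ (by linarith) (hidx l).1)
  have hrr1 : r ≤ r1 := by
    refine le_trans ?_ hLr1
    rw [hr]
    refine one_div_le_one_div_of_le hLpos ?_
    calc (L:ℝ) = (L:ℝ)^1 := (pow_one _).symm
      _ ≤ _ := pow_le_pow_right₀ (by linarith) hi0
  have hPw : ((L:ℝ)^((i0+K)*m))⁻¹ ≤ ∏ l, w l ^ SD.bet Y l := by
    have h1 : ∀ l : Fin m, ((L:ℝ)^(i0+K))⁻¹ ≤ w l ^ SD.bet Y l := by
      intro l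
      unfold SD.bet
      split_ifs
      · rw [pow_zero]; exact inv_le_one_of_one_le₀ (one_le_pow₀ (by linarith))
      · rw [pow_one]; simp only [hw]; rw [one_div]
        exact inv_anti₀ (by positivity) (pow_le_pow_right₀ (by linarith) (hidx l).2.le)
    calc _ = ∏ l : Fin m, ((L:ℝ)^(i0+K))⁻¹ := by
          rw [Finset.prod_const, Finset.card_univ, Fintype.card_fin, pow_mul, inv_pow]
      _ ≤ _ := Finset.prod_le_prod (fun l _ => by positivity) (fun l _ => h1 l)
  have hηκ : η * κ = c2 * ((L:ℝ)^(D*m))⁻¹ := by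
    rw [hη, hc2, mul_pow, ← pow_mul, one_div, inv_pow]; ring
  have hrN : (L:ℝ) * r^N ≤ ((L:ℝ)^(D*m))⁻¹ * ((L:ℝ)^((i0+K)*m))⁻¹ := by
    rw [hr, one_div, inv_pow, ← pow_mul, ← mul_inv, ← pow_add, ← div_eq_mul_inv, div_le_iff₀ (by positivity), inv_mul_eq_div, le_div_iff₀ (by positivity), ← pow_succ']
    refine pow_le_pow_right₀ (by linarith) ?_
    exact hpar
  have hkey : L * c2 * r^N ≤ η * (κ * ∏ l, w l ^ SD.bet Y l) := by
    rw [← mul_assoc η, hηκ]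
    calc L * c2 * r^N = c2 * (L * r^N) := by ring
      _ ≤ c2 * (((L:ℝ)^(D*m))⁻¹ * ((L:ℝ)^((i0+K)*m))⁻¹) := by gcongr
      _ = c2 * ((L:ℝ)^(D*m))⁻¹ * ((L:ℝ)^((i0+K)*m))⁻¹ := by ring
      _ ≤ _ := by gcongr
  have hrN0 : 0 ≤ r^N := by positivity
  have hφ : ∀ i, Measurable fun z : ℝ × E n => S.phi (Y.js i) z.1 z.2 := fun i =>
    ((S.phi_contDiff (Y.js i)).continuous.comp continuous_swap).measurable
  set aa : Fin m → ℝ≥0∞ := fun i => ENNReal.ofReal (1 / (4*K) * (c1 * (c * (α (Y.js i) * ρ^m) / (8 * (L:ℝ)^i0)))) with haa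
  set G : Set (Fin m → ℝ) := {t | t ∈ TTree m Sq (fun i => S.phi (Y.js i)) x ∧
      (cPoly D * (1/(L:ℝ)) ^ D) ^ m * (|∑ Γ : Fin n → Fin m → Fin N, if (fun l => ∑ i, (Γ i l : ℕ)) = SD.bet Y then S.kap Y.js Y.act x Γ else 0| * ∏ l, w l ^ SD.bet Y l) ≤
        |∑ Γ : Fin n → Fin m → Fin N, S.kap Y.js Y.act x Γ * ∏ l, t l ^ (∑ i, (Γ i l : ℕ))|} with hG
  have htree : ∏ i, (aa i / 2) ≤ volume G :=
    tree_main (ι := Fin n → Fin m → Fin N) D (1/(L:ℝ)) (by positivity) m Sq (fun i => S.phi (Y.js i)) Aq w aa hSqm hφ hw0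
      (fun i x hx => (hstep i x hx).1) (fun i x hx => (hstep i x hx).2.1) (fun i x hx => (hstep i x hx).2.2)
      (fun Γ => S.kap Y.js Y.act x Γ) (fun Γ l => ∑ i, (Γ i l : ℕ))
      (fun Γ l => by
        calc ∑ i, (Γ i l : ℕ) ≤ ∑ i : Fin n, N := Finset.sum_le_sum fun i _ => (Γ i l).2.le
          _ = D := by simp [hD]) (SD.bet Y) x hx
  have hGm : MeasurableSet G := by
    have g1 : MeasurableSet {t | t ∈ TTree m Sq (fun i => S.phi (Y.js i)) x} :=
      (measurable_prodMk_left (x := x)) (tree_meas m Sq (fun i => S.phi (Y.js i)) hSqm hφ)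
    have g2 : Continuous fun t : Fin m → ℝ => |∑ Γ : Fin n → Fin m → Fin N, S.kap Y.js Y.act x Γ * ∏ l, t l ^ (∑ i, (Γ i l : ℕ))| := by
      fun_prop
    exact g1.inter (measurableSet_le measurable_const g2.measurable)
  have hfin := hcore x (hΩ (hAΩ 0 hx)).2.1 r η w (by positivity) hrr1 hη0 (fun l => ⟨hw0 l, hwr l⟩)
    (by nlinarith) (by nlinarith) G Ω hGm hΩm
    (by
      intro t ht
      have := S.tree_flm m Y.js Aq Sq w (fun i x hx => ⟨(hstep i x hx).1, (hstep i x hx).2.1.sub⟩) x hx t ht.1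
      exact ⟨hlast ▸ this.1, this.2, ht.2⟩)
  have hα0' : ∀ j, 0 < α j := fun j => hαs.trans_le (hαsα j)
  have haa2 : ∏ i, (aa i / 2) = ENNReal.ofReal (c6^m * ((L:ℝ)^(i0*m))⁻¹ * ∏ l, α (Y.js l)) := by
    have h1 : ∀ i, aa i / 2 = ENNReal.ofReal (c6 * ((L:ℝ)^i0)⁻¹ * α (Y.js i)) := by
      intro i
      have : (2:ℝ≥0∞) = ENNReal.ofReal 2 := by norm_num
      simp only [haa]
      rw [this, ← ENNReal.ofReal_div_of_pos (by norm_num)]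
      congr 1
      rw [hc6, hc5]; field_simp
    rw [Finset.prod_congr rfl (fun i _ => h1 i), ← ENNReal.ofReal_prod_of_nonneg (fun i _ => by have := hα0' (Y.js i); positivity)]
    congr 1
    rw [Finset.prod_mul_distrib, Finset.prod_const, Finset.card_univ, Fintype.card_fin, mul_pow, inv_pow, ← pow_mul]
  have hPα : 0 < ∏ l, α (Y.js l) := Finset.prod_pos fun l _ => hα0' _
  have hreal : 1/4 * (η * κ) * (c6^m * ((L:ℝ)^(i0*m))⁻¹ * ∏ l, α (Y.js l)) ≤ Cst * (volume Ω).toReal := by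
    have h1 : ENNReal.ofReal (1/4 * (η * κ) * (c6^m * ((L:ℝ)^(i0*m))⁻¹ * ∏ l, α (Y.js l))) ≤ ENNReal.ofReal (Cst * (volume Ω).toReal) := by
      rw [ENNReal.ofReal_mul (by positivity), ENNReal.ofReal_mul hCst0.le, ENNReal.ofReal_toReal hfinΩ, ← haa2]
      exact (mul_le_mul_right htree _).trans hfin
    exact (ENNReal.ofReal_le_ofReal_iff (by positivity)).1 h1
  rw [hηκ] at hreal
  have hLpp := hLp p ε hparε
  have hpw : ((L:ℝ)^p)⁻¹ = ((L:ℝ)^(D*m))⁻¹ * ((L:ℝ)^(i0*m))⁻¹ := by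
    rw [hp, add_mul, pow_add, mul_inv]
  have hββ : α0^ε * αs^ε ≤ β^ε := by
    rw [← Real.mul_rpow hα00.le hαs.le]
    refine Real.rpow_le_rpow (by positivity) ?_ hε.le
    refine le_min ?_ ?_
    · exact mul_le_of_le_one_left hαs.le hα01
    · exact mul_le_of_le_one_right hα00.le hαs1
  rw [← prod_js Y α]
  have hz : 1/4 * c2 * c6^m * ((2^p)⁻¹ * (α0^ε * αs^ε)) * ∏ l, α (Y.js l) ≤ Cst * (volume Ω).toReal := by
    refine le_trans ?_ hreal
    calc _ ≤ 1/4 * c2 * c6^m * (((L:ℝ)^p)⁻¹) * ∏ l, α (Y.js l) := by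
          have : (2^p)⁻¹ * (α0^ε * αs^ε) ≤ ((L:ℝ)^p)⁻¹ := le_trans (by gcongr) hLpp
          gcongr
      _ = _ := by rw [hpw]; ring
  calc _ = (1/4 * c2 * c6^m * ((2^p)⁻¹ * (α0^ε * αs^ε)) * ∏ l, α (Y.js l)) / Cst := by ring
    _ ≤ _ := by rw [div_le_iff₀ hCst0]; linarith

end

/-- **Theorem 3.** If `p ∈ [1,∞]^k` with `∑ 1/p_j > 1` and `b(p)` lies in the
interior of the Newton polytope `P`, then, provided the support of `a` is contained in a
sufficiently small neighborhood of `0`, `S` is of strong type `(p_1,…,p_k)`. -/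
theorem statement4 (n k : ℕ) (hn : 2 ≤ n) (hk : 2 ≤ k)
    (π : Fin k → E n → E (n - 1))
    (hπs : ∀ j, ContDiff ℝ (⊤ : ℕ∞) (π j))
    (hπsub : ∀ j x, Function.Surjective (fderiv ℝ (π j) x))
    (hπ0 : ∀ j, π j 0 = 0)
    (X : Fin k → E n → E n)
    (hXs : ∀ j, ContDiff ℝ (⊤ : ℕ∞) (X j))
    (hXne : ∀ j x, X j x ≠ 0)
    (htan : ∀ j x, fderiv ℝ (π j) x (X j x) = 0)
    (p : Fin k → ℝ≥0∞) (hp1 : ∀ j, 1 ≤ p j) (hp : 1 < ∑ j, (p j)⁻¹)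
    (hb : bOf p ∈ interior (newtonP n k X)) :
    ∃ U ∈ nhds (0 : E n), ∀ a : E n → ℝ,
      ContDiff ℝ (⊤ : ℕ∞) a → HasCompactSupport a → tsupport a ⊆ U →
      ∃ C : ℝ≥0, ∀ f : Fin k → E (n - 1) → ℝ, (∀ j, Measurable (f j)) →
        ENNReal.ofReal |∫ x, (∏ j, f j (π j x)) * a x| ≤
          (C : ℝ≥0∞) * ∏ j, eLpNorm (f j) (p j) volume := by
  obtain ⟨S, hS⟩ := exists_SD hn π hπs hπsub hπ0 X hXs hXne htan
  refine top_level n k π hπs X p hp1 hp hb ?_ (base_bound hn S)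
  intro I hI hl
  have hg : ∀ j, ContDiff ℝ (⊤ : ℕ∞) (fun x => X j x (S.c j)) := fun j =>
    (EuclideanSpace.proj (𝕜 := ℝ) (S.c j)).contDiff.comp (hXs j)
  obtain ⟨I1, hI1, hd1, hl1⟩ := lam_transfer S.Xt_contDiff (fun j x => X j x (S.c j)) hg hS I hI hl
  obtain ⟨I2, hI2, hd2, hl2, hmax⟩ := pot_max I1 hI1 hl1
  obtain ⟨Y⟩ := exists_layout I2 hI2
  refine QP_mono π _ _ (fun j => ?_) (QP_layout hn S hl2 (fun I'' h1 h2 h3 => hmax I'' h1 (h2.trans hd2) h3) Y)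
  rw [hd2]
  exact_mod_cast hd1 j

end
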